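/- arXiv:1705.08714 — 4 statements merged into one kernel-verified Lean document; each statement's English description precedes it below -/
import Mathlib

section
/- There is a constant K > 0 such that for all integers T ≥ 2, ∑_{b=1}^{T} τ(b²) ≤ K·T·(log T)², where τ(n) denotes the number of positive divisors of n. -/
lemma card_div_sq_le (T b : ℕ) (hb : b ∈ Finset.Icc 1 T) :
    (b ^ 2).divisors.card ≤
      ((Finset.Icc 1 T ×ˢ Finset.Icc 1 T).filter (fun p => p.1 * p.2 ∣ b)).card := by
  rw [Finset.mem_Icc] at hb
  have hb0 : 0 < b := hb.1
  refine le_trans (Finset.card_le_card ?_)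
    (Finset.card_image_le (f := fun p : ℕ × ℕ => p.1 ^ 2 * p.2))
  intro d hd
  have hdvd := Nat.dvd_of_mem_divisors hd
  obtain ⟨x, y, hxy, hx⟩ := Nat.sq_mul_squarefree d
  rw [Finset.mem_image]
  refine ⟨(y, x), ?_, hxy⟩
  have h1 : y ∣ b := by
    have : y ^ 2 ∣ b ^ 2 := (Dvd.intro _ hxy).trans hdvd
    exact (Nat.pow_dvd_pow_iff two_ne_zero).1 this
  obtain ⟨c, rfl⟩ := h1
  have hy : 0 < y := Nat.pos_of_mul_pos_right hb0
  have h2 : x ∣ c := by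
    rw [← hxy, mul_pow] at hdvd
    exact (hx.dvd_pow_iff_dvd two_ne_zero).1 (Nat.dvd_of_mul_dvd_mul_left (by positivity) hdvd)
  have h3 : y * x ∣ y * c := Nat.mul_dvd_mul_left y h2
  have hyl := Nat.le_of_dvd hb0 (Dvd.intro _ rfl : y ∣ y * c)
  have hxl := Nat.le_of_dvd hb0 ((Dvd.intro_left _ rfl : x ∣ y * x).trans h3)
  have hx0 : 0 < x := Nat.pos_of_ne_zero hx.ne_zero
  simp only [Finset.mem_filter, Finset.mem_product, Finset.mem_Icc]
  exact ⟨⟨⟨hy, hyl.trans hb.2⟩, ⟨hx0, hxl.trans hb.2⟩⟩, h3⟩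

lemma sum_le_div (T : ℕ) :
    (∑ b ∈ Finset.Icc 1 T, (b ^ 2).divisors.card) ≤
      ∑ p ∈ Finset.Icc 1 T ×ˢ Finset.Icc 1 T, T / (p.1 * p.2) := by
  refine (Finset.sum_le_sum (card_div_sq_le T)).trans ?_
  simp_rw [Finset.card_filter]
  rw [Finset.sum_comm]
  refine Finset.sum_le_sum fun p _ => ?_
  rw [← Finset.card_filter, ← Nat.Ioc_filter_dvd_card_eq_div]
  exact le_of_eq rfl

/-- `∑_{b=1}^{T} τ(b²) ≤ K·T·(log T)²`, where `τ(n)` is the number of divisors of `n`. -/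
theorem sum_tau_sq :
    ∃ K : ℝ, 0 < K ∧ ∀ T : ℕ, 2 ≤ T →
      ((∑ b ∈ Finset.Icc 1 T, (b ^ 2).divisors.card : ℕ) : ℝ)
        ≤ K * (T : ℝ) * Real.log T ^ 2 := by
  refine ⟨9, by norm_num, fun T hT => ?_⟩
  have hH : ∑ i ∈ Finset.Icc 1 T, ((i : ℝ))⁻¹ ≤ 1 + Real.log T := by
    have := harmonic_le_one_add_log T
    rw [harmonic_eq_sum_Icc] at this
    push_cast at this
    exact this
  have hH0 : 0 ≤ ∑ i ∈ Finset.Icc 1 T, ((i : ℝ))⁻¹ :=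
    Finset.sum_nonneg fun i _ => by positivity
  have hlog : Real.log 2 ≤ Real.log T :=
    Real.log_le_log (by norm_num) (by exact_mod_cast hT)
  have hl2 := Real.log_two_gt_d9
  have h3 : ∑ i ∈ Finset.Icc 1 T, ((i : ℝ))⁻¹ ≤ 3 * Real.log T := by linarith
  calc ((∑ b ∈ Finset.Icc 1 T, (b ^ 2).divisors.card : ℕ) : ℝ)
      ≤ ((∑ p ∈ Finset.Icc 1 T ×ˢ Finset.Icc 1 T, T / (p.1 * p.2) : ℕ) : ℝ) := by
        exact_mod_cast sum_le_div T
    _ ≤ ∑ p ∈ Finset.Icc 1 T ×ˢ Finset.Icc 1 T, (T : ℝ) * ((p.1 : ℝ)⁻¹ * (p.2 : ℝ)⁻¹) := by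
        rw [Nat.cast_sum]
        refine Finset.sum_le_sum fun p _ => ?_
        refine Nat.cast_div_le.trans (le_of_eq ?_)
        rw [Nat.cast_mul, div_eq_mul_inv, mul_inv]
    _ = T * (∑ i ∈ Finset.Icc 1 T, ((i : ℝ))⁻¹) ^ 2 := by
        rw [← Finset.mul_sum, sq, Finset.sum_mul_sum, Finset.sum_product]
    _ ≤ T * (3 * Real.log T) ^ 2 := by gcongr
    _ = 9 * (T : ℝ) * Real.log T ^ 2 := by ring
end

section
/- There is a constant K > 0 such that for all integers T ≥ 2 and H ≥ 2, ∑_{h=1}^{H} (1/h)·∑_{b=1}^{T} gcd(h, b²) ≤ K·T·(log H)·(log T)². -/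
lemma aux_h (m H : ℕ) (hm : 1 ≤ m) :
    ∑ h ∈ Finset.Icc 1 H, (if m ∣ h then 1 / (h : ℝ) else 0)
      ≤ (1 / (m : ℝ)) * ∑ k ∈ Finset.Icc 1 H, 1 / (k : ℝ) := by
  rw [← Finset.sum_filter, Finset.mul_sum]
  have hsub : (Finset.Icc 1 H).filter (fun h => m ∣ h) ⊆
      (Finset.Icc 1 H).image (fun k => m * k) := by
    intro h hh
    simp only [Finset.mem_filter, Finset.mem_Icc, Finset.mem_image] at hh ⊢
    obtain ⟨⟨h1, h2⟩, k, rfl⟩ := hh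
    refine ⟨k, ⟨?_, ?_⟩, rfl⟩
    · rcases Nat.eq_zero_or_pos k with h0 | h0
      · subst h0; simp at h1
      · exact h0
    · nlinarith
  refine (Finset.sum_le_sum_of_subset_of_nonneg hsub (fun i _ _ => by positivity)).trans ?_
  rw [Finset.sum_image]
  · apply le_of_eq
    refine Finset.sum_congr rfl fun k _ => ?_
    push_cast
    rw [one_div_mul_one_div]
  · intro a _ b _ hab
    exact Nat.eq_of_mul_eq_mul_left hm hab

lemma aux_b (n T : ℕ) :
    ∑ b ∈ Finset.Icc 1 T, (if n ∣ b then (1 : ℝ) else 0) ≤ (T : ℝ) / n := by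
  rw [← Finset.sum_filter, Finset.sum_const, nsmul_eq_mul, mul_one]
  have : Finset.Icc 1 T = Finset.Ioc 0 T := by ext; simp; omega
  rw [this, Nat.Ioc_filter_dvd_card_eq_div]
  exact Nat.cast_div_le

lemma aux_harm (N : ℕ) (hN : 2 ≤ N) :
    ∑ k ∈ Finset.Icc 1 N, 1 / (k : ℝ) ≤ 3 * Real.log N := by
  have h1 := harmonic_le_one_add_log N
  rw [harmonic_eq_sum_Icc] at h1
  push_cast at h1
  simp only [one_div]
  have h2 : Real.log 2 ≤ Real.log N :=
    Real.log_le_log (by norm_num) (by exact_mod_cast hN)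
  have := Real.log_two_gt_d9
  linarith

lemma aux_gcd (h b T : ℕ) (hb : b ∈ Finset.Icc 1 T) :
    (Nat.gcd h (b ^ 2) : ℝ) ≤ ∑ x ∈ Finset.Icc 1 T, ∑ y ∈ Finset.Icc 1 T,
      (if x * y ^ 2 ∣ h then 1 else 0) * (if x * y ∣ b then 1 else 0) * ((x * y ^ 2 : ℕ) : ℝ) := by
  rw [Finset.mem_Icc] at hb
  obtain ⟨s, t, hst, hs⟩ := Nat.sq_mul_squarefree (Nat.gcd h (b ^ 2))
  have hgh : s * t ^ 2 ∣ h := by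
    rw [mul_comm, hst]; exact Nat.gcd_dvd_left _ _
  have hgb : t ^ 2 * s ∣ b ^ 2 := by rw [hst]; exact Nat.gcd_dvd_right _ _
  have ht : t ∣ b := (Nat.pow_dvd_pow_iff two_ne_zero).1 ((Dvd.intro _ rfl).trans hgb)
  obtain ⟨c, rfl⟩ := ht
  have ht0 : 0 < t := by
    rcases Nat.eq_zero_or_pos t with h0 | h0
    · subst h0; simp at hb
    · exact h0
  have hsc : s ∣ c := by
    rw [mul_pow] at hgb
    exact (hs.dvd_pow_iff_dvd two_ne_zero).1 (Nat.dvd_of_mul_dvd_mul_left (by positivity) hgb)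
  have hd : s * t ∣ t * c := by rw [mul_comm]; exact Nat.mul_dvd_mul_left t hsc
  have hs0 : 0 < s := Nat.pos_of_ne_zero hs.ne_zero
  have hle := Nat.le_of_dvd (by omega) hd
  have hsm : s ∈ Finset.Icc 1 T := by rw [Finset.mem_Icc]; constructor <;> nlinarith
  have htm : t ∈ Finset.Icc 1 T := by rw [Finset.mem_Icc]; constructor <;> nlinarith
  have hnn : ∀ x y : ℕ, (0 : ℝ) ≤ (if x * y ^ 2 ∣ h then 1 else 0) *
      (if x * y ∣ t * c then 1 else 0) * ((x * y ^ 2 : ℕ) : ℝ) := by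
    intro x y
    refine mul_nonneg (mul_nonneg ?_ ?_) (by positivity) <;> split_ifs <;> norm_num
  refine le_trans ?_ (Finset.single_le_sum (fun x _ => Finset.sum_nonneg fun y _ => hnn x y) hsm)
  refine le_trans ?_ (Finset.single_le_sum (fun y _ => hnn s y) htm)
  rw [if_pos hgh, if_pos hd, ← hst, mul_comm s]
  simp

/-- `∑_{h=1}^{H} (1/h)·∑_{b=1}^{T} gcd(h, b²) ≤ K·T·(log H)·(log T)²`. -/
theorem sum_gcd_bound :
    ∃ K : ℝ, 0 < K ∧ ∀ T H : ℕ, 2 ≤ T → 2 ≤ H →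
      ∑ h ∈ Finset.Icc 1 H, (1 / (h : ℝ))
          * ∑ b ∈ Finset.Icc 1 T, (Nat.gcd h (b ^ 2) : ℝ)
        ≤ K * (T : ℝ) * Real.log H * Real.log T ^ 2 := by
  refine ⟨27, by norm_num, fun T H hT hH => ?_⟩
  set S : ℕ → ℝ := fun N => ∑ k ∈ Finset.Icc 1 N, 1 / (k : ℝ) with hS
  have hS0 : ∀ N, 0 ≤ S N := fun N => Finset.sum_nonneg fun k _ => by positivity
  have key : ∑ h ∈ Finset.Icc 1 H, (1 / (h : ℝ))
          * ∑ b ∈ Finset.Icc 1 T, (Nat.gcd h (b ^ 2) : ℝ) ≤ T * S H * (S T * S T) := by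
    calc _ ≤ ∑ h ∈ Finset.Icc 1 H, (1 / (h : ℝ)) * ∑ b ∈ Finset.Icc 1 T,
          ∑ x ∈ Finset.Icc 1 T, ∑ y ∈ Finset.Icc 1 T,
          (if x * y ^ 2 ∣ h then 1 else 0) * (if x * y ∣ b then 1 else 0)
            * ((x * y ^ 2 : ℕ) : ℝ) := by
          refine Finset.sum_le_sum fun h _ => mul_le_mul_of_nonneg_left ?_ (by positivity)
          exact Finset.sum_le_sum fun b hb => aux_gcd h b T hb
      _ = ∑ x ∈ Finset.Icc 1 T, ∑ y ∈ Finset.Icc 1 T, ((x * y ^ 2 : ℕ) : ℝ) *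
          ((∑ h ∈ Finset.Icc 1 H, (if x * y ^ 2 ∣ h then 1 / (h : ℝ) else 0)) *
          ∑ b ∈ Finset.Icc 1 T, (if x * y ∣ b then (1 : ℝ) else 0)) := by
          simp only [Finset.sum_mul_sum]
          simp only [Finset.mul_sum]
          rw [Finset.sum_congr rfl fun h _ => Finset.sum_comm]
          rw [Finset.sum_comm]
          refine Finset.sum_congr rfl fun x _ => ?_
          rw [Finset.sum_congr rfl fun h _ => Finset.sum_comm]
          rw [Finset.sum_comm]
          refine Finset.sum_congr rfl fun y _ => ?_
          refine Finset.sum_congr rfl fun h _ => ?_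
          refine Finset.sum_congr rfl fun b _ => ?_
          split_ifs <;> ring
      _ ≤ ∑ x ∈ Finset.Icc 1 T, ∑ y ∈ Finset.Icc 1 T,
          (T * S H) * ((1 / (x : ℝ)) * (1 / (y : ℝ))) := by
          refine Finset.sum_le_sum fun x hx => Finset.sum_le_sum fun y hy => ?_
          rw [Finset.mem_Icc] at hx hy
          have hx0 : 0 < x := hx.1
          have hy0 : 0 < y := hy.1
          have hm : 1 ≤ x * y ^ 2 := Nat.succ_le_of_lt (by positivity)
          have h1 := aux_h (x * y ^ 2) H hm
          have h2 := aux_b (x * y) T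
          have h3 := mul_le_mul h1 h2
            (Finset.sum_nonneg fun b _ => by split_ifs <;> norm_num)
            (mul_nonneg (by positivity) (hS0 H))
          refine (mul_le_mul_of_nonneg_left h3 (Nat.cast_nonneg _)).trans (le_of_eq ?_)
          change _ * (_ * S H * _) = _
          have : (x : ℝ) ≠ 0 := by positivity
          have : (y : ℝ) ≠ 0 := by positivity
          push_cast
          field_simp
      _ = T * S H * (S T * S T) := by
          rw [hS]
          simp only [Finset.sum_mul_sum]
          simp only [Finset.mul_sum]
  refine key.trans ?_
  have hA := aux_harm H hH
  have hB := aux_harm T hT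
  have hlT : 0 ≤ Real.log T := Real.log_natCast_nonneg T
  have hlH : 0 ≤ Real.log H := Real.log_natCast_nonneg H
  calc T * S H * (S T * S T) ≤ T * (3 * Real.log H) * ((3 * Real.log T) * (3 * Real.log T)) := by
        have := hS0 T
        have := hS0 H
        gcongr
    _ = _ := by ring
end

section
/- There is a constant K > 0 such that for all integers T ≥ 1, ∑_{d=1}^{T} |M(⌊T/d⌋)| ≤ K·T, where M is the Mertens function. -/
/-- The Mertens function `M(n) = ∑_{1 ≤ k ≤ n} μ(k)`. -/
def mertens (n : ℕ) : ℤ := ∑ k ∈ Finset.Icc 1 n, ArithmeticFunction.moebius k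

open MeasureTheory FourierTransform SchwartzMap in
/-- Plancherel for `L1 ∩ L2` when the transform is in `L2`. -/
lemma plancherel_aux (g : ℝ → ℂ) (h1 : Integrable g) (h2 : MemLp g 2)
    (h3 : MemLp (𝓕 g) 2) : eLpNorm g 2 = eLpNorm (𝓕 g) 2 := by
  have key : 𝓕 (h2.toLp g) = h3.toLp (𝓕 g) := by
    have hinj := LinearMap.ker_eq_bot.mp
      (Lp.ker_toTemperedDistributionCLM_eq_bot (F := ℂ) (μ := (volume : Measure ℝ)) (p := 2))
    apply hinj
    change (Lp.toTemperedDistribution (𝓕 (h2.toLp g)) : 𝓢'(ℝ, ℂ)) =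
      Lp.toTemperedDistribution (h3.toLp (𝓕 g))
    rw [← Lp.fourier_toTemperedDistribution_eq]
    ext φ
    rw [TemperedDistribution.fourier_apply, Lp.toTemperedDistribution_apply,
      Lp.toTemperedDistribution_apply]
    have e1 : ∫ x, (𝓕 φ) x • (h2.toLp g) x = ∫ x, (𝓕 φ) x • g x := by
      apply integral_congr_ae
      filter_upwards [h2.coeFn_toLp] with x hx
      rw [hx]
    have e2 : ∫ x, φ x • (h3.toLp (𝓕 g)) x = ∫ x, φ x • (𝓕 g) x := by
      apply integral_congr_ae
      filter_upwards [h3.coeFn_toLp] with x hx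
      rw [hx]
    rw [e1, e2]
    have := VectorFourier.integral_fourierIntegral_smul_eq_flip (L := innerₗ ℝ)
      (μ := volume) (ν := volume) Real.continuous_fourierChar continuous_inner φ.integrable h1
    rw [flip_innerₗ] at this
    exact this
  have h := Lp.norm_fourier_eq (h2.toLp g)
  rw [key, Lp.norm_toLp, Lp.norm_toLp] at h
  exact ((ENNReal.toReal_eq_toReal_iff' h3.2.ne h2.2.ne).mp h).symm

open MeasureTheory FourierTransform in
lemma plancherel_le (g : ℝ → ℂ) (h1 : Integrable g) (h2 : Integrable (fun x => ‖g x‖ ^ 2))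
    (h3 : Integrable (fun x => ‖𝓕 g x‖ ^ 2)) :
    ∫ x, ‖g x‖ ^ 2 = ∫ x, ‖𝓕 g x‖ ^ 2 := by
  have hc : Continuous (𝓕 g) := by
    exact VectorFourier.fourierIntegral_continuous Real.continuous_fourierChar
      (by exact continuous_inner) h1
  have m2 : MemLp g 2 := (memLp_two_iff_integrable_sq_norm h1.1).mpr h2
  have m3 : MemLp (𝓕 g) 2 := (memLp_two_iff_integrable_sq_norm hc.aestronglyMeasurable).mpr h3
  have := plancherel_aux g h1 m2 m3
  have a := m2.eLpNorm_eq_integral_rpow_norm (by norm_num) (by norm_num)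
  have b := m3.eLpNorm_eq_integral_rpow_norm (by norm_num) (by norm_num)
  rw [a, b] at this
  simp only [ENNReal.toReal_ofNat, Real.rpow_ofNat] at this
  have hA : 0 ≤ ∫ x, ‖g x‖ ^ 2 := integral_nonneg fun _ => by positivity
  have hB : 0 ≤ ∫ x, ‖𝓕 g x‖ ^ 2 := integral_nonneg fun _ => by positivity
  rw [ENNReal.ofReal_eq_ofReal_iff (by positivity) (by positivity)] at this
  exact (Real.rpow_left_inj hA hB (by norm_num)).mp this

/-- entire summand: `(s-1) n^{-s} + (n+1)^{1-s} - n^{1-s}`, with `n = k+1` -/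
noncomputable def hTerm (k : ℕ) (s : ℂ) : ℂ :=
  (s - 1) * (((k : ℝ) + 1 : ℝ) : ℂ) ^ (-s) + (((k : ℝ) + 2 : ℝ) : ℂ) ^ (1 - s)
    - (((k : ℝ) + 1 : ℝ) : ℂ) ^ (1 - s)

lemma hasDerivAt_ofReal_cpow_pos (c : ℂ) (x : ℝ) (hx : 0 < x) :
    HasDerivAt (fun y : ℝ => (y : ℂ) ^ c) (c * (x : ℂ) ^ (c - 1)) x := by
  have := (hasDerivAt_id (x : ℂ)).cpow_const (c := c) (Or.inl (by simpa using hx))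
  simpa using this.comp_ofReal

lemma diff_cpow_bound (s : ℂ) (hs : 0 < s.re) (n u : ℝ) (hn : 1 ≤ n) (hu : n ≤ u)
    (hu' : u ≤ n + 1) (θ : ℝ) (h0 : 0 ≤ θ) (h1 : θ ≤ 1) :
    ‖(n : ℂ) ^ (-s) - (u : ℂ) ^ (-s)‖ ≤ 2 * ‖s‖ ^ θ * n ^ (-s.re - θ) := by
  have hn0 : 0 < n := by linarith
  have hu0 : 0 < u := by linarith
  have hs0 : 0 < ‖s‖ := norm_pos_iff.mpr (by rintro rfl; simp at hs)
  have hA : (0:ℝ) < n ^ (-s.re) := by positivity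
  have b1 : ‖(n : ℂ) ^ (-s) - (u : ℂ) ^ (-s)‖ ≤ 2 * n ^ (-s.re) := by
    refine (norm_sub_le _ _).trans ?_
    rw [Complex.norm_cpow_eq_rpow_re_of_pos hn0, Complex.norm_cpow_eq_rpow_re_of_pos hu0]
    have := Real.rpow_le_rpow_of_nonpos hn0 hu (z := -s.re) (by linarith)
    simp only [Complex.neg_re]
    linarith
  have b2 : ‖(n : ℂ) ^ (-s) - (u : ℂ) ^ (-s)‖ ≤ n ^ (-s.re) * (‖s‖ / n) := by
    have hd : ∀ x ∈ Set.Icc n u, HasDerivWithinAt (fun x : ℝ => (x : ℂ) ^ (-s))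
        (-s * (x : ℂ) ^ (-s - 1)) (Set.Icc n u) x := by
      intro x hx
      have hx0 : 0 < x := by linarith [hx.1]
      exact (hasDerivAt_ofReal_cpow_pos (-s) x hx0).hasDerivWithinAt
    have := norm_image_sub_le_of_norm_deriv_le_segment' hd (C := ‖s‖ * n ^ (-s.re - 1)) (by
      intro x hx
      have hx0 : 0 < x := by linarith [hx.1]
      rw [norm_mul, norm_neg, Complex.norm_cpow_eq_rpow_re_of_pos hx0]
      simp only [Complex.sub_re, Complex.neg_re, Complex.one_re]
      have := Real.rpow_le_rpow_of_nonpos hn0 hx.1 (z := -s.re - 1) (by linarith)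
      gcongr) u ⟨hu, le_rfl⟩
    rw [norm_sub_rev]
    refine this.trans ?_
    rw [Real.rpow_sub hn0, Real.rpow_one]
    calc _ ≤ ‖s‖ * (n ^ (-s.re) / n) * 1 := by gcongr; linarith
      _ = _ := by ring
  have e : n ^ (-s.re - θ) = n ^ (-s.re) / n ^ θ := Real.rpow_sub hn0 _ _
  have e2 : 2 * ‖s‖ ^ θ * n ^ (-s.re - θ) = 2 * n ^ (-s.re) * (‖s‖ / n) ^ θ := by
    rw [e, Real.div_rpow hs0.le hn0.le]; ring
  rw [e2]
  rcases le_total (‖s‖ / n) 1 with hx | hx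
  · refine b2.trans ?_
    have : ‖s‖ / n ≤ (‖s‖ / n) ^ θ := by
      have := Real.rpow_le_rpow_of_exponent_ge (by positivity) hx h1
      simpa using this
    have h3 : 0 ≤ (‖s‖ / n) ^ θ := by positivity
    nlinarith
  · refine b1.trans ?_
    have : 1 ≤ (‖s‖ / n) ^ θ := Real.one_le_rpow hx h0
    nlinarith

lemma hTerm_bound (k : ℕ) (s : ℂ) (hs : 0 < s.re) (θ : ℝ) (h0 : 0 ≤ θ) (h1 : θ ≤ 1) :
    ‖hTerm k s‖ ≤ 2 * ‖s - 1‖ * ‖s‖ ^ θ * ((k : ℝ) + 1) ^ (-s.re - θ) := by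
  set n : ℝ := (k : ℝ) + 1 with hn
  have hn1 : 1 ≤ n := by simp [hn]
  have hd : ∀ x ∈ Set.Icc n (n + 1), HasDerivWithinAt
      (fun x : ℝ => (s - 1) * (n : ℂ) ^ (-s) * (x : ℂ) + (x : ℂ) ^ (1 - s))
        ((s - 1) * ((n : ℂ) ^ (-s) - (x : ℂ) ^ (-s))) (Set.Icc n (n + 1)) x := by
    intro x hx
    have hx0 : 0 < x := by linarith [hx.1]
    have a := hasDerivAt_ofReal_cpow_pos (1 - s) x hx0
    have b := (hasDerivAt_id' x).ofReal_comp.const_mul ((s - 1) * (n : ℂ) ^ (-s))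
    convert! (b.add a).hasDerivWithinAt using 1
    simp only [Complex.ofReal_one, mul_one, show (1 - s - 1 : ℂ) = -s by ring]
    ring
  have := norm_image_sub_le_of_norm_deriv_le_segment' hd
    (C := ‖s - 1‖ * (2 * ‖s‖ ^ θ * n ^ (-s.re - θ))) (by
      intro x hx
      rw [norm_mul]
      gcongr
      exact diff_cpow_bound s hs n x hn1 hx.1 hx.2.le θ h0 h1) (n + 1) ⟨by linarith, le_rfl⟩
  convert! this using 1
  · congr 1
    simp only [hTerm, ← hn, show (k : ℝ) + 2 = n + 1 by rw [hn]; ring]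
    push_cast
    ring
  · ring

lemma hTerm_differentiable (k : ℕ) : Differentiable ℂ (hTerm k) := by
  have h1 : (((k : ℝ) + 1 : ℝ) : ℂ) ≠ 0 := by norm_cast
  have h2 : (((k : ℝ) + 2 : ℝ) : ℂ) ≠ 0 := by norm_cast
  unfold hTerm
  intro s
  apply DifferentiableAt.sub
  · apply DifferentiableAt.add
    · exact (by fun_prop : DifferentiableAt ℂ (fun s : ℂ => s - 1) s).mul
        ((by fun_prop : DifferentiableAt ℂ (fun s : ℂ => -s) s).const_cpow (Or.inl h1))
    · exact (by fun_prop : DifferentiableAt ℂ (fun s : ℂ => 1 - s) s).const_cpow (Or.inl h2)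
  · exact (by fun_prop : DifferentiableAt ℂ (fun s : ℂ => 1 - s) s).const_cpow (Or.inl h1)

lemma hTerm_hasSum (s : ℂ) (hs : 1 < s.re) : HasSum (fun k => hTerm k s) (riemannZeta₁ s - 1) := by
  have hs1 : s ≠ 1 := by rintro rfl; simp at hs
  have hz : HasSum (fun k : ℕ => (s - 1) * (((k : ℝ) + 1 : ℝ) : ℂ) ^ (-s))
      ((s - 1) * riemannZeta s) := by
    apply HasSum.mul_left
    rw [zeta_eq_tsum_one_div_nat_add_one_cpow hs]
    have h := (summable_nat_add_iff 1).mpr (Complex.summable_one_div_nat_cpow.mpr hs)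
    convert! h.hasSum using 1
    · ext k
      rw [Complex.cpow_neg]; push_cast; simp
    · push_cast; rfl
  have ht : HasSum (fun k : ℕ => (((k : ℝ) + 2 : ℝ) : ℂ) ^ (1 - s)
    - (((k : ℝ) + 1 : ℝ) : ℂ) ^ (1 - s)) (-1) := by
    have hsum : Summable (fun k : ℕ => (((k : ℝ) + 2 : ℝ) : ℂ) ^ (1 - s)
    - (((k : ℝ) + 1 : ℝ) : ℂ) ^ (1 - s)) := by
      have hsm : Summable (fun k => hTerm k s) := by
        refine Summable.of_norm_bounded (g := fun k : ℕ => 2 * ‖s - 1‖ * ‖s‖ ^ (0:ℝ) *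
          ((k : ℝ) + 1) ^ (-s.re - 0)) ?_ (fun k => hTerm_bound k s (by linarith) 0 le_rfl zero_le_one)
        apply Summable.mul_left
        have := (summable_nat_add_iff 1).mpr (Real.summable_nat_rpow.mpr (by linarith : -s.re - 0 < -1))
        simpa using this
      refine (hsm.sub hz.summable).congr fun k => ?_
      simp only [hTerm]; ring
    rw [hsum.hasSum_iff_tendsto_nat]
    have e : ∀ n : ℕ, ∑ k ∈ Finset.range n, ((((k : ℝ) + 2 : ℝ) : ℂ) ^ (1 - s)
        - (((k : ℝ) + 1 : ℝ) : ℂ) ^ (1 - s)) = (((n : ℝ) + 1 : ℝ) : ℂ) ^ (1 - s) - 1 := by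
      intro n
      have := Finset.sum_range_sub (fun k : ℕ => (((k : ℝ) + 1 : ℝ) : ℂ) ^ (1 - s)) n
      simp only [Nat.cast_zero, zero_add, Complex.ofReal_one, Complex.one_cpow] at this
      rw [← this]
      refine Finset.sum_congr rfl fun k _ => ?_
      push_cast
      ring_nf
    simp_rw [e]
    have : Filter.Tendsto (fun n : ℕ => (((n : ℝ) + 1 : ℝ) : ℂ) ^ (1 - s)) Filter.atTop (nhds 0) := by
      rw [tendsto_zero_iff_norm_tendsto_zero]
      have e2 : ∀ n : ℕ, ‖(((n : ℝ) + 1 : ℝ) : ℂ) ^ (1 - s)‖ = ((n : ℝ) + 1) ^ (-(s.re - 1)) := by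
        intro n
        rw [Complex.norm_cpow_eq_rpow_re_of_pos (by positivity)]
        simp
      simp_rw [e2]
      exact (tendsto_rpow_neg_atTop (by linarith : 0 < s.re - 1)).comp
        (Filter.tendsto_atTop_add_const_right _ _ tendsto_natCast_atTop_atTop)
    simpa using this.sub_const 1
  convert! hz.add ht using 1
  · ext k; simp only [hTerm]; ring
  · rw [riemannZeta_eq_inv_sub_mul hs1, ← mul_assoc, mul_inv_cancel₀ (sub_ne_zero.mpr hs1)]; ring

/-- Growth bound for `ζ₁`. -/
lemma zeta1_bound : ∃ Z : ℝ, 1 ≤ Z ∧ ∀ s : ℂ, 1 - 1/72 < s.re →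
    ‖riemannZeta₁ s - 1‖ ≤ Z * ‖s - 1‖ * ‖s‖ ^ (1/36 : ℝ) := by
  have hsm : Summable (fun k : ℕ => ((k : ℝ) + 1) ^ (-(1 + 1/72) : ℝ)) := by
    have := (summable_nat_add_iff 1).mpr (Real.summable_nat_rpow.mpr
      (by norm_num : (-(1 + 1/72) : ℝ) < -1))
    simpa using this
  set W := ∑' k : ℕ, ((k : ℝ) + 1) ^ (-(1 + 1/72) : ℝ) with hW
  have hW0 : 0 ≤ W := tsum_nonneg fun k => by positivity
  have hb : ∀ (k : ℕ) (s : ℂ), 1 - 1/72 < s.re →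
      ‖hTerm k s‖ ≤ (2 * ‖s - 1‖ * ‖s‖ ^ (1/36 : ℝ)) * ((k : ℝ) + 1) ^ (-(1 + 1/72) : ℝ) := by
    intro k s hs
    refine (hTerm_bound k s (by linarith) (1/36) (by norm_num) (by norm_num)).trans ?_
    gcongr
    · simp
    · linarith
  have hopen : IsOpen {s : ℂ | 1 - 1/72 < s.re} := isOpen_lt continuous_const Complex.continuous_re
  have hdiff : DifferentiableOn ℂ (fun s => ∑' k, hTerm k s) {s : ℂ | 1 - 1/72 < s.re} := by
    intro s hs
    have ho2 : IsOpen ({s : ℂ | 1 - 1/72 < s.re} ∩ Metric.ball s 1) := hopen.inter Metric.isOpen_ball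
    have := Complex.differentiableOn_tsum_of_summable_norm (F := fun k s => hTerm k s)
      (u := fun k : ℕ => (2 * (‖s‖ + 2) * (‖s‖ + 1) ^ (1/36 : ℝ)) * ((k : ℝ) + 1) ^ (-(1 + 1/72) : ℝ))
      (hsm.mul_left _) (fun k => (hTerm_differentiable k).differentiableOn) ho2 (by
        intro k w hw
        refine (hb k w hw.1).trans ?_
        have h1 : ‖w‖ ≤ ‖s‖ + 1 := by
          have := hw.2
          rw [mem_ball_iff_norm] at this
          have h2 := norm_sub_norm_le w s
          linarith
        have h2 : ‖w - 1‖ ≤ ‖s‖ + 2 := by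
          have := norm_sub_le w 1
          simp at this; linarith
        gcongr)
    exact ((this s ⟨hs, Metric.mem_ball_self one_pos⟩).differentiableAt
      (ho2.mem_nhds ⟨hs, Metric.mem_ball_self one_pos⟩)).differentiableWithinAt
  have heq : Set.EqOn (fun s => ∑' k, hTerm k s) (fun s => riemannZeta₁ s - 1)
      {s : ℂ | 1 - 1/72 < s.re} := by
    refine AnalyticOnNhd.eqOn_of_preconnected_of_eventuallyEq (𝕜 := ℂ) (z₀ := 2)
      (hdiff.analyticOnNhd hopen)
      ((differentiable_riemannZeta₁.sub_const 1).differentiableOn.analyticOnNhd hopen)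
      (convex_halfSpace_re_gt _).isPreconnected (by norm_num) ?_
    have : {s : ℂ | 1 < s.re} ∈ nhds (2:ℂ) :=
        (isOpen_lt continuous_const Complex.continuous_re).mem_nhds (by simp)
    filter_upwards [this] with s hs
    exact (hTerm_hasSum s hs).tsum_eq
  refine ⟨2 * W + 1, by linarith, fun s hs => ?_⟩
  have := heq hs
  simp only at this
  rw [← this]
  have h := tsum_of_norm_bounded ((hsm.mul_left (2 * ‖s - 1‖ * ‖s‖ ^ (1/36 : ℝ))).hasSum)
    (fun k => hb k s hs)
  refine h.trans ?_
  rw [tsum_mul_left, ← hW]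
  have : 0 ≤ ‖s - 1‖ * ‖s‖ ^ (1/36 : ℝ) := by positivity
  nlinarith

lemma rpow_theta_le (c x : ℝ) (hc : 1 ≤ c) (hx : 0 ≤ x) :
    (c * x) ^ (1/36 : ℝ) ≤ c * x ^ (1/36 : ℝ) := by
  rw [Real.mul_rpow (by linarith) hx]
  gcongr
  have := Real.rpow_le_rpow_of_exponent_le hc (show (1/36 : ℝ) ≤ 1 by norm_num)
  simpa using this

lemma zeta_le_of_zeta1 (Z : ℝ) (hZ : ∀ s : ℂ, 1 - 1/72 < s.re →
    ‖riemannZeta₁ s - 1‖ ≤ Z * ‖s - 1‖ * ‖s‖ ^ (1/36 : ℝ)) (s : ℂ) (hs : 1 - 1/72 < s.re)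
    (h1 : s ≠ 1) : ‖riemannZeta s‖ ≤ 1 / ‖s - 1‖ + Z * ‖s‖ ^ (1/36 : ℝ) := by
  have hp : 0 < ‖s - 1‖ := norm_pos_iff.mpr (sub_ne_zero.mpr h1)
  rw [riemannZeta_eq_inv_sub_mul h1, norm_mul, norm_inv, inv_mul_eq_div, div_le_iff₀ hp, add_mul,
    div_mul_cancel₀ _ hp.ne']
  have h2 := hZ s hs
  have h3 := norm_add_le (riemannZeta₁ s - 1) 1
  simp only [sub_add_cancel, norm_one] at h3
  linarith

lemma zeta_bound : ∃ C : ℝ, 1 ≤ C ∧ ∀ s : ℂ, 1 - 1/72 < s.re → s.re ≤ 3 → 1/2 ≤ |s.im| →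
    ‖riemannZeta s‖ ≤ C * (1 + |s.im|) ^ (1/36 : ℝ) := by
  obtain ⟨Z, hZ1, hZ⟩ := zeta1_bound
  refine ⟨2 + 3 * Z, by linarith, fun s hs hs3 ht => ?_⟩
  have hs1 : s ≠ 1 := by rintro rfl; norm_num at ht
  have hp : 1/2 ≤ ‖s - 1‖ := by
    have := Complex.abs_im_le_norm (s - 1)
    simp at this; linarith
  have h := zeta_le_of_zeta1 Z hZ s hs hs1
  have hn : ‖s‖ ≤ 3 * (1 + |s.im|) := by
    have := Complex.norm_le_abs_re_add_abs_im s
    rw [abs_of_pos (by linarith : 0 < s.re)] at this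
    linarith [abs_nonneg s.im]
  have h4 : ‖s‖ ^ (1/36 : ℝ) ≤ 3 * (1 + |s.im|) ^ (1/36 : ℝ) :=
    (Real.rpow_le_rpow (norm_nonneg _) hn (by norm_num)).trans
      (rpow_theta_le 3 _ (by norm_num) (by positivity))
  have h5 : 1 / ‖s - 1‖ ≤ 2 := by
    rw [div_le_iff₀ (by linarith)]; linarith
  have h6 : 1 ≤ (1 + |s.im|) ^ (1/36 : ℝ) :=
    Real.one_le_rpow (by linarith [abs_nonneg s.im]) (by norm_num)
  nlinarith

lemma zeta_near_one : ∃ C : ℝ, 1 ≤ C ∧ ∀ x : ℝ, 0 < x → x ≤ 1 →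
    ‖riemannZeta (1 + x)‖ ≤ C / x := by
  obtain ⟨Z, hZ1, hZ⟩ := zeta1_bound
  refine ⟨1 + 2 * Z, by linarith, fun x hx hx1 => ?_⟩
  have h := zeta_le_of_zeta1 Z hZ (1 + x) (by simp; linarith) (by simpa using hx.ne')
  have e : ‖(1 + x : ℂ) - 1‖ = x := by simp [abs_of_pos hx]
  have e2 : ‖(1 + x : ℂ)‖ = 1 + x := by
    rw [show (1 + x : ℂ) = ((1 + x : ℝ) : ℂ) by push_cast; rfl, Complex.norm_real,
      Real.norm_of_nonneg (by linarith)]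
  rw [e, e2] at h
  have h4 : (1 + x) ^ (1/36 : ℝ) ≤ 2 := by
    have := Real.rpow_le_rpow_of_exponent_le (by linarith : 1 ≤ 1 + x) (show (1/36 : ℝ) ≤ 1 by norm_num)
    rw [Real.rpow_one] at this; linarith
  refine h.trans ?_
  rw [add_div]
  have : 2 * Z ≤ 2 * Z / x := by
    rw [le_div_iff₀ hx]; nlinarith
  nlinarith

lemma zeta_deriv_bound : ∃ D : ℝ, 1 ≤ D ∧ ∀ s : ℂ, 1 ≤ s.re → s.re ≤ 2 → 1 ≤ |s.im| →
    ‖deriv riemannZeta s‖ ≤ D * (1 + |s.im|) ^ (1/36 : ℝ) := by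
  obtain ⟨C, hC1, hC⟩ := zeta_bound
  refine ⟨2 * C * 100, by linarith, fun s hs hs2 ht => ?_⟩
  have key : ∀ z ∈ Metric.closedBall s (1/100), 1 - 1/72 < z.re ∧ z.re ≤ 3 ∧ 1/2 ≤ |z.im| ∧
      |z.im| ≤ 1 + |s.im| := by
    intro z hz
    rw [mem_closedBall_iff_norm] at hz
    have h1 := (Complex.abs_re_le_norm (z - s)).trans hz
    have h2 := (Complex.abs_im_le_norm (z - s)).trans hz
    rw [Complex.sub_re, abs_le] at h1
    rw [Complex.sub_im] at h2
    have h3 := abs_sub_abs_le_abs_sub z.im s.im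
    have h4 := abs_sub_abs_le_abs_sub s.im z.im
    rw [abs_sub_comm] at h4
    refine ⟨by linarith, by linarith, by linarith, by linarith⟩
  have h := Complex.norm_deriv_le_of_forall_mem_sphere_norm_le (f := riemannZeta) (c := s)
    (R := 1/100) (C := 2 * C * (1 + |s.im|) ^ (1/36 : ℝ)) (by norm_num) (by
      apply DifferentiableOn.diffContOnCl
      rw [closure_ball _ (by norm_num)]
      intro z hz
      apply (differentiableAt_riemannZeta ?_).differentiableWithinAt
      rintro rfl
      have := (key 1 hz).2.2.1
      norm_num at this) (by
      intro z hz
      obtain ⟨a, b, c, d⟩ := key z (Metric.sphere_subset_closedBall hz)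
      refine (hC z a b c).trans ?_
      have : (1 + |z.im|) ^ (1/36 : ℝ) ≤ 2 * (1 + |s.im|) ^ (1/36 : ℝ) :=
        (Real.rpow_le_rpow (by positivity) (by linarith) (by norm_num)).trans
          (rpow_theta_le 2 _ (by norm_num) (by positivity))
      nlinarith)
  refine h.trans (le_of_eq ?_)
  ring

lemma zeta_341 (x : ℝ) (hx : 0 < x) (t : ℝ) :
    1 ≤ ‖riemannZeta (1 + x)‖ ^ 3 * ‖riemannZeta (1 + x + Complex.I * t)‖ ^ 4 *
      ‖riemannZeta (1 + x + 2 * Complex.I * t)‖ := by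
  have := DirichletCharacter.norm_LFunction_product_ge_one (N := 1) 1 hx t
  simpa [DirichletCharacter.LFunctionTrivChar, DirichletCharacter.LFunction_modOne_eq] using this

/-- lower bound to the right of the line -/
lemma zeta_lower_aux : ∃ κ : ℝ, 0 < κ ∧ κ ≤ 1 ∧ ∀ (y t : ℝ), 0 < y → y ≤ 1 → 1 ≤ |t| →
    κ * y ^ 3 / (1 + |t|) ^ (1/144 : ℝ) ≤ ‖riemannZeta (1 + (y ^ 4 : ℝ) + Complex.I * t)‖ := by
  obtain ⟨C, hC1, hC⟩ := zeta_bound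
  obtain ⟨B, hB1, hB⟩ := zeta_near_one
  refine ⟨1 / (B ^ 3 * (2 * C)), by positivity, ?_, fun y t hy hy1 ht => ?_⟩
  · rw [div_le_one (by positivity)]
    have : 1 ≤ B ^ 3 := one_le_pow₀ hB1
    nlinarith
  have h := zeta_341 (y ^ 4) (by positivity) t
  have hx1 : y ^ 4 ≤ 1 := pow_le_one₀ hy.le hy1
  have h1 := hB (y ^ 4) (by positivity) hx1
  have h2 := hC (1 + (y ^ 4 : ℝ) + 2 * Complex.I * t) (by simp [-Complex.ofReal_pow]; nlinarith [pow_pos hy 4])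
    (by simp [-Complex.ofReal_pow]; linarith) (by simp [-Complex.ofReal_pow, abs_mul]; linarith)
  set ρ := (1 + |t|) ^ (1/144 : ℝ) with hρ
  have hρ1 : 1 ≤ ρ := Real.one_le_rpow (by linarith [abs_nonneg t]) (by norm_num)
  have hρ4 : (1 + |t|) ^ (1/36 : ℝ) = ρ ^ 4 := by
    rw [hρ, ← Real.rpow_natCast, ← Real.rpow_mul (by positivity)]; norm_num
  have h3 : ‖riemannZeta (1 + (y ^ 4 : ℝ) + 2 * Complex.I * t)‖ ≤ 2 * C * ρ ^ 4 := by
    refine h2.trans ?_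
    have e : (1 + (y ^ 4 : ℝ) + 2 * Complex.I * t : ℂ).im = 2 * t := by simp [-Complex.ofReal_pow]
    rw [e, ← hρ4]
    have : (1 + |2 * t|) ^ (1/36 : ℝ) ≤ 2 * (1 + |t|) ^ (1/36 : ℝ) := by
      refine (Real.rpow_le_rpow (by positivity) ?_ (by norm_num)).trans
          (rpow_theta_le 2 _ (by norm_num) (by positivity))
      rw [abs_mul]; norm_num; linarith
    nlinarith
  set w := ‖riemannZeta (1 + (y ^ 4 : ℝ) + Complex.I * t)‖ with hw
  have h4 : 1 ≤ (B / y ^ 4) ^ 3 * w ^ 4 * (2 * C * ρ ^ 4) := by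
    refine h.trans ?_
    gcongr
  have h5 : (1 / (B ^ 3 * (2 * C)) * y ^ 3 / ρ) ^ 4 ≤ w ^ 4 := by
    have : y ^ 12 ≤ (B ^ 3 * (2 * C)) * ρ ^ 4 * w ^ 4 := by
      have := mul_le_mul_of_nonneg_left h4 (by positivity : 0 ≤ y ^ 12)
      rw [mul_one] at this
      refine this.trans (le_of_eq ?_)
      field_simp
    have hE : 1 ≤ B ^ 3 * (2 * C) := by
      have : 1 ≤ B ^ 3 := one_le_pow₀ hB1
      nlinarith
    set E := B ^ 3 * (2 * C)
    calc (1 / E * y ^ 3 / ρ) ^ 4 = y ^ 12 / (E ^ 4 * ρ ^ 4) := by field_simp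
      _ ≤ (E * ρ ^ 4 * w ^ 4) / (E ^ 4 * ρ ^ 4) := by gcongr
      _ = w ^ 4 / E ^ 3 := by field_simp
      _ ≤ w ^ 4 := div_le_self (by positivity) (one_le_pow₀ hE)
  exact (pow_le_pow_iff_left₀ (by positivity) (norm_nonneg _) (by norm_num)).mp h5

lemma zeta_lower : ∃ c : ℝ, 0 < c ∧ ∀ s : ℂ, 1 < s.re → s.re ≤ 2 → 1 ≤ |s.im| →
    c / (1 + |s.im|) ^ (1/9 : ℝ) ≤ ‖riemannZeta s‖ := by
  obtain ⟨κ, hκ0, hκ1, hκ⟩ := zeta_lower_aux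
  obtain ⟨D, hD1, hD⟩ := zeta_deriv_bound
  refine ⟨κ * (κ / (2 * D)) ^ 3 / 2, by positivity, fun s hs hs2 ht => ?_⟩
  set t := s.im
  set ρ := (1 + |t|) ^ (1/144 : ℝ) with hρ
  have hρ1 : 1 ≤ ρ := Real.one_le_rpow (by linarith [abs_nonneg t]) (by norm_num)
  have hρ4 : (1 + |t|) ^ (1/36 : ℝ) = ρ ^ 4 := by
    rw [hρ, ← Real.rpow_natCast, ← Real.rpow_mul (by positivity)]; norm_num
  have hρ16 : (1 + |t|) ^ (1/9 : ℝ) = ρ ^ 16 := by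
    rw [hρ, ← Real.rpow_natCast, ← Real.rpow_mul (by positivity)]; norm_num
  rw [hρ16]
  set y₀ := κ / (2 * D) / ρ ^ 5 with hy₀
  have hy0 : 0 < y₀ := by positivity
  have hy1 : y₀ ≤ 1 := by
    rw [hy₀, div_div, div_le_one (by positivity)]
    have : 1 ≤ ρ ^ 5 := one_le_pow₀ hρ1
    nlinarith
  have target : κ * (κ / (2 * D)) ^ 3 / 2 / ρ ^ 16 = κ * y₀ ^ 3 / ρ / 2 := by
    rw [hy₀]; field_simp
  rw [target]
  have hpos : 0 < κ * y₀ ^ 3 / ρ := by positivity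
  rcases le_total (y₀ ^ 4) (s.re - 1) with h | h
  · set y := (s.re - 1) ^ (1/4 : ℝ) with hy
    have hy4 : y ^ 4 = s.re - 1 := by
      rw [hy, ← Real.rpow_natCast, ← Real.rpow_mul (by linarith)]; norm_num
    have hyp : 0 < y := Real.rpow_pos_of_pos (by linarith) _
    have hle : y₀ ≤ y := by
      rw [← hy4] at h
      exact (pow_le_pow_iff_left₀ hy0.le hyp.le (by norm_num)).mp h
    have hy1' : y ≤ 1 := by
      have : y ^ 4 ≤ 1 ^ 4 := by rw [hy4]; linarith
      exact (pow_le_pow_iff_left₀ hyp.le zero_le_one (by norm_num)).mp this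
    have := hκ y t hyp hy1' ht
    rw [hy4] at this
    have es : (1 + ((s.re - 1 : ℝ) : ℂ) + Complex.I * t) = s := by
      apply Complex.ext <;> simp [t]
    rw [es, ← hρ] at this
    refine le_trans ?_ this
    calc κ * y₀ ^ 3 / ρ / 2 ≤ κ * y₀ ^ 3 / ρ := by linarith
      _ ≤ _ := by gcongr
  · have h1 := hκ y₀ t hy0 hy1 ht
    rw [← hρ] at h1
    set z : ℂ := 1 + (y₀ ^ 4 : ℝ) + Complex.I * t with hz
    have hzre : z.re = 1 + y₀ ^ 4 := by simp [hz, -Complex.ofReal_pow]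
    have hzim : z.im = t := by simp [hz, -Complex.ofReal_pow]
    have hzs : ‖z - s‖ ≤ y₀ ^ 4 := by
      have e : z - s = ((1 + y₀ ^ 4 - s.re : ℝ) : ℂ) := by
        apply Complex.ext
        · rw [Complex.sub_re, hzre, Complex.ofReal_re]
        · rw [Complex.sub_im, hzim, Complex.ofReal_im]; simp [t]
      rw [e, Complex.norm_real, Real.norm_of_nonneg (by linarith)]
      linarith
    have hy4 : y₀ ^ 4 ≤ 1 := pow_le_one₀ hy0.le hy1
    have hseg : ∀ w ∈ segment ℝ s z, 1 ≤ w.re ∧ w.re ≤ 2 ∧ w.im = t := by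
      rintro w ⟨a, b, ha, hb, hab, rfl⟩
      simp only [Complex.add_re, Complex.smul_re, Complex.add_im, Complex.smul_im, smul_eq_mul,
        hzre, hzim]
      refine ⟨by nlinarith [pow_pos hy0 4], by nlinarith, ?_⟩
      change a * t + b * t = t
      rw [← add_mul, hab, one_mul]
    have h2 := Convex.norm_image_sub_le_of_norm_deriv_le (f := riemannZeta) (C := D * ρ ^ 4)
      (s := segment ℝ s z) (x := s) (y := z) (by
        intro w hw
        apply differentiableAt_riemannZeta
        rintro rfl
        have := (hseg 1 hw).2.2
        rw [← this] at ht
        norm_num at ht) (by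
        intro w hw
        obtain ⟨a, b, c⟩ := hseg w hw
        have := hD w a b (by rw [c]; exact ht)
        rwa [c, hρ4] at this) (convex_segment _ _) (left_mem_segment _ _ _)
        (right_mem_segment _ _ _)
    have h3 := norm_sub_norm_le (riemannZeta z) (riemannZeta s)
    have h4 : D * ρ ^ 4 * ‖z - s‖ ≤ κ * y₀ ^ 3 / ρ / 2 := by
      calc D * ρ ^ 4 * ‖z - s‖ ≤ D * ρ ^ 4 * (y₀ ^ 3 * y₀) := by
            rw [← pow_succ]; gcongr
        _ = κ * y₀ ^ 3 / ρ / 2 := by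
            nth_rewrite 2 [hy₀]; field_simp
    linarith

/-- The Mellin transform of the Mertens function. -/
noncomputable def mertF (s : ℂ) : ℂ := (s * riemannZeta s)⁻¹

lemma mertF_far : ∃ C : ℝ, 0 < C ∧ ∀ s : ℂ, 1 < s.re → s.re ≤ 2 → 1 ≤ |s.im| →
    ‖deriv mertF s‖ ≤ C * (1 + |s.im|) ^ (-(3/4) : ℝ) := by
  obtain ⟨c, hc0, hc⟩ := zeta_lower
  obtain ⟨D, hD1, hD⟩ := zeta_deriv_bound
  refine ⟨4 / c + 2 * D / c ^ 2, by positivity, fun s hs hs2 ht => ?_⟩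
  have hs1 : s ≠ 1 := by rintro rfl; norm_num at ht
  have hs0 : s ≠ 0 := by rintro rfl; norm_num at ht
  have hz : riemannZeta s ≠ 0 := riemannZeta_ne_zero_of_one_lt_re hs
  have hd : HasDerivAt mertF (-(1 * riemannZeta s + s * deriv riemannZeta s) /
      (s * riemannZeta s) ^ 2) s :=
    ((hasDerivAt_id' s).mul (differentiableAt_riemannZeta hs1).hasDerivAt).inv
      (mul_ne_zero hs0 hz)
  rw [hd.deriv]
  have hl := hc s hs hs2 ht
  have hu := hD s hs.le hs2 ht
  set τ := 1 + |s.im| with hτ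
  have hτ1 : 1 ≤ τ := by linarith
  set p := τ ^ (1/36 : ℝ) with hp
  have hp1 : 1 ≤ p := Real.one_le_rpow hτ1 (by norm_num)
  have hp4 : τ ^ (1/9 : ℝ) = p ^ 4 := by
    rw [hp, ← Real.rpow_natCast, ← Real.rpow_mul (by positivity)]; norm_num
  have hp36 : τ = p ^ 36 := by
    rw [hp, ← Real.rpow_natCast, ← Real.rpow_mul (by positivity)]; norm_num
  have hp27 : τ ^ (-(3/4) : ℝ) = (p ^ 27)⁻¹ := by
    rw [hp, ← Real.rpow_natCast, ← Real.rpow_mul (by positivity), ← Real.rpow_neg (by positivity)]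
    norm_num
  rw [hp27]
  rw [hp4] at hl
  have hsn : p ^ 36 / 2 ≤ ‖s‖ := by
    have := Complex.abs_im_le_norm s
    rw [← hp36]; linarith
  set w := ‖riemannZeta s‖
  set v := ‖deriv riemannZeta s‖
  have hw0 : 0 < w := norm_pos_iff.mpr hz
  have hsp : 0 < ‖s‖ := norm_pos_iff.mpr hs0
  have n1 : ‖-(1 * riemannZeta s + s * deriv riemannZeta s) / (s * riemannZeta s) ^ 2‖
      ≤ (w + ‖s‖ * v) / (‖s‖ * w) ^ 2 := by
    rw [norm_div, norm_neg, norm_pow, norm_mul, one_mul]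
    gcongr
    refine (norm_add_le _ _).trans ?_
    rw [norm_mul]
  refine n1.trans ?_
  have e : (w + ‖s‖ * v) / (‖s‖ * w) ^ 2 = 1 / (‖s‖ ^ 2 * w) + v / (‖s‖ * w ^ 2) := by
    field_simp
  rw [e]
  have a1 : 1 / (‖s‖ ^ 2 * w) ≤ 1 / ((p ^ 36 / 2) ^ 2 * (c / p ^ 4)) := by gcongr
  have a2 : v / (‖s‖ * w ^ 2) ≤ (D * p) / ((p ^ 36 / 2) * (c / p ^ 4) ^ 2) := by gcongr
  have b1 : 1 / ((p ^ 36 / 2) ^ 2 * (c / p ^ 4)) = 4 / c * (p ^ 68)⁻¹ := by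
    field_simp; norm_num
  have b2 : (D * p) / ((p ^ 36 / 2) * (c / p ^ 4) ^ 2) = 2 * D / c ^ 2 * (p ^ 27)⁻¹ := by
    field_simp
  have b3 : (p ^ 68)⁻¹ ≤ (p ^ 27)⁻¹ := by
    gcongr
    norm_num
  rw [b1] at a1
  rw [b2] at a2
  have : 4 / c * (p ^ 68)⁻¹ ≤ 4 / c * (p ^ 27)⁻¹ := by gcongr
  linarith

lemma zeta1_ne_zero (s : ℂ) (hs : 1 ≤ s.re) : riemannZeta₁ s ≠ 0 := by
  by_cases h : s = 1
  · subst h; simp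
  · have := riemannZeta_ne_zero_of_one_le_re hs
    rw [riemannZeta_eq_inv_sub_mul h] at this
    exact right_ne_zero_of_mul this

lemma mertF_near : ∃ C : ℝ, 0 < C ∧ ∀ s : ℂ, 1 < s.re → s.re ≤ 2 → |s.im| ≤ 1 →
    ‖deriv mertF s‖ ≤ C := by
  set U : Set ℂ := {s | s * riemannZeta₁ s ≠ 0} with hU
  have hcont : Continuous fun s => s * riemannZeta₁ s :=
    continuous_id.mul differentiable_riemannZeta₁.continuous
  have hUo : IsOpen U := isOpen_ne_fun hcont continuous_const
  set Φ : ℂ → ℂ := fun s => (s - 1) / (s * riemannZeta₁ s) with hΦ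
  have hd : DifferentiableOn ℂ Φ U := by
    intro s hs
    apply DifferentiableAt.differentiableWithinAt
    exact DifferentiableAt.fun_div (c := fun s : ℂ => s - 1) (by fun_prop)
      (differentiableAt_id.fun_mul (differentiable_riemannZeta₁ s)) hs
  have hdc : ContinuousOn (deriv Φ) U := (hd.deriv hUo).continuousOn
  set K : Set ℂ := Set.Icc 1 2 ×ℂ Set.Icc (-1) 1
  have hK : IsCompact K := isCompact_Icc.reProdIm isCompact_Icc
  have hKU : K ⊆ U := by
    intro s hs
    have h1 : 1 ≤ s.re := hs.1.1
    refine mul_ne_zero ?_ (zeta1_ne_zero s h1)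
    rintro rfl
    norm_num at h1
  obtain ⟨B, hB⟩ := hK.exists_bound_of_continuousOn (hdc.mono hKU)
  refine ⟨|B| + 1, by positivity, fun s hs hs2 ht => ?_⟩
  have hsK : s ∈ K := ⟨⟨hs.le, hs2⟩, abs_le.mp ht⟩
  have heq : mertF =ᶠ[nhds s] Φ := by
    have : {s : ℂ | 1 < s.re} ∈ nhds s :=
        (isOpen_lt continuous_const Complex.continuous_re).mem_nhds hs
    filter_upwards [this] with z hz
    have hz1 : z ≠ 1 := by
      rintro rfl
      simp at hz
    simp only [mertF, hΦ]
    rw [riemannZeta_eq_inv_sub_mul hz1]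
    have := sub_ne_zero.mpr hz1
    field_simp
  rw [heq.deriv_eq]
  have := hB s hsK
  linarith [le_abs_self B]

lemma mertF_bound : ∃ C : ℝ, 0 < C ∧ ∀ s : ℂ, 1 < s.re → s.re ≤ 2 →
    ‖deriv mertF s‖ ≤ C * (1 + |s.im|) ^ (-(3/4) : ℝ) := by
  obtain ⟨C, hC0, hC⟩ := mertF_far
  obtain ⟨B, hB0, hB⟩ := mertF_near
  refine ⟨C + 2 * B, by positivity, fun s hs hs2 => ?_⟩
  have hp : 0 < (1 + |s.im|) ^ (-(3/4) : ℝ) := by positivity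
  rcases le_total 1 |s.im| with h | h
  · refine (hC s hs hs2 h).trans ?_
    gcongr
    linarith
  · refine (hB s hs hs2 h).trans ?_
    have : 1/2 ≤ (1 + |s.im|) ^ (-(3/4) : ℝ) := by
      calc (1/2 : ℝ) = 2 ^ (-1 : ℝ) := by norm_num [Real.rpow_neg_one]
        _ ≤ 2 ^ (-(3/4) : ℝ) := Real.rpow_le_rpow_of_exponent_le (by norm_num) (by norm_num)
        _ ≤ _ := Real.rpow_le_rpow_of_nonpos (by positivity) (by linarith) (by norm_num)
    nlinarith

lemma abs_mertens_le (n : ℕ) : |(mertens n : ℝ)| ≤ n := by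
  unfold mertens
  push_cast
  refine (Finset.abs_sum_le_sum_abs _ _).trans ?_
  calc _ ≤ ∑ k ∈ Finset.Icc 1 n, (1:ℝ) := by
        refine Finset.sum_le_sum fun k _ => ?_
        have := ArithmeticFunction.abs_moebius_le_one (n := k)
        exact_mod_cast this
    _ = n := by simp

/-- The Mertens function at `1/u`. -/
noncomputable def mertInv (u : ℝ) : ℂ := ((mertens ⌊u⁻¹⌋₊ : ℝ) : ℂ)

lemma norm_mertInv_le (u : ℝ) (hu : 0 < u) : ‖mertInv u‖ ≤ u⁻¹ := by
  unfold mertInv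
  rw [Complex.norm_real, Real.norm_eq_abs]
  exact (abs_mertens_le _).trans (Nat.floor_le (by positivity))

lemma mertInv_zero (u : ℝ) (hu : 1 < u) : mertInv u = 0 := by
  have : ⌊u⁻¹⌋₊ = 0 := Nat.floor_eq_zero.mpr (inv_lt_one_of_one_lt₀ hu)
  simp [mertInv, this, mertens]

lemma measurable_mertInv : Measurable mertInv := by
  unfold mertInv
  apply Complex.measurable_ofReal.comp
  exact (measurable_of_countable (fun n : ℕ => (mertens n : ℝ))).comp
    (Nat.measurable_floor.comp measurable_inv)

open ArithmeticFunction in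
lemma mellin_mertInv (s : ℂ) (hs : 1 < s.re) : mellin mertInv s = mertF s := by
  have h0 : s ≠ 0 := by rintro rfl; norm_num at hs
  have hL := LSeries_eq_mul_integral' (fun n => (ArithmeticFunction.moebius n : ℂ)) zero_le_one hs (by
    refine Asymptotics.IsBigO.of_bound 1 (Filter.Eventually.of_forall fun n => ?_)
    rw [Real.rpow_one, one_mul, Real.norm_of_nonneg (Finset.sum_nonneg fun _ _ => norm_nonneg _),
      Real.norm_of_nonneg (by positivity)]
    calc _ ≤ ∑ k ∈ Finset.Icc 1 n, (1:ℝ) := by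
          refine Finset.sum_le_sum fun k _ => ?_
          have := ArithmeticFunction.abs_moebius_le_one (n := k)
          rw [Complex.norm_intCast]
          exact_mod_cast this
      _ = n := by simp)
  have hz := LSeries_zeta_mul_Lseries_moebius hs
  rw [LSeries_zeta_eq_riemannZeta hs] at hz
  rw [hL] at hz
  have hm : mellin mertInv s = ∫ t in Set.Ioi (1 : ℝ),
      (∑ k ∈ Finset.Icc 1 ⌊t⌋₊, (ArithmeticFunction.moebius k : ℂ)) * (t : ℂ) ^ (-(s + 1)) := by
    have : mertInv = fun t => (fun x : ℝ => ((mertens ⌊x⌋₊ : ℝ) : ℂ)) t⁻¹ := rfl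
    rw [this, mellin_comp_inv (fun x : ℝ => ((mertens ⌊x⌋₊ : ℝ) : ℂ)) s, mellin]
    rw [MeasureTheory.setIntegral_eq_of_subset_of_forall_sdiff_eq_zero (s := Set.Ici (1:ℝ))
      measurableSet_Ioi (Set.Ici_subset_Ioi.mpr one_pos)]
    · rw [MeasureTheory.integral_Ici_eq_integral_Ioi]
      refine MeasureTheory.setIntegral_congr_fun measurableSet_Ioi fun t _ => ?_
      simp only [smul_eq_mul, mertens]
      push_cast
      rw [mul_comm]
      ring_nf
    · rintro x ⟨hx, hx1⟩
      have : ⌊x⌋₊ = 0 := Nat.floor_eq_zero.mpr (by simpa using hx1)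
      simp [this, mertens]
  rw [hm]
  unfold mertF
  apply eq_inv_of_mul_eq_one_left
  rw [mul_comm, mul_comm s, mul_assoc]
  exact hz

lemma mellin_log_mertInv (s : ℂ) (hs : 1 < s.re) :
    MellinConvergent (fun t => Real.log t • mertInv t) s ∧
    mellin (fun t => Real.log t • mertInv t) s = deriv mertF s := by
  have hloc : MeasureTheory.LocallyIntegrableOn mertInv (Set.Ioi 0) := by
    have hc : ContinuousOn (fun u : ℝ => u⁻¹) (Set.Ioi 0) :=
      continuousOn_inv₀.mono (fun x hx => (ne_of_gt hx))
    refine (hc.locallyIntegrableOn measurableSet_Ioi).mono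
      measurable_mertInv.aestronglyMeasurable ?_
    refine Filter.Eventually.of_forall fun u => ?_
    rcases lt_or_ge 0 u with hu | hu
    · exact (norm_mertInv_le u hu).trans (le_abs_self _)
    · have : ⌊u⁻¹⌋₊ = 0 := Nat.floor_of_nonpos (inv_nonpos.mpr hu)
      simp [mertInv, this, mertens]
  have h := mellin_hasDerivAt_of_isBigO_rpow (f := mertInv) (a := s.re + 1) (b := 1) (s := s)
    hloc (by
      refine Asymptotics.IsBigO.of_bound 0 ?_
      filter_upwards [Filter.eventually_gt_atTop 1] with u hu
      simp [mertInv_zero u hu]) (by linarith) (by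
      refine Asymptotics.IsBigO.of_bound 1 ?_
      filter_upwards [self_mem_nhdsWithin] with u hu
      have hu0 : (0:ℝ) < u := hu
      rw [Real.rpow_neg_one, one_mul, Real.norm_of_nonneg (by positivity)]
      exact norm_mertInv_le u hu0) hs
  refine ⟨h.1, ?_⟩
  have heq : mertF =ᶠ[nhds s] mellin mertInv := by
    have : {s : ℂ | 1 < s.re} ∈ nhds s :=
        (isOpen_lt continuous_const Complex.continuous_re).mem_nhds hs
    filter_upwards [this] with z hz
    exact (mellin_mertInv z hz).symm
  rw [heq.deriv_eq, h.2.deriv]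

/-- The function whose Fourier transform is `mertF'` on a vertical line. -/
noncomputable def gS (σ u : ℝ) : ℂ := Real.exp (-σ * u) • (Real.log (Real.exp (-u)) • mertInv (Real.exp (-u)))

lemma measurable_gS (σ : ℝ) : Measurable (gS σ) := by
  unfold gS
  have h1 : Measurable fun u : ℝ => Real.exp (-σ * u) := by fun_prop
  have h2 : Measurable fun u : ℝ => Real.log (Real.exp (-u)) := by fun_prop
  have h3 : Measurable fun u : ℝ => mertInv (Real.exp (-u)) :=
    measurable_mertInv.comp (by fun_prop)
  exact h1.smul (h2.smul h3)

lemma gS_norm_le (σ u : ℝ) :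
    ‖gS σ u‖ ≤ (Set.Ioi (0:ℝ)).indicator (fun u => u * Real.exp (-(σ - 1) * u)) u := by
  rcases lt_trichotomy u 0 with h | h | h
  · have h1 : 1 < Real.exp (-u) := Real.one_lt_exp_iff.mpr (by linarith)
    simp [gS, mertInv_zero _ h1, h.le]
  · subst h; simp [gS]
  · rw [Set.indicator_of_mem (show u ∈ Set.Ioi 0 from h)]
    unfold gS
    rw [norm_smul, norm_smul, Real.log_exp, Real.norm_eq_abs, Real.norm_eq_abs, abs_neg,
      abs_of_pos h, abs_of_pos (Real.exp_pos _)]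
    have h1 := norm_mertInv_le _ (Real.exp_pos (-u))
    rw [← Real.exp_neg, neg_neg] at h1
    calc Real.exp (-σ * u) * (u * ‖mertInv (Real.exp (-u))‖)
        ≤ Real.exp (-σ * u) * (u * Real.exp u) := by gcongr
      _ = u * (Real.exp (-σ * u) * Real.exp u) := by ring
      _ = _ := by rw [← Real.exp_add]; congr 2; ring

open MeasureTheory in
lemma gS_integrable (σ : ℝ) (hσ : 1 < σ) : Integrable (gS σ) := by
  refine Integrable.mono' (g := (Set.Ioi (0:ℝ)).indicator (fun u => u * Real.exp (-(σ - 1) * u))) ?_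
    (measurable_gS σ).aestronglyMeasurable (Filter.Eventually.of_forall (gS_norm_le σ))
  rw [integrable_indicator_iff measurableSet_Ioi]
  have := integrableOn_rpow_mul_exp_neg_mul_rpow (s := 1) (p := 1) (b := σ - 1) (by norm_num)
    (by norm_num) (by linarith)
  simpa using this

open MeasureTheory in
lemma gS_sq_integrable (σ : ℝ) (hσ : 1 < σ) : Integrable (fun u => ‖gS σ u‖ ^ 2) := by
  refine Integrable.mono' (g := (Set.Ioi (0:ℝ)).indicator
    (fun u => u ^ 2 * Real.exp (-(2 * (σ - 1)) * u))) ?_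
    ((measurable_gS σ).norm.pow_const 2).aestronglyMeasurable
    (Filter.Eventually.of_forall fun u => ?_)
  · rw [integrable_indicator_iff measurableSet_Ioi]
    have := integrableOn_rpow_mul_exp_neg_mul_rpow (s := 2) (p := 1) (b := 2 * (σ - 1)) (by norm_num)
      (by norm_num) (by linarith)
    simpa using this
  · rw [Real.norm_of_nonneg (by positivity)]
    have h := gS_norm_le σ u
    by_cases hu : u ∈ Set.Ioi (0:ℝ)
    · rw [Set.indicator_of_mem hu] at h ⊢
      calc ‖gS σ u‖ ^ 2 ≤ (u * Real.exp (-(σ - 1) * u)) ^ 2 := by gcongr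
        _ = _ := by
          rw [mul_pow, ← Real.exp_nat_mul]; congr 2; push_cast; ring
    · rw [Set.indicator_of_notMem hu] at h ⊢
      have : ‖gS σ u‖ = 0 := le_antisymm h (norm_nonneg _)
      simp [this]

open MeasureTheory FourierTransform in
lemma gS_fourier (σ : ℝ) (hσ : 1 < σ) (ξ : ℝ) :
    𝓕 (gS σ) ξ = deriv mertF (σ + (2 * Real.pi * ξ : ℝ) * Complex.I) := by
  set s : ℂ := σ + (2 * Real.pi * ξ : ℝ) * Complex.I with hs
  have hre : s.re = σ := by simp [hs]
  have him : s.im = 2 * Real.pi * ξ := by simp [hs]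
  rw [← (mellin_log_mertInv s (by rw [hre]; exact hσ)).2, mellin_eq_fourier, hre, him]
  have : 2 * Real.pi * ξ / (2 * Real.pi) = ξ := by
    have := Real.pi_pos
    field_simp
  rw [this]
  rfl

open MeasureTheory FourierTransform in
lemma gS_L2 : ∃ A : ℝ, 0 ≤ A ∧ ∀ σ : ℝ, 1 < σ → σ ≤ 2 → ∫ u, ‖gS σ u‖ ^ 2 ≤ A := by
  obtain ⟨C, hC0, hC⟩ := mertF_bound
  have hIntg : Integrable (fun ξ : ℝ => C ^ 2 * (1 + ‖ξ‖) ^ (-(3/2) : ℝ)) :=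
    (integrable_one_add_norm (by simp; norm_num)).const_mul _
  refine ⟨∫ ξ : ℝ, C ^ 2 * (1 + ‖ξ‖) ^ (-(3/2) : ℝ), integral_nonneg fun _ => by positivity,
    fun σ hσ hσ2 => ?_⟩
  have hb : ∀ ξ, ‖𝓕 (gS σ) ξ‖ ^ 2 ≤ C ^ 2 * (1 + ‖ξ‖) ^ (-(3/2) : ℝ) := by
    intro ξ
    rw [gS_fourier σ hσ]
    have h := hC (σ + (2 * Real.pi * ξ : ℝ) * Complex.I) (by simpa using hσ) (by simpa using hσ2)
    have him : (σ + (2 * Real.pi * ξ : ℝ) * Complex.I : ℂ).im = 2 * Real.pi * ξ := by simp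
    rw [him] at h
    have h2 : (1 + |2 * Real.pi * ξ|) ^ (-(3/4) : ℝ) ≤ (1 + ‖ξ‖) ^ (-(3/4) : ℝ) := by
      apply Real.rpow_le_rpow_of_nonpos (by positivity) _ (by norm_num)
      rw [abs_mul, abs_of_pos (by positivity : 0 < 2 * Real.pi), Real.norm_eq_abs]
      nlinarith [abs_nonneg ξ, Real.pi_gt_three]
    calc _ ≤ (C * (1 + ‖ξ‖) ^ (-(3/4) : ℝ)) ^ 2 := by
          gcongr
          exact h.trans (by gcongr)
      _ = _ := by
          rw [mul_pow, ← Real.rpow_natCast ((1 + ‖ξ‖) ^ (-(3/4) : ℝ)), ← Real.rpow_mul (by positivity)]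
          norm_num
  have hc : Continuous (𝓕 (gS σ)) :=
    VectorFourier.fourierIntegral_continuous Real.continuous_fourierChar
      (by exact continuous_inner) (gS_integrable σ hσ)
  have h3 : Integrable (fun ξ => ‖𝓕 (gS σ) ξ‖ ^ 2) := by
    refine hIntg.mono' (hc.norm.pow 2).aestronglyMeasurable (Filter.Eventually.of_forall fun ξ => ?_)
    rw [Real.norm_of_nonneg (by positivity)]
    exact hb ξ
  rw [plancherel_le _ (gS_integrable σ hσ) (gS_sq_integrable σ hσ) h3]
  exact integral_mono h3 hIntg hb

/-- The weighted Mertens function in logarithmic scale. -/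
noncomputable def phiM (u : ℝ) : ℝ := |(mertens ⌊Real.exp u⌋₊ : ℝ)| * Real.exp (-u)

lemma phiM_nonneg (u : ℝ) : 0 ≤ phiM u := by unfold phiM; positivity

lemma phiM_le_one (u : ℝ) : phiM u ≤ 1 := by
  unfold phiM
  calc _ ≤ Real.exp u * Real.exp (-u) := by
        gcongr
        exact (abs_mertens_le _).trans (Nat.floor_le (Real.exp_pos u).le)
    _ = 1 := by rw [← Real.exp_add]; simp

lemma measurable_phiM : Measurable phiM := by
  unfold phiM
  have h : Measurable fun u : ℝ => |(mertens ⌊Real.exp u⌋₊ : ℝ)| :=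
    (measurable_of_countable (fun n : ℕ => |(mertens n : ℝ)|)).comp
      (Nat.measurable_floor.comp Real.measurable_exp)
  exact h.mul (by fun_prop)

open MeasureTheory in
lemma phiM_intervalIntegrable (a b : ℝ) : IntervalIntegrable phiM volume a b := by
  refine (intervalIntegrable_const (c := (1:ℝ))).mono_fun measurable_phiM.aestronglyMeasurable
    (Filter.Eventually.of_forall fun u => ?_)
  simp only [norm_one]
  rw [Real.norm_of_nonneg (phiM_nonneg u)]
  exact phiM_le_one u

lemma gS_norm (σ u : ℝ) (hu : 0 ≤ u) :
    ‖gS σ u‖ = Real.exp (-σ * u) * (u * |(mertens ⌊Real.exp u⌋₊ : ℝ)|) := by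
  unfold gS mertInv
  rw [norm_smul, norm_smul, Real.log_exp, Real.norm_eq_abs, Real.norm_eq_abs, abs_neg,
    abs_of_nonneg hu, abs_of_pos (Real.exp_pos _), Complex.norm_real, Real.norm_eq_abs,
    ← Real.exp_neg, neg_neg]

open MeasureTheory in
lemma phiM_integral_bound : ∃ B : ℝ, 0 ≤ B ∧ ∀ L : ℝ, 0 ≤ L → ∫ u in (0:ℝ)..L, phiM u ≤ B := by
  obtain ⟨A, hA0, hA⟩ := gS_L2
  refine ⟨2 * A + 10 * Real.pi, by positivity, fun L hL => ?_⟩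
  set σ : ℝ := 1 + 1 / (1 + L) with hσ
  have hσ1 : 1 < σ := by rw [hσ]; linarith [show 0 < 1 / (1 + L) by positivity]
  have hσ2 : σ ≤ 2 := by
    have : 1 / (1 + L) ≤ 1 := by rw [div_le_one (by positivity)]; linarith
    linarith
  have hi1 := gS_sq_integrable σ hσ1
  have hi2 : Integrable (fun u : ℝ => (1 + u ^ 2)⁻¹) := integrable_inv_one_add_sq
  have hpt : ∀ u ∈ Set.Ioc 0 L, phiM u ≤ 2 * ‖gS σ u‖ ^ 2 + 10 * (1 + u ^ 2)⁻¹ := by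
    rintro u ⟨hu0, huL⟩
    rcases le_total u 1 with h1 | h1
    · have h2 := phiM_le_one u
      have h3 : (1/2 : ℝ) ≤ (1 + u ^ 2)⁻¹ := by
        rw [one_div]
        gcongr
        nlinarith
      nlinarith [sq_nonneg ‖gS σ u‖]
    · have hg := gS_norm σ u hu0.le
      have h3 : Real.exp (-u) ≤ 3 * Real.exp (-σ * u) := by
        have e : Real.exp (-u) = Real.exp (u / (1 + L)) * Real.exp (-σ * u) := by
          rw [← Real.exp_add, hσ]; congr 1; field_simp; ring
        rw [e]
        gcongr
        have : Real.exp (u / (1 + L)) ≤ Real.exp 1 := by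
          apply Real.exp_le_exp.mpr
          rw [div_le_one (by positivity)]; linarith
        linarith [Real.exp_one_lt_d9]
      have h4 : phiM u ≤ 3 * (‖gS σ u‖ * u⁻¹) := by
        rw [hg]
        unfold phiM
        calc _ ≤ |(mertens ⌊Real.exp u⌋₊ : ℝ)| * (3 * Real.exp (-σ * u)) := by gcongr
          _ = _ := by field_simp
      have h5 : (u⁻¹) ^ 2 ≤ 2 * (1 + u ^ 2)⁻¹ := by
        rw [inv_pow, ← one_div, ← div_eq_mul_inv, div_le_div_iff₀ (by positivity) (by positivity)]
        nlinarith
      have h6 : 0 < (1 + u ^ 2)⁻¹ := by positivity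
      nlinarith [sq_nonneg (‖gS σ u‖ - u⁻¹), sq_nonneg ‖gS σ u‖]
  have hi : Integrable (fun u : ℝ => 2 * ‖gS σ u‖ ^ 2 + 10 * (1 + u ^ 2)⁻¹) :=
    (hi1.const_mul 2).add (hi2.const_mul 10)
  rw [intervalIntegral.integral_of_le hL]
  calc ∫ u in Set.Ioc 0 L, phiM u
      ≤ ∫ u in Set.Ioc 0 L, (2 * ‖gS σ u‖ ^ 2 + 10 * (1 + u ^ 2)⁻¹) :=
        setIntegral_mono_on ((intervalIntegrable_iff_integrableOn_Ioc_of_le hL).mp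
          (phiM_intervalIntegrable 0 L)) hi.integrableOn measurableSet_Ioc hpt
    _ ≤ ∫ u, (2 * ‖gS σ u‖ ^ 2 + 10 * (1 + u ^ 2)⁻¹) :=
        setIntegral_le_integral hi (Filter.Eventually.of_forall fun u => by
          simp only [Pi.zero_apply]; positivity)
    _ = 2 * (∫ u, ‖gS σ u‖ ^ 2) + 10 * Real.pi := by
        rw [integral_add (hi1.const_mul 2) (hi2.const_mul 10), integral_const_mul,
          integral_const_mul, integral_univ_inv_one_add_sq]
    _ ≤ _ := by linarith [hA σ hσ1 hσ2]

lemma mertens_lip (m n : ℕ) (h : m ≤ n) :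
    |(mertens m : ℝ)| ≤ |(mertens n : ℝ)| + ((n : ℝ) - m) := by
  induction n, h using Nat.le_induction with
  | base => simp
  | succ n hmn ih =>
    have e : mertens (n + 1) = mertens n + ArithmeticFunction.moebius (n + 1) := by
      unfold mertens
      rw [Finset.sum_Icc_succ_top (by omega)]
    have h1 : |((ArithmeticFunction.moebius (n + 1) : ℤ) : ℝ)| ≤ 1 := by
      exact_mod_cast ArithmeticFunction.abs_moebius_le_one (n := n + 1)
    have h2 : (mertens n : ℝ) = mertens (n + 1) - (ArithmeticFunction.moebius (n + 1) : ℤ) := by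
      rw [e]; push_cast; ring
    have h3 := abs_sub (mertens (n + 1) : ℝ) ((ArithmeticFunction.moebius (n + 1) : ℤ) : ℝ)
    rw [← h2] at h3
    push_cast
    linarith

lemma mertens_step (T j : ℕ) (hj : 1 ≤ j) (hjT : j < T) :
    |(mertens (T / (j + 1)) : ℝ)| ≤
      T * (∫ u in Real.log (T / ((j + 1 : ℕ) : ℝ))..Real.log (T / (j : ℝ)), phiM u) +
      ((T : ℝ) / j - T / ((j + 1 : ℕ) : ℝ) + 1) := by
  have hj0 : (0:ℝ) < j := by exact_mod_cast hj
  have hT0 : (0:ℝ) < T := by exact_mod_cast (by omega : 0 < T)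
  set a := Real.log (T / ((j + 1 : ℕ) : ℝ)) with ha
  set b := Real.log (T / (j : ℝ)) with hb
  set E := (T : ℝ) / j - T / ((j + 1 : ℕ) : ℝ) + 1 with hE
  have hea : Real.exp a = T / ((j + 1 : ℕ) : ℝ) := Real.exp_log (by positivity)
  have heb : Real.exp b = T / (j : ℝ) := Real.exp_log (by positivity)
  have hab : a ≤ b := by
    apply Real.log_le_log (by positivity)
    gcongr
    omega
  have hpt : ∀ u ∈ Set.Icc a b, (|(mertens (T / (j + 1)) : ℝ)| - E) * Real.exp (-u) ≤ phiM u := by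
    rintro u ⟨hua, hub⟩
    unfold phiM
    gcongr
    have h1 : T / (j + 1) ≤ ⌊Real.exp u⌋₊ := by
      rw [← Nat.floor_div_eq_div (K := ℝ)]
      apply Nat.floor_le_floor
      rw [← hea]
      exact Real.exp_le_exp.mpr hua
    have h2 := mertens_lip _ _ h1
    have h3 : (⌊Real.exp u⌋₊ : ℝ) ≤ T / (j : ℝ) := by
      rw [← heb]
      exact (Nat.floor_le (Real.exp_pos u).le).trans (Real.exp_le_exp.mpr hub)
    have h4 : (T : ℝ) / ((j + 1 : ℕ) : ℝ) - 1 ≤ ((T / (j + 1) : ℕ) : ℝ) := by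
      rw [← Nat.floor_div_eq_div (K := ℝ)]
      exact (Nat.sub_one_lt_floor _).le
    linarith
  have hIntg := intervalIntegral.integral_mono_on hab (by
    apply Continuous.intervalIntegrable; fun_prop) (phiM_intervalIntegrable a b) hpt
  rw [intervalIntegral.integral_const_mul] at hIntg
  have hexp : ∫ u in a..b, Real.exp (-u) = 1 / T := by
    rw [intervalIntegral.integral_comp_neg (fun u => Real.exp u), integral_exp,
      Real.exp_neg, Real.exp_neg, hea, heb]
    push_cast
    field_simp
    ring
  rw [hexp] at hIntg
  have h5 := mul_le_mul_of_nonneg_left hIntg hT0.le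
  have e5 : (T : ℝ) * ((|(mertens (T / (j + 1)) : ℝ)| - E) * (1 / T)) =
    |(mertens (T / (j + 1)) : ℝ)| - E := by field_simp
  rw [e5] at h5
  linarith

lemma mertens_partial (T N : ℕ) (hN : 1 ≤ N) (hNT : N ≤ T) :
    ∑ d ∈ Finset.Icc 1 N, |(mertens (T / d) : ℝ)| ≤
      T * (∫ u in Real.log (T / (N : ℝ))..Real.log T, phiM u) + ((T : ℝ) - T / (N : ℝ)) + N + T := by
  induction N, hN using Nat.le_induction with
  | base =>
    have := abs_mertens_le T
    simp; linarith
  | succ j hj ih =>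
    have h1 := ih (by omega)
    have h2 := mertens_step T j hj (by omega)
    rw [Finset.sum_Icc_succ_top (by omega)]
    have h3 := intervalIntegral.integral_add_adjacent_intervals
      (phiM_intervalIntegrable (Real.log (T / ((j + 1 : ℕ) : ℝ))) (Real.log (T / (j : ℝ))))
      (phiM_intervalIntegrable (Real.log (T / (j : ℝ))) (Real.log T))
    rw [← h3, mul_add]
    have : ((j + 1 : ℕ) : ℝ) = (j : ℝ) + 1 := by push_cast; rfl
    linarith

/-- `∑_{d=1}^{T} |M(⌊T/d⌋)| ≤ K·T`. -/
theorem sum_abs_mertens :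
    ∃ K : ℝ, 0 < K ∧ ∀ T : ℕ, 1 ≤ T →
      ∑ d ∈ Finset.Icc 1 T, |(mertens (T / d) : ℝ)| ≤ K * (T : ℝ) := by
  obtain ⟨B, hB0, hB⟩ := phiM_integral_bound
  refine ⟨B + 3, by linarith, fun T hT => ?_⟩
  have hT1 : (1:ℝ) ≤ T := by exact_mod_cast hT
  have h := mertens_partial T T hT le_rfl
  rw [div_self (by positivity), Real.log_one] at h
  have h2 := hB (Real.log T) (Real.log_nonneg hT1)
  nlinarith
end

section
/- Assume the Riemann Hypothesis. Then for every ε > 0 there is a constant K > 0 such that for all integers T ≥ 2, |C(T) − F(T)·G(T)| ≤ K·T^{11/4+ε}. -/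
/-- The set of Farey fractions of order `T`: rationals `a/b` with
`0 ≤ a < b ≤ T` and `gcd(a,b) = 1`, viewed as a finite set of rationals in `[0,1)`. -/
def farey (T : ℕ) : Finset ℚ :=
  (((Finset.range (T + 1)) ×ˢ (Finset.range (T + 1))).filter
    (fun p => p.1 < p.2 ∧ Nat.gcd p.1 p.2 = 1)).image (fun p => (p.1 : ℚ) / (p.2 : ℚ))

/-- `F(T)` is the number of Farey fractions of order `T`. -/
def F (T : ℕ) : ℕ := (farey T).card

/-- The Farey fractions of order `T` lying in `[0, 1/2]`. -/
def fareyHalf (T : ℕ) : Finset ℚ := (farey T).filter (fun q => q ≤ 1 / 2)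

/-- `C(T) = ∑_{a/b ∈ 𝓕(T) ∩ [0,1/2]} #(𝓕(T) ∩ [1 - a²/b², 1])`, where a Farey fraction
`q = a/b` in lowest terms satisfies `a²/b² = q²`. -/
def C (T : ℕ) : ℕ :=
  ∑ q ∈ fareyHalf T, ((farey T).filter (fun ξ => 1 - q ^ 2 ≤ ξ ∧ ξ ≤ 1)).card

/-- `G(T) = ∑_{ξ ∈ 𝓕(T), ξ ≤ 1/2} ξ²`. -/
noncomputable def G (T : ℕ) : ℝ := ∑ q ∈ fareyHalf T, (q : ℝ) ^ 2

section
open Complex Metric Set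

lemma exists_log_ball {f : ℂ → ℂ} {R : ℝ} (hR : 0 < R) (hf : DifferentiableOn ℂ f (ball 0 R))
    (h0 : ∀ z ∈ ball (0:ℂ) R, f z ≠ 0) :
    ∃ g : ℂ → ℂ, DifferentiableOn ℂ g (ball 0 R) ∧ g 0 = 0 ∧
      ∀ z ∈ ball (0:ℂ) R, f z = f 0 * exp (g z) := by
  have hd : DifferentiableOn ℂ (fun z => deriv f z / f z) (ball 0 R) :=
    (hf.deriv isOpen_ball).div hf h0
  obtain ⟨g, hg0, hg⟩ := (hd.isExactOn_ball).with_val_at 0 0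
  have h0mem : (0:ℂ) ∈ ball (0:ℂ) R := by simpa using hR
  refine ⟨g, fun z hz => (hg z hz).differentiableAt.differentiableWithinAt, hg0, fun z hz => ?_⟩
  have hder : ∀ w ∈ ball (0:ℂ) R, HasDerivAt (fun w => f w * exp (-g w)) 0 w := by
    intro w hw
    have h1 : HasDerivAt f (deriv f w) w :=
      (hf.differentiableAt (isOpen_ball.mem_nhds hw)).hasDerivAt
    have h2 := h1.mul ((hg w hw).fun_neg.cexp)
    have hw0 := h0 w hw
    have e : deriv f w * exp (-g w) + f w * (exp (-g w) * -(deriv f w / f w)) = 0 := by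
      field_simp; ring
    rw [e] at h2
    exact h2
  have hconst : f z * exp (-g z) = f 0 * exp (-g 0) := by
    refine isOpen_ball.is_const_of_deriv_eq_zero (convex_ball (0:ℂ) R).isPreconnected
      (f := fun w => f w * exp (-g w)) ?_ ?_ hz h0mem
    · exact fun w hw => (hder w hw).differentiableAt.differentiableWithinAt
    · exact fun w hw => (hder w hw).deriv
  rw [hg0, neg_zero, exp_zero, mul_one] at hconst
  rw [← hconst, mul_assoc, ← exp_add]; simp

lemma three_circles {g : ℂ → ℂ} {R r1 r3 A B : ℝ} (h1 : 0 < r1) (h13 : r1 < r3) (h3 : r3 < R)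
    (hg : DifferentiableOn ℂ g (ball 0 R)) (hA : ∀ z, ‖z‖ = r1 → ‖g z‖ ≤ A)
    (hB : ∀ z, ‖z‖ = r3 → ‖g z‖ ≤ B) {z : ℂ} (hz1 : r1 ≤ ‖z‖) (hz3 : ‖z‖ ≤ r3) :
    ‖g z‖ ≤ A ^ (1 - Real.log (‖z‖ / r1) / Real.log (r3 / r1)) *
      B ^ (Real.log (‖z‖ / r1) / Real.log (r3 / r1)) := by
  have hr3 : 0 < r3 := h1.trans h13
  have hz0 : 0 < ‖z‖ := h1.trans_le hz1
  have hz : z ≠ 0 := by simpa using hz0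
  have key := Complex.HadamardThreeLines.norm_le_interp_of_mem_verticalClosedStrip'
    (f := fun w => g (exp w)) (z := log z) (a := A) (b := B) (l := Real.log r1) (u := Real.log r3)
    (Real.log_lt_log h1 h13) ?_ ?_ ?_ ?_ ?_
  · rw [Complex.exp_log hz, Complex.log_re, ← Real.log_div hz0.ne' h1.ne',
      ← Real.log_div hr3.ne' h1.ne'] at key
    exact key
  · simp only [HadamardThreeLines.verticalClosedStrip, mem_preimage, Complex.log_re, mem_Icc]
    exact ⟨Real.log_le_log h1 hz1, Real.log_le_log hz0 hz3⟩
  · apply DifferentiableOn.diffContOnCl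
    refine hg.comp (differentiable_exp.differentiableOn) ?_
    intro w hw
    have : w ∈ HadamardThreeLines.verticalClosedStrip (Real.log r1) (Real.log r3) := by
      apply closure_minimal _ _ hw
      · exact preimage_mono Ioo_subset_Icc_self
      · exact isClosed_Icc.preimage continuous_re
    simp only [HadamardThreeLines.verticalClosedStrip, mem_preimage, mem_Icc] at this
    simp only [mem_ball_zero_iff, norm_exp]
    calc Real.exp w.re ≤ r3 := by rw [← Real.le_log_iff_exp_le hr3]; exact this.2
      _ < R := h3
  · have hc : IsCompact (closedBall (0:ℂ) r3) := isCompact_closedBall _ _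
    have hcont : ContinuousOn (norm ∘ g) (closedBall (0:ℂ) r3) :=
      continuous_norm.comp_continuousOn (hg.continuousOn.mono (closedBall_subset_ball h3))
    refine (hc.bddAbove_image hcont).mono ?_
    rintro _ ⟨w, hw, rfl⟩
    refine ⟨exp w, ?_, rfl⟩
    simp only [HadamardThreeLines.verticalClosedStrip, mem_preimage, mem_Icc] at hw
    simp only [mem_closedBall_zero_iff, norm_exp]
    rw [← Real.le_log_iff_exp_le hr3]; exact hw.2
  · intro w hw
    apply hA
    simp only [mem_preimage, mem_singleton_iff] at hw
    rw [norm_exp, hw, Real.exp_log h1]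
  · intro w hw
    apply hB
    simp only [mem_preimage, mem_singleton_iff] at hw
    rw [norm_exp, hw, Real.exp_log hr3]
end

section
open Complex Metric Set Filter Topology MeasureTheory

noncomputable def Zf : ℂ → ℂ := Function.update (fun s => (s - 1) * riemannZeta s) 1 1

lemma Zf_of_ne {s : ℂ} (hs : s ≠ 1) : Zf s = (s - 1) * riemannZeta s := by
  simp [Zf, Function.update_of_ne hs]

lemma Zf_one : Zf 1 = 1 := by simp [Zf]

lemma Zf_diff_of_ne {s : ℂ} (hs : s ≠ 1) : DifferentiableAt ℂ Zf s := by
  have h : DifferentiableAt ℂ (fun s => (s - 1) * riemannZeta s) s :=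
    (by fun_prop : DifferentiableAt ℂ (fun s : ℂ => s - 1) s).mul (differentiableAt_riemannZeta hs)
  refine h.congr_of_eventuallyEq ?_
  filter_upwards [isOpen_ne.mem_nhds hs] with w hw using Zf_of_ne hw

lemma Zf_diff : Differentiable ℂ Zf := by
  intro s
  by_cases hs : s = 1
  · subst hs
    refine (analyticAt_of_differentiable_on_punctured_nhds_of_continuousAt ?_ ?_).differentiableAt
    · filter_upwards [self_mem_nhdsWithin] with w hw using Zf_diff_of_ne hw
    · rw [Zf, continuousAt_update_same]
      exact riemannZeta_residue_one
  · exact Zf_diff_of_ne hs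

noncomputable def hfr : ℝ → ℂ := (Ioi (1:ℝ)).indicator (fun x => ((Int.fract x : ℝ) : ℂ))

lemma hfr_meas : Measurable hfr :=
  (Complex.measurable_ofReal.comp measurable_fract).indicator measurableSet_Ioi

lemma hfr_norm_le (x : ℝ) : ‖hfr x‖ ≤ 1 := by
  unfold hfr indicator
  split_ifs
  · rw [Complex.norm_real, Real.norm_eq_abs, abs_of_nonneg (Int.fract_nonneg x)]
    exact (Int.fract_lt_one x).le
  · simp

lemma hfr_locInt : LocallyIntegrableOn hfr (Ioi 0) := by
  apply LocallyIntegrable.locallyIntegrableOn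
  refine (locallyIntegrable_const (1:ℝ)).mono hfr_meas.aestronglyMeasurable ?_
  exact Eventually.of_forall fun x => by simpa using hfr_norm_le x

lemma hfr_top : hfr =O[atTop] fun x : ℝ => x ^ (-(0:ℝ)) := by
  refine Asymptotics.IsBigO.of_bound 1 (Eventually.of_forall fun x => ?_)
  simpa using hfr_norm_le x

lemma hfr_bot (b : ℝ) : hfr =O[𝓝[>] 0] fun x : ℝ => x ^ (-b) := by
  refine Asymptotics.IsBigO.of_bound 1 ?_
  have : Ioo (0:ℝ) 1 ∈ 𝓝[>] (0:ℝ) := Ioo_mem_nhdsGT one_pos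
  filter_upwards [this] with x hx
  have : hfr x = 0 := indicator_of_notMem (by simpa using hx.2.le) _
  rw [this]; simp

lemma mellin_hfr_diff {s : ℂ} (hs : 0 < s.re) : DifferentiableAt ℂ (fun s => mellin hfr (-s)) s := by
  have := mellin_differentiableAt_of_isBigO_rpow (s := -s) (a := 0) (b := -s.re - 1) hfr_locInt hfr_top
    (by simpa using hs) (hfr_bot _) (by simp)
  exact this.comp s differentiableAt_id.neg

lemma mellin_hfr_eq (s : ℂ) : mellin hfr (-s) =
    ∫ t in Ioi (1:ℝ), ((Int.fract t : ℝ) : ℂ) * (t:ℂ) ^ (-(s + 1)) := by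
  unfold mellin
  have : ∀ t : ℝ, (t:ℂ) ^ (-s - 1) • hfr t =
      (Ioi (1:ℝ)).indicator (fun t => ((Int.fract t : ℝ) : ℂ) * (t:ℂ) ^ (-(s + 1))) t := by
    intro t
    unfold hfr
    by_cases h : t ∈ Ioi (1:ℝ)
    · rw [indicator_of_mem h, indicator_of_mem h, smul_eq_mul, mul_comm]; congr 2; ring
    · rw [indicator_of_notMem h, indicator_of_notMem h, smul_zero]
  simp_rw [this]
  rw [setIntegral_indicator measurableSet_Ioi]
  congr 2
  ext x; simp only [mem_inter_iff, mem_Ioi]; constructor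
  · exact fun h => h.2
  · exact fun h => ⟨by linarith, h⟩

lemma mellin_hfr_norm {s : ℂ} (hs : 0 < s.re) : ‖mellin hfr (-s)‖ ≤ 1 / s.re := by
  rw [mellin_hfr_eq]
  have hi : IntegrableOn (fun t : ℝ => t ^ (-s.re - 1)) (Ioi 1) :=
    integrableOn_Ioi_rpow_of_lt (by linarith) one_pos
  calc _ ≤ ∫ t in Ioi (1:ℝ), t ^ (-s.re - 1) := by
        refine norm_integral_le_of_norm_le hi ?_
        refine (ae_restrict_iff' measurableSet_Ioi).2 (Eventually.of_forall fun t ht => ?_)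
        have ht0 : (0:ℝ) < t := one_pos.trans ht
        rw [norm_mul, norm_cpow_eq_rpow_re_of_pos ht0, Complex.norm_real, Real.norm_eq_abs,
          abs_of_nonneg (Int.fract_nonneg t)]
        have e : (-(s+1)).re = -s.re - 1 := by simp; ring
        rw [e]
        exact mul_le_of_le_one_left (by positivity) (Int.fract_lt_one t).le
    _ = 1 / s.re := by
        rw [integral_Ioi_rpow_of_lt (by linarith) one_pos]
        simp

lemma Zf_eq_of_one_lt {s : ℂ} (hs : 1 < s.re) : Zf s = s - s * (s - 1) * mellin hfr (-s) := by
  have hs1 : s ≠ 1 := by rintro rfl; simp at hs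
  have hs1' : s - 1 ≠ 0 := sub_ne_zero.2 hs1
  rw [Zf_of_ne hs1, ← LSeries_one_eq_riemannZeta hs]
  rw [LSeries_eq_mul_integral (r := 1) 1 zero_le_one hs (LSeriesSummable_one_iff.2 hs)
    (Asymptotics.IsBigO.of_bound 1 (Eventually.of_forall fun n => by simp)), mellin_hfr_eq]
  have hI1 : IntegrableOn (fun t : ℝ => (t:ℂ) ^ (-s)) (Ioi 1) :=
    integrableOn_Ioi_cpow_of_lt (by simpa using hs) one_pos
  have hI2 : IntegrableOn (fun t : ℝ => ((Int.fract t : ℝ) : ℂ) * (t:ℂ) ^ (-(s + 1))) (Ioi 1) := by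
    have : IntegrableOn (fun t : ℝ => (t:ℂ) ^ (-(s+1))) (Ioi 1) :=
      integrableOn_Ioi_cpow_of_lt (by simp; linarith) one_pos
    refine this.bdd_mul (c := 1) (Complex.measurable_ofReal.comp measurable_fract).aestronglyMeasurable ?_
    refine Eventually.of_forall fun t => ?_
    rw [Complex.norm_real, Real.norm_eq_abs, abs_of_nonneg (Int.fract_nonneg t)]
    exact (Int.fract_lt_one t).le
  have : ∫ t in Ioi (1:ℝ), (∑ k ∈ Finset.Icc 1 ⌊t⌋₊, (1 : ℕ → ℂ) k) * (t:ℂ) ^ (-(s + 1)) =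
      1 / (s - 1) - ∫ t in Ioi (1:ℝ), ((Int.fract t : ℝ) : ℂ) * (t:ℂ) ^ (-(s + 1)) := by
    have e1 : ∫ t in Ioi (1:ℝ), (t:ℂ) ^ (-s) = 1 / (s - 1) := by
      rw [integral_Ioi_cpow_of_lt (by simpa using hs) one_pos]
      have : -s + 1 ≠ 0 := by intro h; apply hs1'; linear_combination -h
      simp
      rw [← neg_sub, inv_neg, ← sub_eq_neg_add, div_eq_mul_inv]; ring_nf
    rw [← e1, ← integral_sub hI1 hI2]
    refine setIntegral_congr_fun measurableSet_Ioi fun t ht => ?_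
    have ht0 : (0:ℝ) < t := one_pos.trans ht
    have ht' : (t:ℂ) ≠ 0 := by exact_mod_cast ht0.ne'
    have e2 : (t:ℂ) ^ (-s) = t * (t:ℂ) ^ (-(s+1)) := by
      rw [show -s = 1 + (-(s+1)) by ring, cpow_add _ _ ht', cpow_one]
    have e3 : ((⌊t⌋₊ : ℕ) : ℂ) = t - ((Int.fract t : ℝ) : ℂ) := by
      have : ((⌊t⌋₊ : ℕ) : ℝ) = t - Int.fract t := by
        rw [Int.self_sub_fract, natCast_floor_eq_intCast_floor ht0.le]
      rw [← Complex.ofReal_sub, ← this]; simp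
    simp only [Pi.one_apply, Finset.sum_const, Nat.card_Icc, add_tsub_cancel_right, nsmul_eq_mul, mul_one]
    rw [e2, e3]; ring
  rw [this]
  field_simp

lemma Zf_eq {s : ℂ} (hs : 0 < s.re) : Zf s = s - s * (s - 1) * mellin hfr (-s) := by
  have hopen : IsOpen {s : ℂ | 0 < s.re} := isOpen_lt continuous_const continuous_re
  have h1 : AnalyticOnNhd ℂ Zf {s : ℂ | 0 < s.re} :=
    Zf_diff.differentiableOn.analyticOnNhd hopen
  have h2 : AnalyticOnNhd ℂ (fun s => s - s * (s - 1) * mellin hfr (-s)) {s : ℂ | 0 < s.re} := by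
    refine DifferentiableOn.analyticOnNhd (fun s hs => ?_) hopen
    have := mellin_hfr_diff hs
    exact (by fun_prop : DifferentiableAt ℂ _ s).differentiableWithinAt
  refine h1.eqOn_of_preconnected_of_eventuallyEq h2 (convex_halfSpace_re_gt 0).isPreconnected
    (z₀ := 2) (by simp) ?_ hs
  have : {s : ℂ | 1 < s.re} ∈ 𝓝 (2:ℂ) :=
    (isOpen_lt continuous_const continuous_re).mem_nhds (by simp)
  filter_upwards [this] with w hw using Zf_eq_of_one_lt hw

lemma zeta_norm_le {s : ℂ} (hs : 1/2 ≤ s.re) (ht : 1/2 ≤ |s.im|) :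
    ‖riemannZeta s‖ ≤ 4 * ‖s‖ := by
  have hs0 : 0 < s.re := by linarith
  have hs1 : s ≠ 1 := by rintro rfl; norm_num at ht
  have hs1' : s - 1 ≠ 0 := sub_ne_zero.2 hs1
  have h := Zf_eq hs0
  rw [Zf_of_ne hs1] at h
  have h' : riemannZeta s = s / (s - 1) - s * mellin hfr (-s) := by
    field_simp; rw [mul_comm, h]; ring
  have hn : 1/2 ≤ ‖s - 1‖ := by
    calc 1/2 ≤ |(s-1).im| := by simpa using ht
      _ ≤ _ := abs_im_le_norm _
  rw [h']
  calc _ ≤ ‖s / (s-1)‖ + ‖s * mellin hfr (-s)‖ := norm_sub_le _ _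
    _ ≤ 2 * ‖s‖ + ‖s‖ * 2 := by
        rw [norm_div, norm_mul]
        have := mellin_hfr_norm hs0
        have h2 : 1 / s.re ≤ 2 := by rw [div_le_iff₀ hs0]; linarith
        gcongr
        · rw [div_le_iff₀ (by linarith)]; nlinarith [norm_nonneg s]
        · linarith
    _ = _ := by ring
end

section
open Complex Metric Set Filter Topology MeasureTheory

noncomputable def Bz (δ : ℝ) : ℝ := ∑' n : ℕ, ‖LSeries.term 1 ((1 + δ : ℝ) : ℂ) n‖

lemma Bz_summable {δ : ℝ} (hδ : 0 < δ) :
    Summable fun n : ℕ => ‖LSeries.term 1 ((1 + δ : ℝ) : ℂ) n‖ := by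
  have : LSeriesSummable 1 ((1 + δ : ℝ) : ℂ) := LSeriesSummable_one_iff.2 (by simpa using hδ)
  exact this.norm

lemma one_le_Bz {δ : ℝ} (hδ : 0 < δ) : 1 ≤ Bz δ := by
  have := (Bz_summable hδ).le_tsum 1 (fun j _ => norm_nonneg _)
  have e : ‖LSeries.term 1 ((1 + δ : ℝ) : ℂ) 1‖ = 1 := by simp [LSeries.term_def]
  rw [e] at this
  exact this

lemma LSeries_norm_le_Bz {δ : ℝ} (hδ : 0 < δ) {f : ℕ → ℂ} (hf : ∀ n, ‖f n‖ ≤ 1) {s : ℂ}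
    (hs : 1 + δ ≤ s.re) : ‖LSeries f s‖ ≤ Bz δ := by
  refine tsum_of_norm_bounded (Bz_summable hδ).hasSum fun n => ?_
  calc ‖LSeries.term f s n‖ ≤ ‖LSeries.term 1 s n‖ :=
        LSeries.norm_term_le s (by simpa using hf n)
    _ ≤ _ := LSeries.norm_term_le_of_re_le_re 1 (by simpa using hs) n

lemma zeta_norm_le_Bz {δ : ℝ} (hδ : 0 < δ) {s : ℂ} (hs : 1 + δ ≤ s.re) :
    ‖riemannZeta s‖ ≤ Bz δ := by
  rw [← LSeries_one_eq_riemannZeta (by linarith)]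
  exact LSeries_norm_le_Bz hδ (by simp) hs

lemma inv_zeta_eq {s : ℂ} (hs : 1 < s.re) : (riemannZeta s)⁻¹ =
    LSeries (fun n => ((ArithmeticFunction.moebius n : ℤ) : ℂ)) s := by
  have h := ArithmeticFunction.LSeries_zeta_mul_Lseries_moebius hs
  rw [ArithmeticFunction.LSeries_zeta_eq_riemannZeta hs] at h
  exact (eq_inv_of_mul_eq_one_right h).symm

lemma moebius_norm_le (n : ℕ) : ‖((ArithmeticFunction.moebius n : ℤ) : ℂ)‖ ≤ 1 := by
  rw [Complex.norm_intCast]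
  exact_mod_cast ArithmeticFunction.abs_moebius_le_one

lemma inv_zeta_norm_le_Bz {δ : ℝ} (hδ : 0 < δ) {s : ℂ} (hs : 1 + δ ≤ s.re) :
    ‖(riemannZeta s)⁻¹‖ ≤ Bz δ := by
  rw [inv_zeta_eq (by linarith)]
  exact LSeries_norm_le_Bz hδ moebius_norm_le hs

lemma zeta_ne_zero_of_RH (hRH : RiemannHypothesis) {s : ℂ} (hs : 1/2 < s.re) (h1 : s ≠ 1) :
    riemannZeta s ≠ 0 := by
  intro h
  have := hRH s h ?_ h1
  · linarith
  · rintro ⟨n, rfl⟩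
    have : ((-2 : ℂ) * (n + 1)).re = -2 * (n + 1) := by simp
    rw [this] at hs
    have : (0:ℝ) ≤ n := n.cast_nonneg
    linarith

lemma rpow_le_eps {θ η : ℝ} (hθ : 0 ≤ θ) (hθ1 : θ < 1) (hη : 0 < η) :
    ∃ K : ℝ, 0 ≤ K ∧ ∀ x : ℝ, 1 ≤ x → x ^ θ ≤ η * x + K := by
  have h := (tendsto_rpow_neg_atTop (sub_pos.2 hθ1)).eventually (ge_mem_nhds hη)
  rw [eventually_atTop] at h
  obtain ⟨N, hN⟩ := h
  refine ⟨(max N 1) ^ θ, by positivity, fun x hx => ?_⟩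
  have hx0 : 0 < x := by linarith
  rcases le_total N x with h | h
  · have := hN x h
    have h0 : (0:ℝ) ≤ (max N 1) ^ θ := by positivity
    have e : x ^ θ = x ^ (-(1 - θ)) * x := by
      nth_rewrite 3 [← Real.rpow_one x]
      rw [← Real.rpow_add hx0]; congr 1; ring
    rw [e]
    have : x ^ (-(1 - θ)) * x ≤ η * x := by gcongr
    linarith
  · have : x ^ θ ≤ (max N 1) ^ θ := by gcongr; exact h.trans (le_max_left _ _)
    nlinarith

lemma inv_zeta_bound_strip (hRH : RiemannHypothesis) {δ ε : ℝ} (hδ : 0 < δ) (hδ1 : δ < 1/8)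
    (hε : 0 < ε) : ∃ K : ℝ, 0 < K ∧ ∀ s : ℂ, 1/2 + 2 * δ ≤ s.re → s.re ≤ 1 + 2 * δ → 2 ≤ |s.im| →
      ‖(riemannZeta s)⁻¹‖ ≤ K * |s.im| ^ ε := by
  set B := Bz δ with hB
  have hB1 : 1 ≤ B := one_le_Bz hδ
  set r1 : ℝ := 1 - 2 * δ with hr1
  set r3 : ℝ := 3/2 - δ with hr3
  set r2 : ℝ := 3/2 - 2 * δ with hr2
  have h1pos : 0 < r1 := by linarith
  set A : ℝ := 2 * (Real.log (B * B) + 1) * r1 / (1 - δ - r1) with hA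
  have hApos : 0 < A := by
    have : 0 ≤ Real.log (B * B) := Real.log_nonneg (by nlinarith)
    have : 0 < 1 - δ - r1 := by rw [hr1]; linarith
    positivity
  set c1 : ℝ := 2 * r3 / (3/2 - r3) with hc1
  have hc1pos : 0 < c1 := by
    have : 0 < 3/2 - r3 := by rw [hr3]; linarith
    have : 0 < r3 := by rw [hr3]; linarith
    positivity
  set θ0 : ℝ := Real.log (r2 / r1) / Real.log (r3 / r1) with hθ0
  have hl3 : 0 < Real.log (r3 / r1) := Real.log_pos (by rw [one_lt_div h1pos]; linarith)
  have hθ0' : 0 ≤ θ0 := div_nonneg (Real.log_nonneg (by rw [one_le_div h1pos]; linarith)) hl3.le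
  have hθ1 : θ0 < 1 := by
    rw [hθ0, div_lt_one hl3]
    apply Real.log_lt_log (div_pos (by linarith) h1pos)
    gcongr; linarith
  obtain ⟨K0, hK0, hK⟩ := rpow_le_eps hθ0' hθ1 (div_pos hε hc1pos)
  refine ⟨B * Real.exp (A * (ε / c1 + K0) + ε * Real.log (12 * B)), by positivity, ?_⟩
  intro s hs1 hs2 hst
  set t := s.im with ht
  have htpos : 0 < |t| := by linarith
  set c : ℂ := ⟨2, t⟩ with hc
  have hne : ∀ z ∈ ball (0:ℂ) (3/2), 1/2 < (c + z).re ∧ 1/2 ≤ |(c+z).im| ∧ c + z ≠ 1 := by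
    intro z hz
    rw [mem_ball_zero_iff] at hz
    have h1 := abs_re_le_norm z
    have h2 := abs_im_le_norm z
    have hre : (c + z).re = 2 + z.re := by simp [hc]
    have him : (c + z).im = t + z.im := by simp [hc]
    have e : 1/2 ≤ |(c + z).im| := by
      rw [him]
      have := abs_sub_abs_le_abs_sub t (-z.im)
      rw [abs_neg, sub_neg_eq_add] at this
      linarith
    refine ⟨?_, e, ?_⟩
    · rw [hre]; linarith [neg_abs_le z.re]
    · intro h; rw [h] at e; norm_num at e
  have hd : DifferentiableOn ℂ (fun z => riemannZeta (c + z)) (ball 0 (3/2)) := by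
    intro z hz
    have := differentiableAt_riemannZeta (hne z hz).2.2
    exact (this.comp z (by fun_prop : DifferentiableAt ℂ (fun z => c + z) z)).differentiableWithinAt
  obtain ⟨g, hg, hg0, hfg⟩ := exists_log_ball (by norm_num) hd
    (fun z hz => zeta_ne_zero_of_RH hRH (hne z hz).1 (hne z hz).2.2)
  simp only [add_zero] at hfg
  have hcre : 1 + δ ≤ c.re := by simp [hc]; linarith
  have hc0 : riemannZeta c ≠ 0 := by
    have := zeta_ne_zero_of_RH hRH (hne 0 (by simp)).1 (hne 0 (by simp)).2.2
    simpa using this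
  have hinvc : ‖(riemannZeta c)⁻¹‖ ≤ B := inv_zeta_norm_le_Bz hδ hcre
  have hgre : ∀ z ∈ ball (0:ℂ) (3/2), ∀ X : ℝ, ‖riemannZeta (c + z)‖ ≤ X → 0 < X →
      (g z).re ≤ Real.log (X * B) := by
    intro z hz X hX hX0
    rw [Real.le_log_iff_exp_le (by positivity), ← norm_exp]
    have : exp (g z) = riemannZeta (c + z) * (riemannZeta c)⁻¹ := by
      rw [hfg z hz]; field_simp
    rw [this, norm_mul]
    gcongr
  set L := Real.log (12 * |t| * B) with hL
  have hLpos : 0 < L := Real.log_pos (by nlinarith)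
  have hb3 : ∀ z ∈ ball (0:ℂ) (3/2), (g z).re ≤ L := by
    intro z hz
    refine hgre z hz (12 * |t|) ?_ (by positivity)
    refine (zeta_norm_le (hne z hz).1.le (hne z hz).2.1).trans ?_
    rw [mem_ball_zero_iff] at hz
    have h1 : ‖c‖ ≤ 2 + |t| := by
      have := Complex.norm_le_abs_re_add_abs_im c
      simpa [hc] using this
    have := norm_add_le c z
    linarith
  have hA' : ∀ z, ‖z‖ = r1 → ‖g z‖ ≤ A := by
    intro z hz
    have hsub : ball (0:ℂ) (1 - δ) ⊆ ball 0 (3/2) := ball_subset_ball (by linarith)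
    have := borelCaratheodory_zero (M := Real.log (B * B) + 1) (R := 1 - δ) (z := z)
      (by have : 0 ≤ Real.log (B * B) := Real.log_nonneg (by nlinarith)
          linarith) (hg.mono hsub) ?_ (by linarith)
      (by rw [mem_ball_zero_iff, hz, hr1]; linarith) hg0
    · rw [hz] at this; exact this
    · intro w hw
      have hw' := hsub hw
      have := hgre w hw' B (zeta_norm_le_Bz hδ ?_) (by linarith)
      · simp only [mem_ofPred_eq]; linarith
      · rw [mem_ball_zero_iff] at hw
        have h1 := abs_re_le_norm w
        have : (c + w).re = 2 + w.re := by simp [hc]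
        rw [this]; linarith [neg_abs_le w.re]
  have hB' : ∀ z, ‖z‖ = r3 → ‖g z‖ ≤ c1 * L := by
    intro z hz
    have := borelCaratheodory_zero (M := L) (R := 3/2) (z := z) hLpos hg (fun w hw => hb3 w hw)
      (by norm_num) (by rw [mem_ball_zero_iff, hz, hr3]; linarith) hg0
    rw [hz] at this
    calc _ ≤ _ := this
      _ = c1 * L := by rw [hc1]; ring
  set z : ℂ := ((s.re - 2 : ℝ) : ℂ) with hz
  have hzn : ‖z‖ = 2 - s.re := by
    rw [hz, Complex.norm_real, Real.norm_eq_abs, abs_of_neg (by linarith)]; ring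
  have hcz : c + z = s := by
    apply Complex.ext <;> simp [hc, hz, ht]
  have h3c := three_circles h1pos (by linarith : r1 < r3) (by linarith : r3 < 3/2) hg hA' hB'
    (z := z) (by rw [hzn]; linarith) (by rw [hzn]; linarith)
  set θ := Real.log (‖z‖ / r1) / Real.log (r3 / r1) with hθ
  have hzpos : 0 < ‖z‖ := by rw [hzn]; linarith
  have hθle : θ ≤ θ0 := by
    rw [hθ, hθ0]
    gcongr
    rw [hzn]; linarith
  have hθnn : 0 ≤ θ := by
    refine div_nonneg (Real.log_nonneg ?_) hl3.le
    rw [one_le_div h1pos, hzn]; linarith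
  have hgz : ‖g z‖ ≤ A * (ε / c1 + K0) + ε * Real.log (12 * B) + ε * Real.log |t| := by
    have hx : 1 ≤ 1 + c1 * L / A := by
      have : 0 ≤ c1 * L / A := by positivity
      linarith
    calc ‖g z‖ ≤ _ := h3c
      _ = A * (c1 * L / A) ^ θ := by
        rw [Real.rpow_sub hApos, Real.rpow_one, Real.div_rpow (by positivity) hApos.le]
        ring
      _ ≤ A * (1 + c1 * L / A) ^ θ0 := by
        gcongr
        calc (c1 * L / A) ^ θ ≤ (1 + c1 * L / A) ^ θ := by gcongr; linarith
          _ ≤ _ := Real.rpow_le_rpow_of_exponent_le hx hθle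
      _ ≤ A * (ε / c1 * (1 + c1 * L / A) + K0) := by
        gcongr; exact hK _ hx
      _ = A * (ε / c1 + K0) + ε * L := by field_simp; ring
      _ = _ := by
        rw [hL, show 12 * |t| * B = (12 * B) * |t| by ring, Real.log_mul (by positivity) (by positivity)]
        ring
  have hzmem : z ∈ ball (0:ℂ) (3/2) := by rw [mem_ball_zero_iff, hzn]; linarith
  have := hfg z hzmem
  rw [hcz] at this
  rw [this, mul_inv, norm_mul, ← exp_neg, norm_exp]
  calc _ ≤ B * Real.exp (A * (ε / c1 + K0) + ε * Real.log (12 * B) + ε * Real.log |t|) := by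
        gcongr
        rw [neg_re]
        linarith [neg_abs_le (g z).re, abs_re_le_norm (g z)]
    _ = _ := by
        rw [Real.exp_add _ (ε * Real.log |t|), Real.rpow_def_of_pos htpos, mul_comm ε (Real.log |t|)]
        ring
end

section
open Complex Metric Set Filter Topology MeasureTheory

noncomputable def fi (s : ℂ) : ℂ := (s - 1) / Zf s

lemma fi_of_ne {s : ℂ} (hs : s ≠ 1) : fi s = (riemannZeta s)⁻¹ := by
  have : s - 1 ≠ 0 := sub_ne_zero.2 hs
  rw [fi, Zf_of_ne hs]; rw [div_mul_eq_div_div, div_self this, one_div]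

lemma Zf_ne_zero (hRH : RiemannHypothesis) {s : ℂ} (hs : 1/2 < s.re) : Zf s ≠ 0 := by
  by_cases h : s = 1
  · rw [h, Zf_one]; exact one_ne_zero
  · rw [Zf_of_ne h]
    exact mul_ne_zero (sub_ne_zero.2 h) (zeta_ne_zero_of_RH hRH hs h)

lemma fi_diff (hRH : RiemannHypothesis) {s : ℂ} (hs : 1/2 < s.re) : DifferentiableAt ℂ fi s := by
  have h1 := Zf_diff s
  have h2 := Zf_ne_zero hRH hs
  unfold fi
  fun_prop (disch := assumption)

lemma fi_bound (hRH : RiemannHypothesis) {δ ε : ℝ} (hδ : 0 < δ) (hδ1 : δ < 1/8)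
    (hε : 0 < ε) : ∃ K : ℝ, 0 < K ∧ ∀ s : ℂ, 1/2 + 2 * δ ≤ s.re → s.re ≤ 2 →
      ‖fi s‖ ≤ K * (1 + |s.im|) ^ ε := by
  obtain ⟨K1, hK1, hb1⟩ := inv_zeta_bound_strip hRH hδ hδ1 hε
  have hcomp : IsCompact (Icc (1/2 + 2 * δ) 2 ×ℂ Icc (-2) 2) := isCompact_Icc.reProdIm isCompact_Icc
  have hcont : ContinuousOn fi (Icc (1/2 + 2 * δ) 2 ×ℂ Icc (-2) 2) := by
    intro s hs
    have : 1/2 + 2 * δ ≤ s.re := hs.1.1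
    exact (fi_diff hRH (by linarith)).continuousAt.continuousWithinAt
  obtain ⟨K2, hK2⟩ := hcomp.exists_bound_of_continuousOn hcont
  have hBz := one_le_Bz (δ := 2 * δ) (by linarith)
  refine ⟨K1 + |K2| + Bz (2 * δ), by positivity, fun s hs1 hs2 => ?_⟩
  have hone : (1:ℝ) ≤ (1 + |s.im|) ^ ε :=
    Real.one_le_rpow (by linarith [abs_nonneg s.im]) hε.le
  rcases le_total |s.im| 2 with h | h
  · have := hK2 s ⟨⟨hs1, hs2⟩, abs_le.1 h⟩
    calc ‖fi s‖ ≤ |K2| := this.trans (le_abs_self _)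
      _ ≤ (K1 + |K2| + Bz (2 * δ)) * 1 := by linarith
      _ ≤ _ := by gcongr
  · have hne : s ≠ 1 := by rintro rfl; norm_num at h
    rw [fi_of_ne hne]
    rcases le_total s.re (1 + 2 * δ) with h2 | h2
    · calc _ ≤ _ := hb1 s hs1 h2 h
        _ ≤ (K1 + |K2| + Bz (2 * δ)) * (1 + |s.im|) ^ ε := by
          gcongr
          · linarith [abs_nonneg K2]
          · linarith
    · calc _ ≤ _ := inv_zeta_norm_le_Bz (by linarith) h2
        _ ≤ (K1 + |K2| + Bz (2 * δ)) * 1 := by linarith [abs_nonneg K2]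
        _ ≤ _ := by gcongr

lemma int_bd {η : ℝ} (hη : 0 < η) : Integrable (fun y : ℝ => (1 + |y|) ^ (-(1 + η))) := by
  have := integrable_one_add_norm (E := ℝ) (μ := volume) (r := 1 + η) (by simp [hη])
  simpa using this

lemma contour_shift {f : ℂ → ℂ} {a b K η : ℝ} (hab : a ≤ b) (hη : 0 < η)
    (hf : ∀ s : ℂ, a ≤ s.re → s.re ≤ b → DifferentiableAt ℂ f s)
    (hb : ∀ s : ℂ, a ≤ s.re → s.re ≤ b → ‖f s‖ ≤ K * (1 + |s.im|) ^ (-(1 + η))) :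
    ∫ y : ℝ, f (a + y * I) = ∫ y : ℝ, f (b + y * I) := by
  have hInteg : ∀ c : ℝ, a ≤ c → c ≤ b → Integrable (fun y : ℝ => f (c + y * I)) := by
    intro c h1 h2
    refine ((int_bd hη).const_mul K).mono' ?_ ?_
    · apply Continuous.aestronglyMeasurable
      rw [continuous_iff_continuousAt]
      intro y
      exact ContinuousAt.comp (f := fun y : ℝ => (c + y * I : ℂ)) (g := f)
        (hf _ (by simpa using h1) (by simpa using h2)).continuousAt (by fun_prop)
    · refine Eventually.of_forall fun y => ?_
      have := hb (c + y * I) (by simpa using h1) (by simpa using h2)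
      simpa using this
  have hlim : ∀ c : ℝ, a ≤ c → c ≤ b →
      Tendsto (fun U : ℝ => ∫ y in (-U)..U, f (c + y * I)) atTop (𝓝 (∫ y : ℝ, f (c + y * I))) :=
    fun c h1 h2 => intervalIntegral_tendsto_integral (hInteg c h1 h2) tendsto_neg_atTop_atBot tendsto_id
  have hhor : ∀ σ : ℝ → ℝ, (∀ U, |σ U| = |U|) →
      Tendsto (fun U : ℝ => ∫ x in a..b, f (x + σ U * I)) atTop (𝓝 0) := by
    intro σ hσ
    have h0 : Tendsto (fun U : ℝ => K * (1 + |U|) ^ (-(1 + η)) * |b - a|) atTop (𝓝 0) := by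
      have h1 : Tendsto (fun U : ℝ => 1 + |U|) atTop atTop :=
        tendsto_atTop_add_const_left _ _ tendsto_abs_atTop_atTop
      have h2 := (tendsto_rpow_neg_atTop (by linarith : 0 < 1 + η)).comp h1
      simpa using (h2.const_mul K).mul_const |b - a|
    refine squeeze_zero_norm (fun U => ?_) h0
    refine intervalIntegral.norm_integral_le_of_norm_le_const fun x hx => ?_
    rw [uIoc_of_le hab] at hx
    have := hb (x + σ U * I) (by simpa using hx.1.le) (by simpa using hx.2)
    simpa [hσ] using this
  have hrect : ∀ U : ℝ, (∫ x : ℝ in a..b, f (x + (-U : ℝ) * I)) - (∫ x : ℝ in a..b, f (x + U * I)) +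
      I • (∫ y : ℝ in (-U)..U, f (b + y * I)) - I • (∫ y : ℝ in (-U)..U, f (a + y * I)) = 0 := by
    intro U
    have := integral_boundary_rect_eq_zero_of_differentiableOn f ⟨a, -U⟩ ⟨b, U⟩ ?_
    · simpa using this
    · intro s hs
      have h1 := hs.1
      simp only [uIcc_of_le hab, mem_preimage, mem_Icc] at h1
      exact (hf s h1.1 h1.2).differentiableWithinAt
  have h1 := ((((hhor (fun U => -U) (by simp)).sub (hhor (fun U => U) (by simp))).add
    ((hlim b hab le_rfl).const_smul I)).sub ((hlim a le_rfl hab).const_smul I))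
  have h2 := tendsto_nhds_unique (h1.congr hrect) tendsto_const_nhds
  simp only [sub_self, zero_add, smul_eq_mul] at h2
  have : I * ((∫ y : ℝ, f (b + y * I)) - ∫ y : ℝ, f (a + y * I)) = 0 := by rw [mul_sub]; exact h2
  have := (mul_eq_zero.1 this).resolve_left I_ne_zero
  exact (sub_eq_zero.1 this).symm

noncomputable def wk (t : ℝ) : ℂ :=
  indicator (Ioc 0 1) (fun _ => 1 : ℝ → ℂ) t - indicator (Ioc 0 1) (fun t => (t:ℂ) ^ (1:ℂ) : ℝ → ℂ) t

lemma wk_eq {t : ℝ} (ht : 0 < t) : wk t = ((max (1 - t) 0 : ℝ) : ℂ) := by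
  unfold wk
  by_cases h : t ≤ 1
  · have hm : t ∈ Ioc (0:ℝ) 1 := ⟨ht, h⟩
    rw [indicator_of_mem hm, indicator_of_mem hm, max_eq_left (by linarith)]
    simp
  · have hm : t ∉ Ioc (0:ℝ) 1 := fun h' => h h'.2
    rw [indicator_of_notMem hm, indicator_of_notMem hm, max_eq_right (by linarith)]
    simp

lemma wk_mellin {s : ℂ} (hs : 0 < s.re) : HasMellin wk s (1 / (s * (s + 1))) := by
  have h1 := hasMellin_one_Ioc hs
  have h2 := hasMellin_cpow_Ioc 1 (s := s) (by simp; linarith)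
  have h := hasMellin_sub h1.1 h2.1
  rw [h1.2, h2.2] at h
  have hs0 : s ≠ 0 := by rintro rfl; simp at hs
  have hs1 : s + 1 ≠ 0 := by intro h; have := congrArg re h; simp at this; linarith
  have : 1 / s - 1 / (s + 1) = 1 / (s * (s + 1)) := by field_simp; ring
  rw [this] at h
  exact h

lemma one_add_le_norm {s : ℂ} (hs : 1/2 ≤ s.re) : 1 + |s.im| ≤ 3 * ‖s‖ := by
  have h1 := abs_re_le_norm s
  have h2 := abs_im_le_norm s
  have := le_abs_self s.re
  linarith

lemma ker_bound {s : ℂ} (hs : 1/2 ≤ s.re) : ‖1 / (s * (s + 1))‖ ≤ 9 * (1 + |s.im|) ^ (-(1 + 1 : ℝ)) := by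
  have h1 := one_add_le_norm hs
  have h2 := one_add_le_norm (s := s + 1) (by simp; linarith)
  have e : (s + 1).im = s.im := by simp
  rw [e] at h2
  have hp : 0 < 1 + |s.im| := by positivity
  rw [Real.rpow_neg hp.le, show (1 + 1 : ℝ) = ((2:ℕ):ℝ) by norm_num, Real.rpow_natCast, norm_div, norm_mul, norm_one, ← div_eq_mul_inv,
    div_le_div_iff₀ (by have : 0 < ‖s‖ := by linarith
                        have : 0 < ‖s+1‖ := by linarith
                        positivity) (by positivity)]
  nlinarith [mul_le_mul h1 h2 hp.le (by linarith)]

lemma wk_inv {x : ℝ} (hx : 0 < x) : ∫ y : ℝ, (x:ℂ) ^ (-((2:ℝ) + y * I : ℂ)) *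
    (1 / (((2:ℝ) + y * I : ℂ) * (((2:ℝ) + y * I : ℂ) + 1))) = 2 * Real.pi * ((max (1 - x) 0 : ℝ) : ℂ) := by
  have hm : ∀ y : ℝ, mellin wk ((2:ℝ) + y * I : ℂ) =
      1 / (((2:ℝ) + y * I : ℂ) * (((2:ℝ) + y * I : ℂ) + 1)) := fun y => (wk_mellin (by simp)).2
  have h := mellinInv_mellin_eq 2 wk hx (wk_mellin (by simp)).1 ?_ ?_
  · rw [wk_eq hx] at h
    rw [← h, mellinInv]
    simp_rw [hm]
    simp only [smul_eq_mul, real_smul]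
    push_cast
    have : (Real.pi : ℂ) ≠ 0 := by exact_mod_cast Real.pi_ne_zero
    field_simp
    simp only [mul_comm I]
  · unfold VerticalIntegrable
    simp_rw [hm]
    refine ((int_bd one_pos).const_mul 9).mono' ?_ ?_
    · apply Continuous.aestronglyMeasurable
      apply Continuous.div (by fun_prop) (by fun_prop)
      intro y h
      rcases mul_eq_zero.1 h with h | h
      · have := congrArg re h; simp at this
      · have := congrArg re h; simp at this; norm_num at this
    · refine Eventually.of_forall fun y => ?_
      have := ker_bound (s := (2:ℝ) + y * I) (by simp; norm_num)
      simpa using this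
  · have : ContinuousAt (fun t : ℝ => ((max (1 - t) 0 : ℝ) : ℂ)) x := by fun_prop
    refine this.congr ?_
    filter_upwards [Ioi_mem_nhds hx] with t ht using (wk_eq ht).symm
end

section
open Complex Metric Set Filter Topology MeasureTheory

noncomputable def M1 (N : ℕ) : ℝ := ∑ n ∈ Finset.Icc 1 N, (ArithmeticFunction.moebius n : ℝ) * ((N:ℝ) - n)

lemma cpow_div_aux {n N : ℕ} (hn : 0 < n) (hN : 0 < N) (s : ℂ) :
    (((n / N : ℝ) : ℝ) : ℂ) ^ (-s) = (N:ℂ) ^ s / (n:ℂ) ^ s := by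
  have h1 : ((n / N : ℝ) : ℂ) = (n:ℝ) * ((N:ℝ)⁻¹ : ℝ) := by push_cast; rw [div_eq_mul_inv]
  rw [h1, mul_cpow_ofReal_nonneg (by positivity) (by positivity)]
  rw [cpow_neg, ofReal_inv, inv_cpow, cpow_neg, inv_inv]
  · push_cast; rw [div_eq_mul_inv, mul_comm]
  · rw [ofReal_natCast, natCast_arg]; exact Real.pi_pos.ne

lemma perron_two (N : ℕ) (hN : 0 < N) :
    ∫ y : ℝ, (N:ℂ) ^ (((2:ℝ) + y * I : ℂ) + 1) *
      (1 / (((2:ℝ) + y * I : ℂ) * (((2:ℝ) + y * I : ℂ) + 1))) * fi ((2:ℝ) + y * I : ℂ) =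
      2 * Real.pi * (M1 N : ℂ) := by
  set S : ℝ → ℂ := fun y => ((2:ℝ) + y * I : ℂ) with hS
  set k : ℝ → ℂ := fun y => 1 / (S y * (S y + 1)) with hk
  have hSre : ∀ y, (S y).re = 2 := fun y => by simp [hS]
  have hkc : Continuous k := by
    apply Continuous.div (by fun_prop) (by fun_prop)
    intro y h
    rcases mul_eq_zero.1 h with h | h
    · have := congrArg re h; simp [hS] at this
    · have := congrArg re h; simp [hS] at this; norm_num at this
  have hkb : ∀ y, ‖k y‖ ≤ 9 * (1 + |y|) ^ (-(1 + 1 : ℝ)) := fun y => by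
    have := ker_bound (s := S y) (by rw [hSre]; norm_num)
    simpa [hS, hk] using this
  have hki : Integrable k := ((int_bd one_pos).const_mul 9).mono' hkc.aestronglyMeasurable
    (Eventually.of_forall hkb)
  have hNpos : (0:ℝ) < N := by exact_mod_cast hN
  have hNc : (N:ℂ) ≠ 0 := by exact_mod_cast hN.ne'
  set Fn : ℕ → ℝ → ℂ := fun n y =>
    (N:ℂ) ^ (S y + 1) * LSeries.term (fun n => ((ArithmeticFunction.moebius n : ℤ) : ℂ)) (S y) n * k y with hFn
  have hFcont : ∀ n, Continuous (Fn n) := by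
    intro n
    rcases Nat.eq_zero_or_pos n with rfl | hn
    · simp only [hFn, LSeries.term_zero, mul_zero, zero_mul]; exact continuous_const
    · have hn' : (n:ℂ) ≠ 0 := by exact_mod_cast hn.ne'
      simp only [hFn, LSeries.term_of_ne_zero hn.ne']
      have h1 : Continuous fun y => (N:ℂ) ^ (S y + 1) :=
        Continuous.const_cpow (by fun_prop) (Or.inl hNc)
      have h2 : Continuous fun y => (n:ℂ) ^ (S y) :=
        Continuous.const_cpow (by fun_prop) (Or.inl hn')
      refine (h1.mul (continuous_const.div h2 fun y => ?_)).mul hkc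
      simp [hn']
  have hFb : ∀ n y, ‖Fn n y‖ ≤ (N:ℝ) ^ (3:ℝ) * ‖LSeries.term 1 ((1 + 1 : ℝ) : ℂ) n‖ * ‖k y‖ := by
    intro n y
    simp only [hFn, norm_mul]
    gcongr
    · have : ‖(N:ℂ) ^ (S y + 1)‖ = (N:ℝ) ^ (3:ℝ) := by
        have := norm_cpow_eq_rpow_re_of_pos hNpos (S y + 1)
        rw [add_re, hSre, one_re, ofReal_natCast] at this
        rw [this]; norm_num
      rw [this]
    · calc _ ≤ ‖LSeries.term 1 (S y) n‖ :=
            LSeries.norm_term_le (S y) (by simpa using moebius_norm_le n)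
        _ ≤ _ := LSeries.norm_term_le_of_re_le_re 1 (by rw [hSre]; simp; norm_num) n
  have hFi : ∀ n, Integrable (Fn n) := fun n =>
    (hki.norm.const_mul ((N:ℝ) ^ (3:ℝ) * ‖LSeries.term 1 ((1 + 1 : ℝ) : ℂ) n‖)).mono'
      (hFcont n).aestronglyMeasurable (Eventually.of_forall (hFb n))
  have hsum : Summable fun n => ∫ y, ‖Fn n y‖ := by
    refine Summable.of_nonneg_of_le (fun n => integral_nonneg fun y => norm_nonneg _) (fun n => ?_)
      (((Bz_summable one_pos).mul_left ((N:ℝ) ^ (3:ℝ))).mul_right (∫ y, ‖k y‖))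
    rw [← integral_const_mul]
    exact integral_mono (hFi n).norm (hki.norm.const_mul _) (hFb n)
  have hmain := (hasSum_integral_of_summable_integral_norm hFi hsum).tsum_eq
  have hR : ∀ y, ∑' n, Fn n y = (N:ℂ) ^ (S y + 1) * k y * fi (S y) := by
    intro y
    have hne : S y ≠ 1 := by intro h; have := hSre y; rw [h] at this; norm_num at this
    rw [fi_of_ne hne, inv_zeta_eq (by rw [hSre]; norm_num)]
    simp only [hFn]
    rw [tsum_mul_right, tsum_mul_left, LSeries]; ring
  simp_rw [hR] at hmain
  rw [← hmain]
  have hterm : ∀ n : ℕ, 0 < n → ∫ y, Fn n y =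
      2 * Real.pi * (((ArithmeticFunction.moebius n : ℤ) : ℂ) * N * ((max (1 - (n / N : ℝ)) 0 : ℝ) : ℂ)) := by
    intro n hn
    have hx : (0:ℝ) < n / N := by positivity
    have := wk_inv hx
    rw [show (2 * Real.pi * (((ArithmeticFunction.moebius n : ℤ) : ℂ) * N * ((max (1 - (n / N : ℝ)) 0 : ℝ) : ℂ)) : ℂ)
      = (((ArithmeticFunction.moebius n : ℤ) : ℂ) * N) * (2 * Real.pi * ((max (1 - (n / N : ℝ)) 0 : ℝ) : ℂ)) by ring,
      ← this, ← integral_const_mul]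
    congr 1; ext y
    rw [cpow_div_aux hn hN]
    simp only [hFn, LSeries.term_of_ne_zero hn.ne', hk, hS]
    rw [cpow_add _ _ hNc, cpow_one]; ring
  rw [tsum_eq_sum (s := Finset.Icc 1 N)]
  · unfold M1
    rw [Finset.sum_congr rfl fun n hn => hterm n (Finset.mem_Icc.1 hn).1, ← Finset.mul_sum]
    congr 1
    push_cast
    refine Finset.sum_congr rfl fun n hn => ?_
    have h2 : (n:ℝ) ≤ N := by exact_mod_cast (Finset.mem_Icc.1 hn).2
    have : (max (1 - (n / N : ℝ)) 0 : ℝ) = 1 - n / N := max_eq_left (by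
      rw [sub_nonneg, div_le_one hNpos]; exact h2)
    have h3 : ((max (1 - (n / N : ℝ)) 0 : ℝ) : ℂ) = 1 - n / N := by rw [this]; push_cast; rfl
    push_cast at h3
    rw [h3]; field_simp
  · intro n hn
    rcases Nat.eq_zero_or_pos n with rfl | hn0
    · simp [hFn]
    · rw [hterm n hn0]
      have h2 : (N:ℝ) ≤ n := by
        have : ¬ n ≤ N := fun h => hn (Finset.mem_Icc.2 ⟨hn0, h⟩)
        exact_mod_cast (by omega : N ≤ n)
      have : (max (1 - (n / N : ℝ)) 0 : ℝ) = 0 := max_eq_right (by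
        rw [sub_nonpos, one_le_div hNpos]; exact h2)
      rw [this]; simp

lemma perron (hRH : RiemannHypothesis) {σ : ℝ} (hσ : 1/2 < σ) (hσ2 : σ ≤ 2) (N : ℕ) (hN : 0 < N) :
    ∫ y : ℝ, (N:ℂ) ^ ((σ + y * I : ℂ) + 1) *
      (1 / ((σ + y * I : ℂ) * ((σ + y * I : ℂ) + 1))) * fi (σ + y * I : ℂ) =
      2 * Real.pi * (M1 N : ℂ) := by
  rw [← perron_two N hN]
  set δ := min ((σ - 1/2) / 2) (1/16) with hδ
  have hδ0 : 0 < δ := lt_min (by linarith) (by norm_num)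
  have hδ1 : δ < 1/8 := (min_le_right _ _).trans_lt (by norm_num)
  have hδ2 : 1/2 + 2 * δ ≤ σ := by have := min_le_left ((σ - 1/2) / 2) (1/16); linarith
  obtain ⟨K, hK, hb⟩ := fi_bound hRH hδ0 hδ1 (ε := 1/2) (by norm_num)
  have hN1 : (1:ℝ) ≤ N := by exact_mod_cast hN
  have hNc : (N:ℂ) ≠ 0 := by exact_mod_cast hN.ne'
  refine contour_shift (f := fun s => (N:ℂ) ^ (s + 1) * (1 / (s * (s + 1))) * fi s) (η := 1/2)
    (K := (N:ℝ) ^ (3:ℝ) * 9 * K) hσ2 (by norm_num) ?_ ?_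
  · intro s h1 h2
    have := fi_diff hRH (lt_of_lt_of_le hσ h1)
    have hs0 : s ≠ 0 := by rintro rfl; simp at h1; linarith
    have hs1 : s + 1 ≠ 0 := by intro h; have := congrArg re h; simp at this; linarith
    have h3 : DifferentiableAt ℂ (fun s : ℂ => (N:ℂ) ^ (s + 1)) s :=
      DifferentiableAt.const_cpow (by fun_prop) (Or.inl hNc)
    have h4 : s * (s + 1) ≠ 0 := mul_ne_zero hs0 hs1
    fun_prop (disch := assumption)
  · intro s h1 h2
    rw [norm_mul, norm_mul]
    have hp : 0 < 1 + |s.im| := by positivity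
    calc _ ≤ (N:ℝ) ^ (3:ℝ) * (9 * (1 + |s.im|) ^ (-(1 + 1 : ℝ))) * (K * (1 + |s.im|) ^ (1/2 : ℝ)) := by
          gcongr
          · have := norm_cpow_eq_rpow_re_of_pos (by linarith : (0:ℝ) < N) (s + 1)
            rw [ofReal_natCast] at this
            rw [this]
            exact Real.rpow_le_rpow_of_exponent_le hN1 (by simp; linarith)
          · exact ker_bound (by linarith)
          · exact hb s (by linarith) h2
      _ = (N:ℝ) ^ (3:ℝ) * 9 * K * ((1 + |s.im|) ^ (-(1 + 1 : ℝ)) * (1 + |s.im|) ^ (1/2 : ℝ)) := by ring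
      _ = _ := by rw [← Real.rpow_add hp]; norm_num
end

section
open Complex Metric Set Filter Topology MeasureTheory

lemma cpow_diff_bound {a b : ℝ} (ha : 0 < a) (hab : a ≤ b) {w : ℂ} (hw : 1 ≤ w.re) :
    ‖(b:ℂ) ^ w - (a:ℂ) ^ w‖ ≤ ‖w‖ * b ^ (w.re - 1) * (b - a) := by
  have hw0 : w ≠ 0 := by rintro rfl; simp at hw; linarith
  have hd : ∀ x ∈ Icc a b, HasDerivWithinAt (fun t : ℝ => (t:ℂ) ^ w) (w * (x:ℂ) ^ (w - 1)) (Icc a b) x := by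
    intro x hx
    have hx0 : x ≠ 0 := (lt_of_lt_of_le ha hx.1).ne'
    exact (hasDerivAt_ofReal_cpow_const hx0 hw0).hasDerivWithinAt
  refine norm_image_sub_le_of_norm_deriv_le_segment' hd ?_ b (right_mem_Icc.2 hab)
  intro x hx
  have hx0 : 0 < x := lt_of_lt_of_le ha hx.1
  rw [norm_mul, norm_cpow_eq_rpow_re_of_pos hx0]
  have : (w - 1).re = w.re - 1 := by simp
  rw [this]
  gcongr
  exact hx.2.le

noncomputable def Mr (N : ℕ) : ℝ := ∑ n ∈ Finset.Icc 1 N, (ArithmeticFunction.moebius n : ℝ)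

lemma abs_moebius_real (n : ℕ) : |(ArithmeticFunction.moebius n : ℝ)| ≤ 1 := by
  have := ArithmeticFunction.abs_moebius_le_one (n := n)
  exact_mod_cast this

lemma M1_diff (N H : ℕ) : (H:ℝ) * |Mr N| ≤ |M1 (N + H) - M1 N| + (H:ℝ) ^ 2 := by
  have h1 : M1 (N + H) = ∑ n ∈ Finset.Icc 1 N, (ArithmeticFunction.moebius n : ℝ) * (((N:ℝ) - n) + H)
      + ∑ n ∈ Finset.Ioc N (N + H), (ArithmeticFunction.moebius n : ℝ) * (((N + H : ℕ):ℝ) - n) := by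
    unfold M1
    have : Finset.Icc 1 (N + H) = (Finset.Icc 1 N) ∪ (Finset.Ioc N (N + H)) := by
      ext x; simp; omega
    rw [this, Finset.sum_union]
    · congr 1
      refine Finset.sum_congr rfl fun n _ => ?_
      push_cast; ring
    · rw [Finset.disjoint_left]; intro x; simp; omega
  have h2 : M1 (N + H) - M1 N = H * Mr N +
      ∑ n ∈ Finset.Ioc N (N + H), (ArithmeticFunction.moebius n : ℝ) * (((N + H : ℕ):ℝ) - n) := by
    rw [h1]; unfold M1 Mr
    rw [Finset.mul_sum]
    simp only [mul_add, Finset.sum_add_distrib]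
    have : ∀ n : ℕ, (ArithmeticFunction.moebius n : ℝ) * (H:ℝ) = H * (ArithmeticFunction.moebius n : ℝ) :=
      fun n => mul_comm _ _
    simp only [this]; ring
  have h3 : |∑ n ∈ Finset.Ioc N (N + H), (ArithmeticFunction.moebius n : ℝ) * (((N + H : ℕ):ℝ) - n)| ≤ (H:ℝ)^2 := by
    refine (Finset.abs_sum_le_sum_abs _ _).trans ?_
    have : ∀ n ∈ Finset.Ioc N (N + H), |(ArithmeticFunction.moebius n : ℝ) * (((N + H : ℕ):ℝ) - n)| ≤ H := by
      intro n hn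
      rw [Finset.mem_Ioc] at hn
      have a1 : (N:ℝ) < n := by exact_mod_cast hn.1
      have a2 : (n:ℝ) ≤ ((N + H : ℕ):ℝ) := by exact_mod_cast hn.2
      rw [abs_mul]
      have : |((N + H : ℕ):ℝ) - n| ≤ H := by
        rw [abs_of_nonneg (by linarith)]; push_cast; linarith
      calc _ ≤ 1 * (H:ℝ) := mul_le_mul (abs_moebius_real n) this (abs_nonneg _) zero_le_one
        _ = _ := one_mul _
    refine (Finset.sum_le_card_nsmul _ _ _ this).trans ?_
    simp [sq]
  have h4 : (H:ℝ) * Mr N = (M1 (N + H) - M1 N) -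
      ∑ n ∈ Finset.Ioc N (N + H), (ArithmeticFunction.moebius n : ℝ) * (((N + H : ℕ):ℝ) - n) := by
    rw [h2]; ring
  have h5 : (H:ℝ) * |Mr N| = |(H:ℝ) * Mr N| := by rw [abs_mul]; simp
  rw [h5, h4]
  exact (abs_sub _ _).trans (add_le_add le_rfl h3)

lemma min_interp {a b c δ : ℝ} (hc : 0 ≤ c) (ha : c ≤ a) (hb : c ≤ b) (h0 : 0 ≤ δ) (h1 : δ ≤ 1) :
    c ≤ a ^ (1 - δ) * b ^ δ := by
  rcases hc.eq_or_lt with rfl | hc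
  · positivity
  calc c = c ^ (1 - δ) * c ^ δ := by rw [← Real.rpow_add hc]; simp
    _ ≤ _ := by
      have ha0 : 0 ≤ a := hc.le.trans ha
      have h2 : 0 ≤ 1 - δ := by linarith
      gcongr

lemma perron_cont (hRH : RiemannHypothesis) {σ : ℝ} (hσ : 1/2 < σ) (N : ℕ) (hN : 0 < N) :
    Continuous fun y : ℝ => (N:ℂ) ^ ((σ + y * I : ℂ) + 1) *
      (1 / ((σ + y * I : ℂ) * ((σ + y * I : ℂ) + 1))) * fi (σ + y * I : ℂ) := by
  have hNc : (N:ℂ) ≠ 0 := by exact_mod_cast hN.ne'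
  rw [continuous_iff_continuousAt]
  intro y
  set s : ℂ := σ + y * I with hs
  have hsre : s.re = σ := by simp [hs]
  have := fi_diff hRH (s := s) (by rw [hsre]; exact hσ)
  have hs0 : s ≠ 0 := by intro h; rw [h] at hsre; simp at hsre; linarith
  have hs1 : s + 1 ≠ 0 := by intro h; have := congrArg re h; simp [hsre] at this; linarith
  have h3 : DifferentiableAt ℂ (fun s : ℂ => (N:ℂ) ^ (s + 1)) s :=
    DifferentiableAt.const_cpow (by fun_prop) (Or.inl hNc)
  have h4 : s * (s + 1) ≠ 0 := mul_ne_zero hs0 hs1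
  have h5 : DifferentiableAt ℂ (fun s : ℂ => (N:ℂ) ^ (s + 1) * (1 / (s * (s + 1))) * fi s) s := by
    fun_prop (disch := assumption)
  exact ContinuousAt.comp (f := fun y : ℝ => (σ + y * I : ℂ)) (x := y) h5.continuousAt (by fun_prop)

lemma perron_integrable (hRH : RiemannHypothesis) {σ : ℝ} (hσ : 1/2 < σ) (hσ2 : σ ≤ 2) (N : ℕ) (hN : 0 < N) :
    Integrable fun y : ℝ => (N:ℂ) ^ ((σ + y * I : ℂ) + 1) *
      (1 / ((σ + y * I : ℂ) * ((σ + y * I : ℂ) + 1))) * fi (σ + y * I : ℂ) := by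
  set δ := min ((σ - 1/2) / 2) (1/16) with hδ
  have hδ0 : 0 < δ := lt_min (by linarith) (by norm_num)
  have hδ1 : δ < 1/8 := (min_le_right _ _).trans_lt (by norm_num)
  have hδ2 : 1/2 + 2 * δ ≤ σ := by have := min_le_left ((σ - 1/2) / 2) (1/16); linarith
  obtain ⟨K, hK, hb⟩ := fi_bound hRH hδ0 hδ1 (ε := 1/2) (by norm_num)
  have hN1 : (1:ℝ) ≤ N := by exact_mod_cast hN
  refine ((int_bd (η := 1/2) (by norm_num)).const_mul ((N:ℝ) ^ (3:ℝ) * 9 * K)).mono'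
    (perron_cont hRH hσ N hN).aestronglyMeasurable (Eventually.of_forall fun y => ?_)
  set s : ℂ := σ + y * I with hs
  have hsre : s.re = σ := by simp [hs]
  have hsim : s.im = y := by simp [hs]
  rw [norm_mul, norm_mul, ← hsim]
  have hp : 0 < 1 + |s.im| := by positivity
  calc _ ≤ (N:ℝ) ^ (3:ℝ) * (9 * (1 + |s.im|) ^ (-(1 + 1 : ℝ))) * (K * (1 + |s.im|) ^ (1/2 : ℝ)) := by
        gcongr
        · have := norm_cpow_eq_rpow_re_of_pos (by linarith : (0:ℝ) < N) (s + 1)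
          rw [ofReal_natCast] at this
          rw [this]
          exact Real.rpow_le_rpow_of_exponent_le hN1 (by simp; linarith)
        · exact ker_bound (by linarith)
        · exact hb s (by linarith) (by linarith)
    _ = (N:ℝ) ^ (3:ℝ) * 9 * K * ((1 + |s.im|) ^ (-(1 + 1 : ℝ)) * (1 + |s.im|) ^ (1/2 : ℝ)) := by ring
    _ = _ := by rw [← Real.rpow_add hp]; norm_num

lemma M1_diff_bound (hRH : RiemannHypothesis) {δ : ℝ} (hδ : 0 < δ) (hδ1 : δ < 1/8) :
    ∃ K : ℝ, 0 < K ∧ ∀ N H : ℕ, 1 ≤ N → 1 ≤ H →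
      |M1 (N + H) - M1 N| ≤ K * (H * ((N + H : ℕ):ℝ) ^ (1/2 + 3 * δ)) := by
  obtain ⟨K, hK, hb⟩ := fi_bound hRH hδ hδ1 (ε := δ/2) (by linarith)
  set J := ∫ y : ℝ, (1 + |y|) ^ (-(1 + δ/2)) with hJ
  have hJ0 : 0 ≤ J := integral_nonneg fun y => by positivity
  refine ⟨18 * K * J + 1, by positivity, fun N H hN hH => ?_⟩
  set σ : ℝ := 1/2 + 2 * δ with hσ
  have hσ1 : 1/2 < σ := by rw [hσ]; linarith
  have hσ2 : σ ≤ 2 := by rw [hσ]; linarith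
  set X : ℝ := ((N + H : ℕ):ℝ) with hX
  have hN1 : (1:ℝ) ≤ N := by exact_mod_cast hN
  have hH1 : (1:ℝ) ≤ H := by exact_mod_cast hH
  have hXe : X = N + H := by rw [hX]; push_cast; rfl
  have hX0 : 0 < X := by rw [hXe]; linarith
  have p1 := perron hRH hσ1 hσ2 N (by omega)
  have p2 := perron hRH hσ1 hσ2 (N + H) (by omega)
  have i1 := perron_integrable hRH hσ1 hσ2 N (by omega)
  have i2 := perron_integrable hRH hσ1 hσ2 (N + H) (by omega)
  have key : ‖(2 * Real.pi * (M1 (N + H) : ℂ)) - 2 * Real.pi * (M1 N : ℂ)‖ ≤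
      (18 * K * (H * X ^ (1/2 + 3 * δ))) * J := by
    rw [← p1, ← p2, ← integral_sub i2 i1, hJ, ← integral_const_mul]
    refine norm_integral_le_of_norm_le ((int_bd (by linarith)).const_mul _) (Eventually.of_forall fun y => ?_)
    set s : ℂ := σ + y * I with hs
    have hsre : s.re = σ := by simp [hs]
    have hsim : s.im = y := by simp [hs]
    have hs1re : (s + 1).re = σ + 1 := by simp [hs]
    rw [← sub_mul, ← sub_mul, norm_mul, norm_mul]
    have hp : 0 < 1 + |s.im| := by positivity
    have b1 : ‖((N + H : ℕ):ℂ) ^ (s + 1) - (N:ℂ) ^ (s + 1)‖ ≤ ‖s + 1‖ * X ^ σ * H := by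
      have := cpow_diff_bound (a := N) (b := X) (w := s + 1) (by linarith) (by linarith) (by rw [hs1re]; linarith)
      rw [hs1re] at this
      rw [hX, ofReal_natCast, ofReal_natCast] at this
      refine this.trans (le_of_eq ?_)
      rw [← hX, hXe]; ring_nf
    have b2 : ‖((N + H : ℕ):ℂ) ^ (s + 1) - (N:ℂ) ^ (s + 1)‖ ≤ 2 * X ^ (σ + 1) := by
      refine (norm_sub_le _ _).trans ?_
      have e1 := norm_cpow_eq_rpow_re_of_pos hX0 (s + 1)
      have e2 := norm_cpow_eq_rpow_re_of_pos (by linarith : (0:ℝ) < N) (s + 1)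
      rw [hX, ofReal_natCast] at e1
      rw [ofReal_natCast] at e2
      rw [e1, e2, hs1re, ← hX]
      have : (N:ℝ) ^ (σ + 1) ≤ X ^ (σ + 1) := by gcongr; linarith
      linarith
    have b3 := min_interp (norm_nonneg _) b1 b2 hδ.le (by linarith)
    have hsn : 1 + |s.im| ≤ 3 * ‖s‖ := one_add_le_norm (by rw [hsre]; linarith)
    have hsn1 : 1 + |s.im| ≤ 3 * ‖s + 1‖ := by
      have := one_add_le_norm (s := s + 1) (by rw [hs1re]; linarith)
      simpa using this
    have ns0 : 0 < ‖s‖ := by linarith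
    have ns1 : 0 < ‖s + 1‖ := by linarith
    have b4 : (‖s + 1‖ * X ^ σ * H) ^ (1 - δ) * (2 * X ^ (σ + 1)) ^ δ ≤
        ‖s + 1‖ ^ (1 - δ) * (2 * (H * X ^ (1/2 + 3 * δ))) := by
      rw [Real.mul_rpow (by positivity) (by positivity), Real.mul_rpow (by positivity) (by positivity),
        Real.mul_rpow (by positivity) (by positivity), ← Real.rpow_mul hX0.le, ← Real.rpow_mul hX0.le]
      have c1 : (H:ℝ) ^ (1 - δ) ≤ H := by
        conv_rhs => rw [← Real.rpow_one (H:ℝ)]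
        exact Real.rpow_le_rpow_of_exponent_le hH1 (by linarith)
      have c2 : (2:ℝ) ^ δ ≤ 2 := by
        conv_rhs => rw [← Real.rpow_one (2:ℝ)]
        exact Real.rpow_le_rpow_of_exponent_le (by norm_num) (by linarith)
      have c3 : X ^ (σ * (1 - δ)) * X ^ ((σ + 1) * δ) = X ^ (1/2 + 3 * δ) := by
        rw [← Real.rpow_add hX0]; congr 1; rw [hσ]; ring
      calc _ = ‖s + 1‖ ^ (1 - δ) * ((2:ℝ) ^ δ * ((H:ℝ) ^ (1 - δ) * (X ^ (σ * (1 - δ)) * X ^ ((σ + 1) * δ)))) := by ring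
        _ ≤ _ := by rw [c3]; gcongr
    have b5 : ‖s + 1‖ ^ (1 - δ) * ‖1 / (s * (s + 1))‖ ≤ 9 * (1 + |s.im|) ^ (-(1 + δ)) := by
      rw [norm_div, norm_mul, norm_one]
      have e1 : ‖s + 1‖ ^ (1 - δ) = ‖s + 1‖ * ‖s + 1‖ ^ (-δ) := by
        rw [sub_eq_add_neg, Real.rpow_add ns1, Real.rpow_one]
      have e2 : ‖s + 1‖ ^ (1 - δ) * (1 / (‖s‖ * ‖s + 1‖)) = ‖s‖⁻¹ * ‖s + 1‖ ^ (-δ) := by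
        rw [e1]; field_simp
      rw [e2]
      have e3 : ‖s‖⁻¹ ≤ 3 * (1 + |s.im|)⁻¹ := by
        rw [inv_le_comm₀ ns0 (by positivity), mul_inv, inv_inv]; linarith
      have e4 : ‖s + 1‖ ^ (-δ) ≤ 3 * (1 + |s.im|) ^ (-δ) := by
        have : ((1 + |s.im|) / 3) ^ δ ≤ ‖s + 1‖ ^ δ := by
          gcongr; linarith
        rw [Real.div_rpow hp.le (by norm_num)] at this
        have c2 : (3:ℝ) ^ δ ≤ 3 := by
          conv_rhs => rw [← Real.rpow_one (3:ℝ)]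
          exact Real.rpow_le_rpow_of_exponent_le (by norm_num) (by linarith)
        rw [Real.rpow_neg ns1.le, Real.rpow_neg hp.le]
        rw [inv_le_comm₀ (by positivity) (by positivity), mul_inv, inv_inv]
        refine le_trans ?_ this
        rw [div_eq_mul_inv, mul_comm]
        gcongr
      calc _ ≤ (3 * (1 + |s.im|)⁻¹) * (3 * (1 + |s.im|) ^ (-δ)) := by gcongr
        _ = 9 * ((1 + |s.im|) ^ (-1 : ℝ) * (1 + |s.im|) ^ (-δ)) := by rw [Real.rpow_neg_one]; ring
        _ = _ := by rw [← Real.rpow_add hp]; ring_nf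
    have b6 := hb s (by rw [hsre]) (by rw [hsre]; linarith)
    rw [← hsim]
    calc _ ≤ (‖s + 1‖ ^ (1 - δ) * (2 * (H * X ^ (1/2 + 3 * δ)))) * ‖1 / (s * (s + 1))‖ * (K * (1 + |s.im|) ^ (δ/2)) := by
          gcongr; exact b3.trans b4
      _ = (2 * (H * X ^ (1/2 + 3 * δ))) * (‖s + 1‖ ^ (1 - δ) * ‖1 / (s * (s + 1))‖) * (K * (1 + |s.im|) ^ (δ/2)) := by ring
      _ ≤ (2 * (H * X ^ (1/2 + 3 * δ))) * (9 * (1 + |s.im|) ^ (-(1 + δ))) * (K * (1 + |s.im|) ^ (δ/2)) := by gcongr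
      _ = 18 * K * (H * X ^ (1/2 + 3 * δ)) * ((1 + |s.im|) ^ (-(1 + δ)) * (1 + |s.im|) ^ (δ/2)) := by ring
      _ = _ := by rw [← Real.rpow_add hp]; ring_nf
  rw [← mul_sub, norm_mul, ← ofReal_sub, norm_real, Real.norm_eq_abs] at key
  have h2pi : (1:ℝ) ≤ ‖(2 * Real.pi : ℂ)‖ := by
    rw [norm_mul, norm_real, Real.norm_eq_abs, abs_of_pos Real.pi_pos]
    simp; linarith [Real.pi_gt_three]
  have : |M1 (N + H) - M1 N| ≤ ‖(2 * Real.pi : ℂ)‖ * |M1 (N + H) - M1 N| := by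
    nlinarith [abs_nonneg (M1 (N + H) - M1 N)]
  have hQ : 0 ≤ (H * X ^ (1/2 + 3 * δ)) := by positivity
  nlinarith

lemma Mr_bound (hRH : RiemannHypothesis) {ε : ℝ} (hε : 0 < ε) :
    ∃ K : ℝ, 0 < K ∧ ∀ N : ℕ, |Mr N| ≤ K * (N:ℝ) ^ (1/2 + ε) := by
  set δ := min (ε / 3) (1/16) with hδ
  have hδ0 : 0 < δ := lt_min (by linarith) (by norm_num)
  have hδ1 : δ < 1/8 := (min_le_right _ _).trans_lt (by norm_num)
  have hδ2 : 3 * δ ≤ ε := by have := min_le_left (ε/3) (1/16); linarith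
  obtain ⟨K, hK, hb⟩ := M1_diff_bound hRH hδ0 hδ1
  refine ⟨2 * K + 1, by positivity, fun N => ?_⟩
  rcases Nat.eq_zero_or_pos N with rfl | hN
  · simp [Mr]; positivity
  set H := Nat.sqrt N with hH
  have hH1 : 1 ≤ H := Nat.sqrt_pos.2 hN
  have hHN : H ≤ N := Nat.sqrt_le_self N
  have hN1 : (1:ℝ) ≤ N := by exact_mod_cast hN
  have hH1' : (1:ℝ) ≤ H := by exact_mod_cast hH1
  have hHs : (H:ℝ) ≤ (N:ℝ) ^ (1/2 + ε) := by
    have h1 : (H:ℝ) ≤ √N := Real.nat_sqrt_le_real_sqrt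
    rw [Real.sqrt_eq_rpow] at h1
    exact h1.trans (Real.rpow_le_rpow_of_exponent_le hN1 (by linarith))
  have h1 := M1_diff N H
  have h2 := hb N H hN hH1
  have h3 : ((N + H : ℕ):ℝ) ^ (1/2 + 3 * δ) ≤ 2 * (N:ℝ) ^ (1/2 + ε) := by
    have : ((N + H : ℕ):ℝ) ≤ 2 * N := by exact_mod_cast (by omega : N + H ≤ 2 * N)
    calc _ ≤ (2 * (N:ℝ)) ^ (1/2 + 3 * δ) := by gcongr
      _ = (2:ℝ) ^ (1/2 + 3 * δ) * (N:ℝ) ^ (1/2 + 3 * δ) := Real.mul_rpow (by norm_num) (by positivity)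
      _ ≤ 2 * (N:ℝ) ^ (1/2 + ε) := by
        have c2 : (2:ℝ) ^ (1/2 + 3 * δ) ≤ 2 := by
          conv_rhs => rw [← Real.rpow_one (2:ℝ)]
          exact Real.rpow_le_rpow_of_exponent_le (by norm_num) (by linarith)
        gcongr
  have h4 : (H:ℝ) * |Mr N| ≤ H * ((2 * K + 1) * (N:ℝ) ^ (1/2 + ε)) := by
    calc _ ≤ K * (H * (2 * (N:ℝ) ^ (1/2 + ε))) + (H:ℝ)^2 := by
          refine h1.trans (add_le_add (h2.trans ?_) le_rfl); gcongr
      _ ≤ K * (H * (2 * (N:ℝ) ^ (1/2 + ε))) + H * (N:ℝ) ^ (1/2 + ε) := by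
          rw [sq]; gcongr
      _ = _ := by ring
  exact le_of_mul_le_mul_left h4 (by linarith)
end

section

lemma sum_periodic {f : ℤ → ℝ} {q : ℕ} (hq : 0 < q) (hf : ∀ n : ℤ, f (n + q) = f n) {p : ℤ}
    (hp : IsCoprime p q) (c : ℤ) :
    ∑ j ∈ Finset.range q, f (p * j + c) = ∑ j ∈ Finset.range q, f j := by
  have hq' : (0:ℤ) < q := by exact_mod_cast hq
  have hper : ∀ (n : ℤ), f (n % q) = f n := by
    have h1 : ∀ (k : ℕ) (n : ℤ), f (n + q * k) = f n := by
      intro k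
      induction k with
      | zero => intro n; simp
      | succ k ih => intro n; rw [← ih n, ← hf (n + q * k)]; congr 1; push_cast; ring
    intro n
    have h2 := Int.emod_add_mul_ediv n q
    rcases le_total 0 (n / q) with h | h
    · obtain ⟨k, hk⟩ := Int.eq_ofNat_of_zero_le h
      rw [hk] at h2
      rw [← h1 k (n % q), h2]
    · obtain ⟨k, hk⟩ := Int.eq_ofNat_of_zero_le (neg_nonneg.2 h)
      have h3 : n + q * k = n % q := by rw [← hk]; linarith
      rw [← h1 k n, h3]
  set g : ℕ → ℕ := fun j => ((p * j + c) % q).toNat with hg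
  have hgc : ∀ j, ((g j : ℕ) : ℤ) = (p * j + c) % q := fun j =>
    Int.toNat_of_nonneg (Int.emod_nonneg _ hq'.ne')
  have hmaps : ∀ j ∈ Finset.range q, g j ∈ Finset.range q := by
    intro j _
    have := Int.emod_lt_of_pos (p * j + c) hq'
    rw [← hgc] at this
    simpa using this
  have hinj : Set.InjOn g (Finset.range q) := by
    intro i hi j hj hij
    have h1 : (p * i + c) % q = (p * j + c) % q := by rw [← hgc, ← hgc, hij]
    have h2 : (q:ℤ) ∣ p * ((i:ℤ) - j) := by
      have h3 := Int.dvd_of_emod_eq_zero (Int.emod_eq_emod_iff_emod_sub_eq_zero.1 h1)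
      have h4 : p * i + c - (p * j + c) = p * ((i:ℤ) - j) := by ring
      rwa [h4] at h3
    have h3 : (q:ℤ) ∣ (i:ℤ) - j := hp.symm.dvd_of_dvd_mul_left h2
    simp at hi hj
    have h4 : (i:ℤ) - j = 0 := Int.eq_zero_of_abs_lt_dvd h3 (by rw [abs_lt]; constructor <;> omega)
    omega
  have himg : (Finset.range q).image g = Finset.range q := by
    apply Finset.eq_of_subset_of_card_le
    · intro x hx
      obtain ⟨j, hj, rfl⟩ := Finset.mem_image.1 hx
      exact hmaps j hj
    · rw [Finset.card_image_of_injOn hinj]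
  conv_rhs => rw [← himg]
  rw [Finset.sum_image hinj]
  refine Finset.sum_congr rfl fun j _ => ?_
  rw [hgc, hper]

noncomputable def psi (t : ℝ) : ℝ := Int.fract t - 1/2

lemma psi_abs (t : ℝ) : |psi t| ≤ 1/2 := by
  unfold psi
  rw [abs_le]; constructor <;> linarith [Int.fract_nonneg t, Int.fract_lt_one t]

lemma block_aux {q : ℕ} (hq : 0 < q) (α : ℝ) {p : ℤ} (hp : IsCoprime p q) (c : ℤ) :
    |∑ j ∈ Finset.range q, psi (α + ((p * j + c : ℤ) : ℝ) / q)| ≤ 1/2 := by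
  have hq' : (0:ℝ) < q := by exact_mod_cast hq
  have hper : ∀ n : ℤ, psi (α + ((n + q : ℤ) : ℝ) / q) = psi (α + (n : ℝ) / q) := by
    intro n
    unfold psi
    have : α + ((n + q : ℤ) : ℝ) / q = α + (n : ℝ) / q + 1 := by push_cast; field_simp; ring
    rw [this, Int.fract_add_one]
  rw [sum_periodic (f := fun n => psi (α + (n : ℝ) / q)) hq hper hp c]
  rw [← sum_periodic (f := fun n => psi (α + (n : ℝ) / q)) hq hper (p := 1) isCoprime_one_left (-⌊q * α⌋)]
  have hv : ∀ j ∈ Finset.range q, psi (α + ((1 * (j:ℤ) + -⌊q * α⌋ : ℤ) : ℝ) / q)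
      = Int.fract (q * α) / q + (j:ℝ) / q - 1/2 := by
    intro j hj
    unfold psi
    have hj' : (j:ℝ) + 1 ≤ q := by exact_mod_cast Finset.mem_range.1 hj
    have e : α + ((1 * (j:ℤ) + -⌊q * α⌋ : ℤ) : ℝ) / q = Int.fract (q * α) / q + (j:ℝ) / q := by
      unfold Int.fract; push_cast; field_simp; ring
    rw [e, Int.fract_eq_self.2]
    have := Int.fract_nonneg (q * α)
    have := Int.fract_lt_one (q * α)
    constructor
    · positivity
    · rw [← add_div, div_lt_one hq']; linarith
  rw [Finset.sum_congr rfl hv]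
  have hs : ∑ j ∈ Finset.range q, (j:ℝ) = q * (q - 1) / 2 := by
    clear * -
    induction q with
    | zero => simp
    | succ k ih => rw [Finset.sum_range_succ, ih]; push_cast; ring
  have hs2 : ∑ j ∈ Finset.range q, (j:ℝ) / q = q * (q - 1) / 2 / q := by
    rw [← Finset.sum_div, hs]
  rw [Finset.sum_sub_distrib, Finset.sum_add_distrib, hs2]
  simp only [Finset.sum_const, Finset.card_range, nsmul_eq_mul]
  have e : (q:ℝ) * (Int.fract (q * α) / q) + q * (q - 1) / 2 / q - q * (1/2) = Int.fract (q * α) - 1/2 := by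
    field_simp; ring
  rw [e]
  exact psi_abs (q * α)

lemma psi_upper {t h : ℝ} {u : ℝ} (h1 : -u ≤ h) (h2 : h ≤ u) : psi (t + h) ≤ psi (t - u) + 2 * u := by
  unfold psi Int.fract
  have : (⌊t - u⌋ : ℝ) ≤ ⌊t + h⌋ := by exact_mod_cast Int.floor_le_floor (by linarith)
  linarith

lemma psi_lower {t h : ℝ} {u : ℝ} (h1 : -u ≤ h) (h2 : h ≤ u) : psi (t + u) - 2 * u ≤ psi (t + h) := by
  unfold psi Int.fract
  have : (⌊t + h⌋ : ℝ) ≤ ⌊t + u⌋ := by exact_mod_cast Int.floor_le_floor (by linarith)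
  linarith

lemma block {q : ℕ} (hq : 0 < q) (α x : ℝ) {p : ℤ} (hp : IsCoprime p q)
    (hx : |x - (p:ℝ) / q| ≤ 1 / (q:ℝ) ^ 2) :
    |∑ j ∈ Finset.range q, psi (α + j * x)| ≤ 3 := by
  have hq' : (0:ℝ) < q := by exact_mod_cast hq
  have hj : ∀ j ∈ Finset.range q, |(j:ℝ) * (x - (p:ℝ)/q)| ≤ 1 / q := by
    intro j hj
    have hj' : (j:ℝ) ≤ q := by exact_mod_cast (Finset.mem_range.1 hj).le
    rw [abs_mul, abs_of_nonneg (by positivity)]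
    calc _ ≤ (q:ℝ) * (1 / (q:ℝ) ^ 2) := by gcongr
      _ = _ := by field_simp
  have hu : ∑ j ∈ Finset.range q, psi (α + j * x) ≤
      ∑ j ∈ Finset.range q, (psi (α + ((p * j + (-1) : ℤ) : ℝ) / q) + 2 * (1 / q)) := by
    refine Finset.sum_le_sum fun j hj' => ?_
    have h := abs_le.1 (hj j hj')
    have := psi_upper (t := α + (p:ℝ) * j / q) h.1 h.2
    have e1 : α + (p:ℝ) * j / q + (j:ℝ) * (x - (p:ℝ)/q) = α + j * x := by ring
    have e2 : α + (p:ℝ) * j / q - 1 / q = α + ((p * j + (-1) : ℤ) : ℝ) / q := by push_cast; ring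
    rwa [e1, e2] at this
  have hl : ∑ j ∈ Finset.range q, (psi (α + ((p * j + 1 : ℤ) : ℝ) / q) - 2 * (1 / q)) ≤
      ∑ j ∈ Finset.range q, psi (α + j * x) := by
    refine Finset.sum_le_sum fun j hj' => ?_
    have h := abs_le.1 (hj j hj')
    have := psi_lower (t := α + (p:ℝ) * j / q) h.1 h.2
    have e1 : α + (p:ℝ) * j / q + (j:ℝ) * (x - (p:ℝ)/q) = α + j * x := by ring
    have e2 : α + (p:ℝ) * j / q + 1 / q = α + ((p * j + 1 : ℤ) : ℝ) / q := by push_cast; ring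
    rwa [e1, e2] at this
  rw [Finset.sum_add_distrib] at hu
  rw [Finset.sum_sub_distrib] at hl
  have a1 := abs_le.1 (block_aux hq α hp (-1))
  have a2 := abs_le.1 (block_aux hq α hp 1)
  have e : ∑ j ∈ Finset.range q, 2 * (1 / (q:ℝ)) = 2 := by
    simp only [Finset.sum_const, Finset.card_range, nsmul_eq_mul]; field_simp
  rw [e] at hu hl
  rw [abs_le]; constructor <;> linarith [a1.1, a1.2, a2.1, a2.2]

lemma sum_psi_trivial (N : ℕ) (f : ℕ → ℝ) : |∑ j ∈ Finset.range N, psi (f j)| ≤ N / 2 := by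
  refine (Finset.abs_sum_le_sum_abs _ _).trans ?_
  refine (Finset.sum_le_card_nsmul _ _ (1/2) fun j _ => psi_abs _).trans ?_
  simp; linarith

lemma blocks {q : ℕ} (hq : 0 < q) (x : ℝ) {p : ℤ} (hp : IsCoprime p q)
    (hx : |x - (p:ℝ) / q| ≤ 1 / (q:ℝ) ^ 2) (N : ℕ) : ∀ α : ℝ,
    |∑ j ∈ Finset.range N, psi (α + j * x)| ≤ 3 * (N:ℝ) / q + q := by
  have hq' : (0:ℝ) < q := by exact_mod_cast hq
  induction N using Nat.strong_induction_on with
  | _ N ih =>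
    intro α
    rcases lt_or_ge N q with h | h
    · refine (sum_psi_trivial N _).trans ?_
      have : (N:ℝ) ≤ q := by exact_mod_cast h.le
      have : 0 ≤ 3 * (N:ℝ) / q := by positivity
      linarith
    · obtain ⟨M, rfl⟩ := Nat.exists_eq_add_of_le h
      rw [Finset.sum_range_add]
      have h1 := block hq α x hp hx
      have h2 := ih M (by omega) (α + q * x)
      have e : ∑ j ∈ Finset.range M, psi (α + ((q + j : ℕ):ℝ) * x) =
          ∑ j ∈ Finset.range M, psi (α + q * x + j * x) := by
        refine Finset.sum_congr rfl fun j _ => ?_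
        congr 1; push_cast; ring
      rw [e]
      refine (abs_add_le _ _).trans ?_
      have : 3 * ((q + M : ℕ):ℝ) / q = 3 + 3 * (M:ℝ) / q := by push_cast; field_simp
      rw [this]; linarith

noncomputable def SN (N : ℕ) (x : ℝ) : ℝ := ∑ m ∈ Finset.Icc 1 N, psi (m * x)

lemma SN_eq (N : ℕ) (x : ℝ) : SN N x = ∑ j ∈ Finset.range N, psi (x + j * x) := by
  unfold SN
  have : Finset.Icc 1 N = Finset.Ico 1 (N + 1) := by ext; simp
  rw [this, Finset.sum_Ico_eq_sum_range]
  simp only [Nat.add_sub_cancel]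
  refine Finset.sum_congr rfl fun j _ => ?_
  congr 1; push_cast; ring

lemma SN_trivial (N : ℕ) (x : ℝ) : |SN N x| ≤ N := by
  rw [SN_eq]; refine (sum_psi_trivial N _).trans ?_
  have : (0:ℝ) ≤ N := by positivity
  linarith

lemma SN_le {q : ℕ} (hq : 0 < q) (x : ℝ) {p : ℤ} (hp : IsCoprime p q)
    (hx : |x - (p:ℝ) / q| ≤ 1 / (q:ℝ) ^ 2) (N : ℕ) : |SN N x| ≤ 3 * (N:ℝ) / q + q := by
  rw [SN_eq]; exact blocks hq x hp hx N x
end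

section

lemma count_sep {B : Finset ℝ} {Q l : ℝ} (hQ : 0 < Q) (hl : 0 ≤ l)
    (hsep : ∀ u ∈ B, ∀ v ∈ B, u ≠ v → 1 ≤ Q * |u - v|)
    (hd : ∀ u ∈ B, ∀ v ∈ B, |u - v| ≤ l) : (B.card : ℝ) ≤ Q * l + 1 := by
  rcases B.eq_empty_or_nonempty with rfl | hne
  · simp; positivity
  set m := B.min' hne with hm
  have hmB : m ∈ B := B.min'_mem hne
  have hle : ∀ u ∈ B, m ≤ u := fun u hu => B.min'_le u hu
  have hcard : B.card ≤ (Finset.range (⌊Q * l⌋₊ + 1)).card := by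
    refine Finset.card_le_card_of_injOn (fun u => ⌊Q * (u - m)⌋₊) ?_ ?_
    · intro u hu
      have h1 := hd u hu m hmB
      rw [abs_of_nonneg (by linarith [hle u hu])] at h1
      simp only [Finset.coe_range, Set.mem_Iio]
      exact Nat.lt_succ_of_le (Nat.floor_le_floor (by gcongr))
    · intro u hu v hv huv
      by_contra hne
      have h1 := hsep u hu v hv hne
      have a1 : 0 ≤ Q * (u - m) := mul_nonneg hQ.le (by linarith [hle u hu])
      have a2 : 0 ≤ Q * (v - m) := mul_nonneg hQ.le (by linarith [hle v hv])
      have b1 := Nat.floor_le a1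
      have b2 := Nat.floor_le a2
      have b3 := Nat.lt_floor_add_one (Q * (u - m))
      have b4 := Nat.lt_floor_add_one (Q * (v - m))
      simp only at huv
      rw [huv] at b1 b3
      have h2 : |Q * (u - v)| < 1 := by rw [abs_lt]; constructor <;> linarith
      rw [abs_mul, abs_of_pos hQ] at h2
      linarith
  rw [Finset.card_range] at hcard
  have h1 : (B.card : ℝ) ≤ (⌊Q * l⌋₊ : ℝ) + 1 := by exact_mod_cast hcard
  linarith [Nat.floor_le (by positivity : 0 ≤ Q * l)]

lemma sum_inv_sqrt (n : ℕ) : ∑ p ∈ Finset.Icc 1 n, 1 / √(p:ℝ) ≤ 2 * √(n:ℝ) := by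
  induction n with
  | zero => simp
  | succ k ih =>
    rw [Finset.sum_Icc_succ_top (by omega)]
    have h0 : 0 ≤ √(k:ℝ) := Real.sqrt_nonneg _
    have h1 : 0 < √((k+1 : ℕ):ℝ) := Real.sqrt_pos.2 (by positivity)
    have h2 : √((k+1 : ℕ):ℝ) ^ 2 = k + 1 := by rw [Real.sq_sqrt (by positivity)]; push_cast; rfl
    have h3 : √(k:ℝ) ^ 2 = k := Real.sq_sqrt (by positivity)
    have h4 : 1 / √((k+1 : ℕ):ℝ) ≤ 2 * √((k+1 : ℕ):ℝ) - 2 * √(k:ℝ) := by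
      rw [div_le_iff₀ h1]
      nlinarith [sq_nonneg (√((k+1 : ℕ):ℝ) - √(k:ℝ))]
    linarith

lemma SN_point {N : ℕ} (hN : 1 ≤ N) {x : ℝ} (hx0 : 0 < x) (hx : x ≤ 1/4) :
    (∃ q ∈ Finset.Icc 1 N.sqrt, ∃ p ∈ Finset.Icc 1 q,
      |x - (p:ℝ) / q| ≤ 1 / ((N.sqrt + 1) * q) ∧ |SN N x| ≤ 4 * N / q) ∨
    |SN N x| ≤ 3 * (N.sqrt + 1) + min (N:ℝ) (1 / x) := by
  set n := N.sqrt with hn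
  have hn1 : 1 ≤ n := Nat.sqrt_pos.2 hN
  have hn1' : (1:ℝ) ≤ n := by exact_mod_cast hn1
  have hnN : (n:ℝ) * n ≤ N := by exact_mod_cast Nat.sqrt_le N
  have hNn : (N:ℝ) ≤ (n + 1) * (n + 1) := by exact_mod_cast (Nat.lt_succ_sqrt N).le
  obtain ⟨r, hr, hrd⟩ := Real.exists_rat_abs_sub_le_and_den_le x (n := n) hn1
  have hd0 : 0 < r.den := r.den_pos
  have hd1 : (1:ℝ) ≤ r.den := by exact_mod_cast hd0
  have hdn : (r.den:ℝ) ≤ n := by exact_mod_cast hrd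
  have hrc : (r:ℝ) = (r.num:ℝ) / r.den := by exact_mod_cast (Rat.num_div_den r).symm
  rw [hrc] at hr
  have hrn : -1 < r.num := by
    by_contra h
    have h1 : (r.num:ℝ) ≤ -1 := by exact_mod_cast (by omega : r.num ≤ -1)
    have h2 := (abs_le.1 hr).2
    have h3 : 1 / ((n + 1) * (r.den:ℝ)) ≤ 1 / r.den := by
      apply one_div_le_one_div_of_le (by linarith); nlinarith
    have h4 : (r.num:ℝ) / r.den ≤ - (1 / r.den) := by
      rw [neg_div' , div_le_div_iff_of_pos_right (by linarith)]; linarith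
    linarith
  rcases (by omega : r.num = 0 ∨ 1 ≤ r.num) with h0 | h1
  · right
    rw [h0] at hr
    simp only [Int.cast_zero, zero_div, sub_zero] at hr
    rw [abs_of_pos hx0] at hr
    have hxn : x ≤ 1 / (n + 1) := hr.trans (by
      apply one_div_le_one_div_of_le (by linarith); nlinarith)
    set q := ⌊1 / x⌋₊ with hq
    have hqx : (q:ℝ) ≤ 1 / x := Nat.floor_le (by positivity)
    have hqx2 : 1 / x < q + 1 := Nat.lt_floor_add_one _
    have hqn : n + 1 ≤ q := by
      apply Nat.le_floor
      push_cast
      rwa [le_one_div (by linarith) hx0]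
    have hqn' : (n:ℝ) + 1 ≤ q := by exact_mod_cast hqn
    have hq0 : (0:ℝ) < q := by linarith
    have hS : |SN N x| ≤ 3 * (N:ℝ) / q + q := by
      refine SN_le (p := 1) (by omega) x isCoprime_one_left ?_ N
      have e1 : x ≤ 1 / q := by rwa [le_one_div hx0 hq0]
      have e2 : 1 / ((q:ℝ) + 1) ≤ x := by rw [one_div_le (by linarith) hx0]; exact hqx2.le
      rw [Int.cast_one, abs_sub_comm, abs_of_nonneg (by linarith)]
      have e3 : 1 / (q:ℝ) - 1 / ((q:ℝ) + 1) = 1 / (q * (q + 1)) := by field_simp; ring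
      have e4 : 1 / ((q:ℝ) * (q + 1)) ≤ 1 / (q:ℝ)^2 := by
        apply one_div_le_one_div_of_le (by positivity); nlinarith
      linarith
    have hb : 3 * (N:ℝ) / q ≤ 3 * (n + 1) := by
      rw [div_le_iff₀ hq0]; nlinarith
    have ht := SN_trivial N x
    rcases min_choice (N:ℝ) (1/x) with h | h <;> rw [h] <;> linarith
  · left
    refine ⟨r.den, Finset.mem_Icc.2 ⟨hd0, hrd⟩, r.num.toNat, ?_, ?_, ?_⟩
    · rw [Finset.mem_Icc]
      have h2 := (abs_le.1 hr).1
      have h3 : (r.num:ℝ) / r.den ≤ 1/4 + 1 / ((n + 1) * r.den) := by linarith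
      have h4 : 1 / ((n + 1) * (r.den:ℝ)) ≤ 1 / 2 / r.den := by
        rw [div_div]; apply one_div_le_one_div_of_le (by linarith); nlinarith
      have h5 : (r.num:ℝ) ≤ (1/4) * r.den + 1/2 := by
        have : (r.num:ℝ) / r.den ≤ 1/4 + 1/2/r.den := by linarith
        rw [div_le_iff₀ (by linarith)] at this
        have e : (1/4 + 1/2/(r.den:ℝ)) * r.den = (1/4) * r.den + 1/2 := by field_simp
        linarith
      have h6 : (r.num:ℝ) ≤ r.den := by linarith
      have h7 : r.num ≤ r.den := by exact_mod_cast h6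
      omega
    · have : ((r.num.toNat : ℕ) : ℝ) = (r.num : ℝ) := by
        exact_mod_cast congrArg (fun z : ℤ => (z:ℝ)) (Int.toNat_of_nonneg (by omega : 0 ≤ r.num))
      rw [this]; exact hr
    · have hS : |SN N x| ≤ 3 * (N:ℝ) / r.den + r.den := by
        refine SN_le hd0 x (p := r.num) ?_ ?_ N
        · rw [Int.isCoprime_iff_nat_coprime]; simpa using r.reduced
        · refine hr.trans ?_
          rw [sq]
          apply one_div_le_one_div_of_le (by positivity)
          gcongr; linarith
      refine hS.trans ?_
      have : (r.den:ℝ) ≤ N / r.den := by rw [le_div_iff₀ (by linarith)]; nlinarith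
      have e : 4 * (N:ℝ) / r.den = 3 * N / r.den + N / r.den := by ring
      linarith

lemma SN_point' {N : ℕ} (hN : 1 ≤ N) {ξ : ℝ} (h0 : 0 ≤ ξ) (h1 : ξ ≤ 1/2) :
    |SN N (ξ ^ 2)| ≤
      ∑ q ∈ Finset.Icc 1 N.sqrt, ∑ p ∈ Finset.Icc 1 q,
        (if |ξ ^ 2 - (p:ℝ) / q| ≤ 1 / ((N.sqrt + 1) * q) then 4 * (N:ℝ) / q else 0) +
      3 * (N.sqrt + 1) +
      ∑ j ∈ Finset.range (N.sqrt + 1), (if ⌊(N.sqrt:ℝ) * ξ⌋₊ = j then 2 * (N:ℝ) / (j + 1) else 0) := by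
  set n := N.sqrt with hn
  have hn1 : 1 ≤ n := Nat.sqrt_pos.2 hN
  have hn1' : (1:ℝ) ≤ n := by exact_mod_cast hn1
  have hnN : (n:ℝ) * n ≤ N := by exact_mod_cast Nat.sqrt_le N
  have hfl : ⌊(n:ℝ) * ξ⌋₊ ∈ Finset.range (n + 1) := by
    rw [Finset.mem_range, Nat.lt_succ_iff]
    apply Nat.floor_le_of_le; nlinarith
  rw [Finset.sum_ite_eq, if_pos hfl]
  have hA : 0 ≤ ∑ q ∈ Finset.Icc 1 n, ∑ p ∈ Finset.Icc 1 q,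
      (if |ξ ^ 2 - (p:ℝ) / q| ≤ 1 / ((n + 1) * q) then 4 * (N:ℝ) / q else 0) :=
    Finset.sum_nonneg fun q _ => Finset.sum_nonneg fun p _ => by split_ifs <;> positivity
  have hB : 0 ≤ 2 * (N:ℝ) / (⌊(n:ℝ) * ξ⌋₊ + 1) := by positivity
  rcases h0.eq_or_lt with rfl | hpos
  · have := SN_trivial N (0 ^ 2)
    simp at *
    linarith
  rcases SN_point hN (x := ξ ^ 2) (by positivity) (by nlinarith) with ⟨q, hq, p, hp, hc, hS⟩ | hS
  · have : 4 * (N:ℝ) / q ≤ ∑ q ∈ Finset.Icc 1 n, ∑ p ∈ Finset.Icc 1 q,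
      (if |ξ ^ 2 - (p:ℝ) / q| ≤ 1 / ((n + 1) * q) then 4 * (N:ℝ) / q else 0) := by
      refine le_trans ?_ (Finset.single_le_sum (f := fun q : ℕ => ∑ p ∈ Finset.Icc 1 q,
        (if |ξ ^ 2 - (p:ℝ) / q| ≤ 1 / ((n + 1) * q) then 4 * (N:ℝ) / q else 0))
        (fun q _ => Finset.sum_nonneg fun p _ => by split_ifs <;> positivity) hq)
      refine le_trans ?_ (Finset.single_le_sum (f := fun p : ℕ =>
        (if |ξ ^ 2 - (p:ℝ) / q| ≤ 1 / ((n + 1) * q) then 4 * (N:ℝ) / q else 0))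
        (fun p _ => by split_ifs <;> positivity) hp)
      rw [if_pos hc]
    linarith
  · have : min (N:ℝ) (1 / ξ ^ 2) ≤ 2 * (N:ℝ) / (⌊(n:ℝ) * ξ⌋₊ + 1) := by
      rcases Nat.eq_zero_or_pos ⌊(n:ℝ) * ξ⌋₊ with h | h
      · rw [h]; refine (min_le_left _ _).trans ?_; simp; linarith [(by positivity : (0:ℝ) ≤ N)]
      · refine (min_le_right _ _).trans ?_
        set j := ⌊(n:ℝ) * ξ⌋₊
        have hj : (j:ℝ) ≤ n * ξ := Nat.floor_le (by positivity)
        have hj1 : (1:ℝ) ≤ j := by exact_mod_cast h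
        rw [div_le_div_iff₀ (by positivity) (by positivity)]
        have e1 : (j:ℝ) * j ≤ (n * ξ) * (n * ξ) := by gcongr
        have e2 : (n:ℝ) * n * ξ ^ 2 ≤ N * ξ ^ 2 := by gcongr
        nlinarith
    linarith

lemma count_near {A : Finset ℝ} {Q : ℝ} (hQ : 0 < Q)
    (hsep : ∀ u ∈ A, ∀ v ∈ A, u ≠ v → 1 ≤ Q * |u - v|) (h0 : ∀ u ∈ A, 0 ≤ u)
    {n p q : ℕ} (hn : 1 ≤ n) (hp : 1 ≤ p) (hq : 1 ≤ q) :
    ((A.filter fun ξ : ℝ => |ξ ^ 2 - (p:ℝ) / q| ≤ 1 / (((n:ℝ) + 1) * q)).card : ℝ) ≤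
      Q * (2 / ((n + 1) * √(q:ℝ)) * (1 / √(p:ℝ))) + 1 := by
  have hn' : (1:ℝ) ≤ n := by exact_mod_cast hn
  have hp' : (1:ℝ) ≤ p := by exact_mod_cast hp
  have hq' : (1:ℝ) ≤ q := by exact_mod_cast hq
  have sp : 0 < √(p:ℝ) := Real.sqrt_pos.2 (by linarith)
  have sq' : 0 < √(q:ℝ) := Real.sqrt_pos.2 (by linarith)
  have sp2 : √(p:ℝ) ^ 2 = p := Real.sq_sqrt (by linarith)
  have sq2 : √(q:ℝ) ^ 2 = q := Real.sq_sqrt (by linarith)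
  refine count_sep hQ (by positivity)
    (fun u hu v hv => hsep u (Finset.mem_filter.1 hu).1 v (Finset.mem_filter.1 hv).1) ?_
  have hlow : ∀ u : ℝ, 0 ≤ u → |u ^ 2 - (p:ℝ) / q| ≤ 1 / ((n + 1) * q) → √(p:ℝ) / (2 * √(q:ℝ)) ≤ u := by
    intro u hu0 hu
    have h1 := (abs_le.1 hu).1
    have h2 : 1 / (((n:ℝ) + 1) * q) ≤ (p:ℝ) / q / 2 := by
      rw [div_div, div_le_div_iff₀ (by positivity) (by positivity)]
      have : (1:ℝ) * (q * 2) ≤ p * ((n + 1) * q) := by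
        have : (2:ℝ) ≤ p * (n + 1) := by nlinarith
        nlinarith
      linarith
    refine (pow_le_pow_iff_left₀ (by positivity) hu0 two_ne_zero).1 ?_
    rw [div_pow, mul_pow, sp2, sq2]
    have e : (p:ℝ) / (2 ^ 2 * q) = p / q / 4 := by field_simp; norm_num
    have : 0 ≤ (p:ℝ) / q := by positivity
    rw [e]; linarith
  intro u hu v hv
  rw [Finset.mem_filter] at hu hv
  have lu := hlow u (h0 u hu.1) hu.2
  have lv := hlow v (h0 v hv.1) hv.2
  have hdiff : |u ^ 2 - v ^ 2| ≤ 2 / ((n + 1) * q) := by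
    have := abs_sub_le (u ^ 2) ((p:ℝ) / q) (v ^ 2)
    rw [abs_sub_comm ((p:ℝ)/q)] at this
    have e : 2 / (((n:ℝ) + 1) * q) = 1 / ((n + 1) * q) + 1 / ((n + 1) * q) := by ring
    linarith [hu.2, hv.2]
  have hf : |u ^ 2 - v ^ 2| = |u - v| * (u + v) := by
    have : u ^ 2 - v ^ 2 = (u - v) * (u + v) := by ring
    rw [this, abs_mul, abs_of_nonneg (add_nonneg (h0 u hu.1) (h0 v hv.1))]
  have hsum : √(p:ℝ) / √(q:ℝ) ≤ u + v := by
    have : √(p:ℝ) / √(q:ℝ) = √(p:ℝ) / (2 * √(q:ℝ)) + √(p:ℝ) / (2 * √(q:ℝ)) := by field_simp; norm_num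
    linarith
  have h3 : |u - v| * (√(p:ℝ) / √(q:ℝ)) ≤ 2 / ((n + 1) * q) := by
    calc _ ≤ |u - v| * (u + v) := by gcongr
      _ ≤ _ := by rw [← hf]; exact hdiff
  rw [← le_div_iff₀ (by positivity)] at h3
  refine h3.trans (le_of_eq ?_)
  rw [← sq2]
  field_simp
  rw [Real.sqrt_sq sq'.le]

lemma avg_bound {A : Finset ℝ} {Q : ℝ} (hQ : 1 ≤ Q)
    (hsep : ∀ u ∈ A, ∀ v ∈ A, u ≠ v → 1 ≤ Q * |u - v|) (h0 : ∀ u ∈ A, 0 ≤ u)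
    (h1 : ∀ u ∈ A, u ≤ 1/2) {N : ℕ} (hN : 1 ≤ N) (hNQ : (N:ℝ) ≤ Q) :
    ∑ ξ ∈ A, |SN N (ξ ^ 2)| ≤ 60 * (N.sqrt * Q * ∑ j ∈ Finset.range (N + 1), 1 / ((j:ℝ) + 1)) := by
  have hQ0 : 0 < Q := by linarith
  refine (Finset.sum_le_sum fun ξ hξ => SN_point' hN (h0 ξ hξ) (h1 ξ hξ)).trans ?_
  rw [Finset.sum_add_distrib, Finset.sum_add_distrib]
  set n := N.sqrt with hn
  set L := ∑ j ∈ Finset.range (N + 1), 1 / ((j:ℝ) + 1) with hL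
  have hn1 : 1 ≤ n := Nat.sqrt_pos.2 hN
  have hn1' : (1:ℝ) ≤ n := by exact_mod_cast hn1
  have hnN : (n:ℝ) * n ≤ N := by exact_mod_cast Nat.sqrt_le N
  have hnN' : n ≤ N := Nat.sqrt_le_self N
  have hNn : (N:ℝ) ≤ (n + 1) * (n + 1) := by exact_mod_cast (Nat.lt_succ_sqrt N).le
  have hL1 : 1 ≤ L := by
    have := Finset.single_le_sum (f := fun j : ℕ => 1 / ((j:ℝ) + 1)) (fun j _ => by positivity)
      (Finset.mem_range.2 (by omega : 0 < N + 1))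
    simpa [hL] using this
  have hLn : ∑ j ∈ Finset.range (n + 1), 1 / ((j:ℝ) + 1) ≤ L := by
    apply Finset.sum_le_sum_of_subset_of_nonneg
    · intro j; simp; omega
    · intro j _ _; positivity
  have hLq : ∑ q ∈ Finset.Icc 1 n, 1 / (q:ℝ) ≤ L := by
    have e : Finset.Icc 1 n = Finset.Ico 1 (n + 1) := by ext; simp
    rw [e, Finset.sum_Ico_eq_sum_range]
    simp only [Nat.add_sub_cancel]
    have : ∑ j ∈ Finset.range n, 1 / (((1 + j : ℕ)):ℝ) = ∑ j ∈ Finset.range n, 1 / ((j:ℝ) + 1) :=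
      Finset.sum_congr rfl fun j _ => by push_cast; rw [add_comm]
    rw [this]
    apply Finset.sum_le_sum_of_subset_of_nonneg
    · intro j; simp; omega
    · intro j _ _; positivity
  -- first part
  have P1 : ∑ ξ ∈ A, ∑ q ∈ Finset.Icc 1 n, ∑ p ∈ Finset.Icc 1 q,
        (if |ξ ^ 2 - (p:ℝ) / q| ≤ 1 / ((n + 1) * q) then 4 * (N:ℝ) / q else 0) ≤
      16 * (N * Q / (n + 1)) * L + 4 * N * n := by
    rw [Finset.sum_comm]
    have hq : ∀ q ∈ Finset.Icc 1 n, ∑ ξ ∈ A, ∑ p ∈ Finset.Icc 1 q,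
        (if |ξ ^ 2 - (p:ℝ) / q| ≤ 1 / ((n + 1) * q) then 4 * (N:ℝ) / q else 0) ≤
        16 * (N * Q / (n + 1)) * (1 / q) + 4 * N := by
      intro q hq
      have hq1 := (Finset.mem_Icc.1 hq).1
      have hq' : (1:ℝ) ≤ q := by exact_mod_cast hq1
      have sq' : 0 < √(q:ℝ) := Real.sqrt_pos.2 (by linarith)
      rw [Finset.sum_comm]
      have hp : ∀ p ∈ Finset.Icc 1 q, ∑ ξ ∈ A,
          (if |ξ ^ 2 - (p:ℝ) / q| ≤ 1 / ((n + 1) * q) then 4 * (N:ℝ) / q else 0) ≤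
          (Q * (2 / ((n + 1) * √(q:ℝ)) * (1 / √(p:ℝ))) + 1) * (4 * (N:ℝ) / q) := by
        intro p hp
        rw [← Finset.sum_filter, Finset.sum_const, nsmul_eq_mul]
        gcongr
        exact count_near hQ0 hsep h0 hn1 (Finset.mem_Icc.1 hp).1 hq1
      refine (Finset.sum_le_sum hp).trans ?_
      rw [← Finset.sum_mul, Finset.sum_add_distrib, ← Finset.mul_sum, ← Finset.mul_sum]
      simp only [Finset.sum_const, Nat.card_Icc, Nat.add_sub_cancel, nsmul_eq_mul, mul_one]
      calc _ ≤ (Q * (2 / ((n + 1) * √(q:ℝ)) * (2 * √(q:ℝ))) + q) * (4 * (N:ℝ) / q) := by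
            gcongr; exact sum_inv_sqrt q
        _ = _ := by field_simp; ring
    refine (Finset.sum_le_sum hq).trans ?_
    rw [Finset.sum_add_distrib, ← Finset.mul_sum]
    simp only [Finset.sum_const, Nat.card_Icc, Nat.add_sub_cancel, nsmul_eq_mul]
    have : 16 * ((N:ℝ) * Q / (n + 1)) * ∑ i ∈ Finset.Icc 1 n, 1 / (i:ℝ) ≤ 16 * ((N:ℝ) * Q / (n + 1)) * L := by
      gcongr
    linarith
  have hcard : (A.card : ℝ) ≤ Q * (1/2) + 1 := by
    refine count_sep hQ0 (by norm_num) hsep fun u hu v hv => ?_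
    rw [abs_le]; constructor <;> linarith [h0 u hu, h0 v hv, h1 u hu, h1 v hv]
  have P2 : ∑ ξ ∈ A, (3 * ((n:ℝ) + 1)) ≤ (Q * (1/2) + 1) * (3 * (n + 1)) := by
    rw [Finset.sum_const, nsmul_eq_mul]; gcongr
  have P3 : ∑ ξ ∈ A, ∑ j ∈ Finset.range (n + 1), (if ⌊(n:ℝ) * ξ⌋₊ = j then 2 * (N:ℝ) / (j + 1) else 0)
      ≤ (Q * (1 / n) + 1) * (2 * N) * L := by
    rw [Finset.sum_comm]
    have hj : ∀ j ∈ Finset.range (n + 1), ∑ ξ ∈ A, (if ⌊(n:ℝ) * ξ⌋₊ = j then 2 * (N:ℝ) / (j + 1) else 0)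
        ≤ (Q * (1 / n) + 1) * (2 * N) * (1 / (j + 1)) := by
      intro j _
      rw [← Finset.sum_filter, Finset.sum_const, nsmul_eq_mul]
      have : ((A.filter fun ξ => ⌊(n:ℝ) * ξ⌋₊ = j).card : ℝ) ≤ Q * (1 / n) + 1 := by
        refine count_sep hQ0 (by positivity)
          (fun u hu v hv => hsep u (Finset.mem_filter.1 hu).1 v (Finset.mem_filter.1 hv).1) ?_
        intro u hu v hv
        rw [Finset.mem_filter] at hu hv
        have a1 := Nat.floor_le (mul_nonneg (by linarith : (0:ℝ) ≤ n) (h0 u hu.1))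
        have a2 := Nat.floor_le (mul_nonneg (by linarith : (0:ℝ) ≤ n) (h0 v hv.1))
        have a3 := Nat.lt_floor_add_one ((n:ℝ) * u)
        have a4 := Nat.lt_floor_add_one ((n:ℝ) * v)
        rw [hu.2] at a1 a3
        rw [hv.2] at a2 a4
        rw [le_div_iff₀ (by linarith), ← abs_of_pos (by linarith : (0:ℝ) < n), ← abs_mul, abs_le]
        constructor <;> linarith
      calc _ ≤ (Q * (1 / n) + 1) * (2 * (N:ℝ) / (j + 1)) := by gcongr
        _ = _ := by ring
    refine (Finset.sum_le_sum hj).trans ?_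
    rw [← Finset.mul_sum]
    gcongr
  have E1 : (N:ℝ) * Q / (n + 1) ≤ 2 * n * Q := by
    rw [div_le_iff₀ (by linarith)]
    nlinarith [mul_nonneg (by linarith : (0:ℝ) ≤ n - 1) hQ0.le, mul_le_mul_of_nonneg_right hNn hQ0.le,
      mul_nonneg (mul_nonneg (by linarith : (0:ℝ) ≤ n - 1) (by linarith : (0:ℝ) ≤ n + 1)) hQ0.le]
  have E2 : (N:ℝ) * n ≤ n * Q := by nlinarith
  have E3 : Q * (1 / n) * (2 * N) ≤ 8 * (n * Q) := by
    have : Q * (1 / n) * (2 * N) = 2 * N * Q / n := by ring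
    rw [this, div_le_iff₀ (by linarith)]
    have : (N:ℝ) ≤ 4 * (n * n) := by nlinarith
    nlinarith
  have E4 : (N:ℝ) ≤ n * Q := by nlinarith
  have hnQ : 1 ≤ n * Q := by nlinarith
  have hnQL : (n:ℝ) * Q ≤ n * Q * L := by nlinarith
  have E5 : (Q * (1/2) + 1) * (3 * ((n:ℝ) + 1)) ≤ 12 * (n * Q) := by nlinarith
  have F1 : 16 * ((N:ℝ) * Q / (n + 1)) * L ≤ 32 * (n * Q * L) := by
    calc _ ≤ 16 * (2 * n * Q) * L := by gcongr
      _ = _ := by ring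
  have F3 : (Q * (1 / n) + 1) * (2 * (N:ℝ)) * L ≤ 10 * (n * Q * L) := by
    have : (Q * (1 / n) + 1) * (2 * (N:ℝ)) ≤ 10 * (n * Q) := by linarith
    calc _ ≤ 10 * (n * Q) * L := by gcongr
      _ = _ := by ring
  linarith
end

section

lemma coprime_count (K b : ℕ) (hb : 0 < b) :
    (((Finset.Ioc 0 K).filter fun a => Nat.Coprime a b).card : ℝ) =
      ∑ d ∈ b.divisors, ((K / d : ℕ) : ℝ) * (ArithmeticFunction.moebius d : ℝ) := by
  have h1 : ∀ a : ℕ, (if Nat.Coprime a b then (1:ℝ) else 0) =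
      ∑ d ∈ b.divisors, if d ∣ a then (ArithmeticFunction.moebius d : ℝ) else 0 := by
    intro a
    rw [← Finset.sum_filter]
    have hd : b.divisors.filter (fun d => d ∣ a) = (Nat.gcd a b).divisors := by
      ext d
      have : Nat.gcd a b ≠ 0 := (Nat.gcd_pos_of_pos_right a hb).ne'
      simp only [Finset.mem_filter, Nat.mem_divisors, Nat.dvd_gcd_iff]
      constructor
      · rintro ⟨⟨h1, h2⟩, h3⟩; exact ⟨⟨h3, h1⟩, this⟩
      · rintro ⟨⟨h1, h2⟩, h3⟩; exact ⟨⟨h2, hb.ne'⟩, h1⟩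
    rw [hd]
    have h2 := congrArg (fun f : ArithmeticFunction ℤ => f (Nat.gcd a b)) ArithmeticFunction.coe_zeta_mul_moebius
    simp only [ArithmeticFunction.coe_zeta_mul_apply, ArithmeticFunction.one_apply] at h2
    have h3 := congrArg (fun z : ℤ => (z:ℝ)) h2
    push_cast at h3
    rw [h3]
  rw [Finset.card_filter]
  push_cast
  rw [Finset.sum_congr rfl fun a _ => h1 a, Finset.sum_comm]
  refine Finset.sum_congr rfl fun d _ => ?_
  rw [← Finset.sum_filter, Finset.sum_const, Nat.Ioc_filter_dvd_card_eq_div, nsmul_eq_mul]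

noncomputable def gfl (x : ℝ) : ArithmeticFunction ℝ := ⟨fun m => (⌊x * m⌋₊ : ℝ), by simp⟩

lemma coprime_count_conv {x : ℝ} (b : ℕ) (hb : 0 < b) :
    (((Finset.Ioc 0 ⌊x * b⌋₊).filter fun a => Nat.Coprime a b).card : ℝ) =
      (gfl x * (ArithmeticFunction.moebius : ArithmeticFunction ℝ)) b := by
  rw [coprime_count _ b hb, ArithmeticFunction.mul_apply,
    Nat.sum_divisorsAntidiagonal' (fun i j => gfl x i * (ArithmeticFunction.moebius : ArithmeticFunction ℝ) j)]
  refine Finset.sum_congr rfl fun d hd => ?_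
  have hdb := (Nat.mem_divisors.1 hd).1
  have hd0 : (d:ℝ) ≠ 0 := by
    have := Nat.pos_of_dvd_of_pos hdb hb
    exact_mod_cast this.ne'
  have : ⌊x * ((b / d : ℕ) : ℝ)⌋₊ = ⌊x * b⌋₊ / d := by
    rw [← Nat.floor_div_natCast, Nat.cast_div hdb hd0, mul_div_assoc]
  simp [gfl, this]

lemma sum_conv (g : ArithmeticFunction ℝ) (T : ℕ) :
    ∑ b ∈ Finset.Ioc 0 T, (g * (ArithmeticFunction.moebius : ArithmeticFunction ℝ)) b =
      ∑ m ∈ Finset.Icc 1 T, Mr (T / m) * g m := by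
  rw [ArithmeticFunction.sum_Ioc_mul_eq_sum_sum]
  refine Finset.sum_congr rfl fun m _ => ?_
  unfold Mr
  rw [mul_comm]
  rfl

lemma sum_Mr (T : ℕ) (hT : 1 ≤ T) : ∑ m ∈ Finset.Icc 1 T, Mr (T / m) = 1 := by
  have h := sum_conv (ArithmeticFunction.zeta : ArithmeticFunction ℝ) T
  rw [ArithmeticFunction.coe_zeta_mul_coe_moebius] at h
  have h1 : ∑ m ∈ Finset.Icc 1 T, Mr (T / m) * (ArithmeticFunction.zeta : ArithmeticFunction ℝ) m =
      ∑ m ∈ Finset.Icc 1 T, Mr (T / m) := by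
    refine Finset.sum_congr rfl fun m hm => ?_
    have : m ≠ 0 := by have := (Finset.mem_Icc.1 hm).1; omega
    simp [ArithmeticFunction.natCoe_apply, ArithmeticFunction.zeta_apply, this]
  rw [← h1, ← h]
  simp only [ArithmeticFunction.one_apply]
  rw [Finset.sum_ite_eq', if_pos]
  simp; omega

lemma coprime_sub_aux {a b : ℕ} (h : a ≤ b) (hc : Nat.Coprime a b) : Nat.Coprime (b - a) b := by
  obtain ⟨c, rfl⟩ := Nat.exists_eq_add_of_le h
  simp only [Nat.add_sub_cancel_left]
  rw [Nat.coprime_self_add_right] at hc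
  rw [Nat.coprime_add_self_right]
  exact hc.symm

lemma farey_card (T : ℕ) {x : ℚ} (hx1 : x ≤ 1) :
    (((farey T).filter (fun ξ => 1 - x ≤ ξ ∧ ξ ≤ 1)).card : ℝ) =
      ∑ m ∈ Finset.Icc 1 T, Mr (T / m) * (⌊(x:ℝ) * m⌋₊ : ℝ) := by
  set P := ((Finset.Ioc 0 T).sigma fun b => (Finset.Ioc 0 ⌊(x:ℝ) * b⌋₊).filter fun a => Nat.Coprime a b) with hP
  have himg : (farey T).filter (fun ξ => 1 - x ≤ ξ ∧ ξ ≤ 1) =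
      P.image (fun p => 1 - (p.2 : ℚ) / (p.1 : ℚ)) := by
    ext ξ
    simp only [hP, farey, Finset.mem_filter, Finset.mem_image, Finset.mem_product, Finset.mem_range,
      Finset.mem_sigma, Finset.mem_Ioc]
    constructor
    · rintro ⟨⟨⟨a, b⟩, ⟨⟨h1, h2⟩, h3, h4⟩, rfl⟩, h5, h6⟩
      simp only at h1 h2 h3 h4 h5 h6 ⊢
      have hb : (0:ℚ) < b := by exact_mod_cast (by omega : 0 < b)
      refine ⟨⟨b, b - a⟩, ⟨⟨by dsimp only; omega, by dsimp only; omega⟩, ⟨by dsimp only; omega, ?_⟩, ?_⟩, ?_⟩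
      · apply Nat.le_floor
        rw [Nat.cast_sub h3.le]
        have : (b:ℚ) - a ≤ x * b := by
          rw [le_div_iff₀ hb] at h5; linarith
        exact_mod_cast this
      · simp only
        exact coprime_sub_aux h3.le h4
      · simp only
        rw [Nat.cast_sub h3.le]; field_simp; ring
    · rintro ⟨⟨b, a⟩, ⟨⟨h1, h2⟩, ⟨h3, h4⟩, h5⟩, rfl⟩
      simp only at h1 h2 h3 h4 h5 ⊢
      have hb : (0:ℚ) < b := by exact_mod_cast h1
      have h6 : (a:ℝ) ≤ (x:ℝ) * b := (Nat.le_floor_iff' (by omega)).1 h4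
      have h7 : (a:ℚ) ≤ x * b := by exact_mod_cast h6
      have h8 : (a:ℚ) ≤ b := by nlinarith
      have h9 : a ≤ b := by exact_mod_cast h8
      refine ⟨⟨⟨b - a, b⟩, ⟨⟨by omega, by omega⟩, by simp only; omega, ?_⟩, ?_⟩, ?_, ?_⟩
      · simp only
        exact coprime_sub_aux h9 h5
      · simp only
        rw [Nat.cast_sub h9]; field_simp
      · have : (a:ℚ) / b ≤ x := by rwa [div_le_iff₀ hb]
        linarith
      · have : 0 ≤ (a:ℚ) / b := by positivity
        linarith
  rw [himg, Finset.card_image_of_injOn]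
  · rw [hP, Finset.card_sigma]
    push_cast
    have : ∀ b ∈ Finset.Ioc 0 T, (((Finset.Ioc 0 ⌊(x:ℝ) * b⌋₊).filter fun a => Nat.Coprime a b).card : ℝ) =
      (gfl x * (ArithmeticFunction.moebius : ArithmeticFunction ℝ)) b := fun b hb =>
        coprime_count_conv b (Finset.mem_Ioc.1 hb).1
    rw [Finset.sum_congr rfl this, sum_conv]
    rfl
  · rintro ⟨b, a⟩ h ⟨b', a'⟩ h' heq
    simp only [hP, Finset.coe_sigma, Set.mem_sigma_iff, Finset.mem_coe, Finset.mem_Ioc, Finset.mem_filter] at h h'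
    simp only [sub_right_inj] at heq
    have := Rat.div_int_inj (a := a) (b := b) (c := a') (d := b') (by exact_mod_cast h.1.1) (by exact_mod_cast h'.1.1)
      (by simpa using h.2.2) (by simpa using h'.2.2) (by simpa using heq)
    obtain ⟨e1, e2⟩ := this
    have e1' : a = a' := by exact_mod_cast e1
    have e2' : b = b' := by exact_mod_cast e2
    subst e1'; subst e2'; rfl
end


lemma farey_mem {T : ℕ} {ξ : ℚ} (h : ξ ∈ farey T) : 0 ≤ ξ ∧ ξ < 1 ∧
    ∃ a b : ℕ, 0 < b ∧ b ≤ T ∧ ξ = (a:ℚ) / b := by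
  simp only [farey, Finset.mem_image, Finset.mem_filter, Finset.mem_product, Finset.mem_range] at h
  obtain ⟨⟨a, b⟩, ⟨⟨h1, h2⟩, h3, h4⟩, rfl⟩ := h
  simp only at h1 h2 h3 h4 ⊢
  have hb : (0:ℚ) < b := by exact_mod_cast (by omega : 0 < b)
  refine ⟨by positivity, ?_, a, b, by omega, by omega, rfl⟩
  rw [div_lt_one hb]; exact_mod_cast h3

lemma farey_sep {T : ℕ} {u v : ℚ} (hu : u ∈ farey T) (hv : v ∈ farey T) (hne : u ≠ v) :
    1 ≤ (T:ℚ) ^ 2 * |u - v| := by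
  obtain ⟨-, -, a, b, hb, hbT, rfl⟩ := farey_mem hu
  obtain ⟨-, -, c, d, hd, hdT, rfl⟩ := farey_mem hv
  have hb' : (0:ℚ) < b := by exact_mod_cast hb
  have hd' : (0:ℚ) < d := by exact_mod_cast hd
  have hbT' : (b:ℚ) ≤ T := by exact_mod_cast hbT
  have hdT' : (d:ℚ) ≤ T := by exact_mod_cast hdT
  have e : (a:ℚ) / b - c / d = ((a * d - b * c : ℤ) : ℚ) / (b * d) := by
    push_cast; field_simp
  have hz : (a * d - b * c : ℤ) ≠ 0 := by
    intro h; rw [h] at e; simp at e; exact hne (sub_eq_zero.1 e)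
  have hz1 : (1:ℚ) ≤ |((a * d - b * c : ℤ) : ℚ)| := by
    have := Int.one_le_abs hz
    exact_mod_cast this
  rw [e, abs_div, abs_of_pos (by positivity : (0:ℚ) < b * d), ← mul_div_assoc,
    le_div_iff₀ (by positivity)]
  have : (b:ℚ) * d ≤ T ^ 2 := by rw [sq]; gcongr
  nlinarith [sq_nonneg (T:ℚ)]

lemma disc_eq (T : ℕ) (hT : 1 ≤ T) {x : ℚ} (hx0 : 0 ≤ x) (hx1 : x ≤ 1) :
    (((farey T).filter (fun ξ => 1 - x ≤ ξ ∧ ξ ≤ 1)).card : ℝ) - (F T : ℝ) * x =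
      -(∑ m ∈ Finset.Icc 1 T, Mr (T / m) * psi (m * x)) - 1/2 := by
  have hF : (F T : ℝ) = ∑ m ∈ Finset.Icc 1 T, Mr (T / m) * (m:ℝ) := by
    have h1 := farey_card T (x := 1) le_rfl
    have h2 : (farey T).filter (fun ξ => 1 - (1:ℚ) ≤ ξ ∧ ξ ≤ 1) = farey T := by
      apply Finset.filter_true_of_mem
      intro ξ hξ
      have := farey_mem hξ
      exact ⟨by linarith [this.1], this.2.1.le⟩
    rw [h2] at h1
    unfold F
    rw [h1]
    simp
  rw [farey_card T hx1, hF, Finset.sum_mul, ← Finset.sum_sub_distrib]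
  have h12 : (1:ℝ)/2 = ∑ m ∈ Finset.Icc 1 T, Mr (T / m) * (1/2) := by
    rw [← Finset.sum_mul, sum_Mr T hT]; norm_num
  rw [h12, ← Finset.sum_neg_distrib, ← Finset.sum_sub_distrib]
  refine Finset.sum_congr rfl fun m _ => ?_
  have hx0' : (0:ℝ) ≤ x := by exact_mod_cast hx0
  have : ((⌊(x:ℝ) * m⌋₊ : ℕ) : ℝ) = (⌊(x:ℝ) * m⌋ : ℝ) :=
    natCast_floor_eq_intCast_floor (by positivity)
  rw [this]
  unfold psi Int.fract
  rw [mul_comm (m:ℝ) (x:ℝ)]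
  ring

lemma hyperbola (T : ℕ) (x : ℝ) :
    |∑ m ∈ Finset.Icc 1 T, Mr (T / m) * psi (m * x)| ≤
      ∑ m ∈ Finset.Icc 1 T.sqrt, |Mr (T / m)| +
      ∑ k ∈ Finset.Icc 1 T.sqrt, (|SN (T / k) x| + |SN T.sqrt x|) := by
  set Y := T.sqrt with hY
  have hYT : Y ≤ T := Nat.sqrt_le_self T
  have hY1 : Y * Y ≤ T := Nat.sqrt_le T
  have hY2 : T < (Y + 1) * (Y + 1) := Nat.lt_succ_sqrt T
  have hsp : Finset.Icc 1 T = Finset.Icc 1 Y ∪ Finset.Ioc Y T := by ext m; simp; omega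
  rw [hsp, Finset.sum_union (by rw [Finset.disjoint_left]; intro m; simp; omega)]
  refine (abs_add_le _ _).trans (add_le_add ?_ ?_)
  · refine (Finset.abs_sum_le_sum_abs _ _).trans (Finset.sum_le_sum fun m _ => ?_)
    rw [abs_mul]
    have := psi_abs (m * x)
    nlinarith [abs_nonneg (Mr (T / m))]
  · have h1 : ∑ m ∈ Finset.Ioc Y T, Mr (T / m) * psi (m * x) =
        ∑ k ∈ Finset.Icc 1 Y, (ArithmeticFunction.moebius k : ℝ) * (SN (T / k) x - SN Y x) := by
      unfold Mr
      simp only [Finset.sum_mul]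
      rw [Finset.sum_comm' (t' := Finset.Icc 1 Y) (s' := fun k => Finset.Ioc Y (T / k))]
      · refine Finset.sum_congr rfl fun k hk => ?_
        rw [Finset.mem_Icc] at hk
        rw [← Finset.mul_sum]
        congr 1
        have hle : Y ≤ T / k := by
          rw [Nat.le_div_iff_mul_le (by omega)]
          exact (Nat.mul_le_mul_left Y hk.2).trans hY1
        have hsp2 : Finset.Icc 1 (T / k) = Finset.Icc 1 Y ∪ Finset.Ioc Y (T / k) := by ext m; simp; omega
        unfold SN
        rw [hsp2, Finset.sum_union (by rw [Finset.disjoint_left]; intro m; simp; omega)]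
        ring
      · intro m k
        simp only [Finset.mem_Ioc, Finset.mem_Icc]
        constructor
        · rintro ⟨⟨a1, a2⟩, a3, a4⟩
          rw [Nat.le_div_iff_mul_le (by omega)] at a4
          refine ⟨⟨a1, ?_⟩, a3, ?_⟩
          · rw [Nat.le_div_iff_mul_le (by omega), mul_comm]; exact a4
          · by_contra h
            have : (Y + 1) * (Y + 1) ≤ k * m := Nat.mul_le_mul (by omega) (by omega)
            omega
        · rintro ⟨⟨a1, a2⟩, a3, a4⟩
          rw [Nat.le_div_iff_mul_le (by omega)] at a2
          refine ⟨⟨a1, ?_⟩, a3, ?_⟩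
          · nlinarith
          · rw [Nat.le_div_iff_mul_le (by omega), mul_comm]; exact a2
    rw [h1]
    refine (Finset.abs_sum_le_sum_abs _ _).trans (Finset.sum_le_sum fun k _ => ?_)
    rw [abs_mul]
    calc _ ≤ 1 * |SN (T / k) x - SN Y x| := by gcongr; exact abs_moebius_real k
      _ ≤ _ := by rw [one_mul]; exact abs_sub _ _

lemma harm_bound {ε : ℝ} (hε : 0 < ε) : ∃ K : ℝ, 0 < K ∧ ∀ T : ℕ, 1 ≤ T →
    ∑ j ∈ Finset.range (T + 1), 1 / ((j:ℝ) + 1) ≤ K * (T:ℝ) ^ ε := by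
  refine ⟨1 + 2 ^ ε / ε, by positivity, fun T hT => ?_⟩
  have hT' : (1:ℝ) ≤ T := by exact_mod_cast hT
  have h1 : ∑ j ∈ Finset.range (T + 1), 1 / ((j:ℝ) + 1) ≤ 1 + Real.log ((T + 1 : ℕ):ℝ) := by
    have := harmonic_le_one_add_log (T + 1)
    unfold harmonic at this
    push_cast at this ⊢
    simpa using this
  have h2 : Real.log ((T + 1 : ℕ):ℝ) ≤ ((T + 1 : ℕ):ℝ) ^ ε / ε :=
    Real.log_le_rpow_div (by positivity) hε
  have h3 : ((T + 1 : ℕ):ℝ) ^ ε ≤ 2 ^ ε * (T:ℝ) ^ ε := by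
    rw [← Real.mul_rpow (by norm_num) (by positivity)]
    gcongr
    push_cast; linarith
  have h4 : 1 ≤ (T:ℝ) ^ ε := Real.one_le_rpow hT' hε.le
  have h5 : ((T + 1 : ℕ):ℝ) ^ ε / ε ≤ 2 ^ ε * (T:ℝ) ^ ε / ε := by gcongr
  have h6 : (1 + 2 ^ ε / ε) * (T:ℝ) ^ ε = (T:ℝ) ^ ε + 2 ^ ε * (T:ℝ) ^ ε / ε := by ring
  linarith

lemma sqrt_sqrt_le (T : ℕ) : √((T.sqrt : ℕ) : ℝ) ≤ (T:ℝ) ^ (1/4 : ℝ) := by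
  have h1 : ((T.sqrt : ℕ) : ℝ) ≤ √T := Real.nat_sqrt_le_real_sqrt
  calc _ ≤ √(√(T:ℝ)) := Real.sqrt_le_sqrt h1
    _ = _ := by
      rw [Real.sqrt_eq_rpow, Real.sqrt_eq_rpow, ← Real.rpow_mul (by positivity)]; norm_num

theorem CT_sub_FG_RH (hRH : RiemannHypothesis) :
    ∀ ε : ℝ, 0 < ε → ∃ K : ℝ, 0 < K ∧ ∀ T : ℕ, 2 ≤ T →
      |(C T : ℝ) - (F T : ℝ) * G T| ≤ K * (T : ℝ) ^ ((11 : ℝ) / 4 + ε) := by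
  intro ε hε
  obtain ⟨K1, hK1, hM⟩ := Mr_bound hRH hε
  obtain ⟨K2, hK2, hL⟩ := harm_bound hε
  refine ⟨4 * K1 + 180 * K2 + 1, by positivity, fun T hT => ?_⟩
  have hT1 : (1:ℝ) ≤ T := by exact_mod_cast (by omega : 1 ≤ T)
  have hT0 : (0:ℝ) < T := by linarith
  set Y := T.sqrt with hY
  have hY1 : 1 ≤ Y := Nat.sqrt_pos.2 (by omega)
  have hYT : Y ≤ T := Nat.sqrt_le_self T
  set L := ∑ j ∈ Finset.range (T + 1), 1 / ((j:ℝ) + 1) with hLdef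
  have hL0 : 0 ≤ L := Finset.sum_nonneg fun j _ => by positivity
  set Q : ℝ := (T:ℝ) ^ 2 with hQ
  have hQ1 : 1 ≤ Q := one_le_pow₀ hT1
  have hTQ : (T:ℝ) ≤ Q := by rw [hQ]; nlinarith
  set A : Finset ℝ := (fareyHalf T).image (fun q : ℚ => (q:ℝ)) with hA
  have hAmem : ∀ u ∈ A, ∃ q ∈ fareyHalf T, (q:ℝ) = u := fun u hu => by simpa [hA] using hu
  have hsum : ∀ f : ℝ → ℝ, ∑ q ∈ fareyHalf T, f q = ∑ ξ ∈ A, f ξ := fun f => by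
    rw [hA, Finset.sum_image]
    intro a _ b _ h; simpa using h
  have hhalf : ∀ q ∈ fareyHalf T, q ∈ farey T ∧ q ≤ 1/2 := fun q hq => Finset.mem_filter.1 hq
  have hsep : ∀ u ∈ A, ∀ v ∈ A, u ≠ v → 1 ≤ Q * |u - v| := by
    intro u hu v hv hne
    obtain ⟨a, ha, rfl⟩ := hAmem u hu
    obtain ⟨b, hb, rfl⟩ := hAmem v hv
    have := farey_sep (hhalf a ha).1 (hhalf b hb).1 (fun h => hne (by rw [h]))
    rw [hQ]
    exact_mod_cast this
  have h0 : ∀ u ∈ A, 0 ≤ u := by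
    intro u hu
    obtain ⟨a, ha, rfl⟩ := hAmem u hu
    exact_mod_cast (farey_mem (hhalf a ha).1).1
  have h1 : ∀ u ∈ A, u ≤ 1/2 := by
    intro u hu
    obtain ⟨a, ha, rfl⟩ := hAmem u hu
    have := (hhalf a ha).2
    have h2 : ((a:ℚ):ℝ) ≤ ((1/2 : ℚ) : ℝ) := by exact_mod_cast this
    simpa using h2
  have hcard : (A.card : ℝ) ≤ 2 * Q := by
    have : (A.card : ℝ) ≤ Q * (1/2) + 1 := by
      refine count_sep (by linarith) (by norm_num) hsep fun u hu v hv => ?_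
      rw [abs_le]; constructor <;> linarith [h0 u hu, h0 v hv, h1 u hu, h1 v hv]
    linarith
  have hmain : (C T : ℝ) - (F T : ℝ) * G T =
      ∑ ξ ∈ A, (-(∑ m ∈ Finset.Icc 1 T, Mr (T / m) * psi (m * ξ ^ 2)) - 1/2) := by
    rw [← hsum (fun ξ => -(∑ m ∈ Finset.Icc 1 T, Mr (T / m) * psi (m * ξ ^ 2)) - 1/2)]
    unfold C G
    push_cast
    rw [Finset.mul_sum, ← Finset.sum_sub_distrib]
    refine Finset.sum_congr rfl fun q hq => ?_
    have hq0 := (farey_mem (hhalf q hq).1).1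
    have hq1 := (hhalf q hq).2
    have := disc_eq T (by omega) (x := q ^ 2) (by positivity) (by nlinarith)
    push_cast at this
    exact this
  have havg : ∀ N : ℕ, 1 ≤ N → N ≤ T → ∑ ξ ∈ A, |SN N (ξ ^ 2)| ≤ 60 * Q * L * √(N:ℝ) := by
    intro N hN hNT
    have hNT' : (N:ℝ) ≤ T := by exact_mod_cast hNT
    refine (avg_bound hQ1 hsep h0 h1 hN (hNT'.trans hTQ)).trans ?_
    have a1 : ((N.sqrt : ℕ) : ℝ) ≤ √N := Real.nat_sqrt_le_real_sqrt
    have a2 : ∑ j ∈ Finset.range (N + 1), 1 / ((j:ℝ) + 1) ≤ L := by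
      apply Finset.sum_le_sum_of_subset_of_nonneg
      · intro j; simp; omega
      · intro j _ _; positivity
    calc _ ≤ 60 * (√N * Q * L) := by
          have : 0 ≤ ∑ j ∈ Finset.range (N + 1), 1 / ((j:ℝ) + 1) :=
            Finset.sum_nonneg fun j _ => by positivity
          gcongr
      _ = _ := by ring
  -- the Mertens part
  have hYq : √(Y:ℝ) ≤ (T:ℝ) ^ (1/4 : ℝ) := sqrt_sqrt_le T
  have hMs : ∑ m ∈ Finset.Icc 1 Y, |Mr (T / m)| ≤ 2 * K1 * (T:ℝ) ^ (3/4 + ε) := by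
    have hm : ∀ m ∈ Finset.Icc 1 Y, |Mr (T / m)| ≤ K1 * (T:ℝ) ^ (1/2 + ε) * (1 / √(m:ℝ)) := by
      intro m hm
      have hm1 : (1:ℝ) ≤ m := by exact_mod_cast (Finset.mem_Icc.1 hm).1
      refine (hM _).trans ?_
      rw [mul_assoc]
      gcongr
      calc ((T / m : ℕ) : ℝ) ^ (1/2 + ε) ≤ ((T:ℝ) / m) ^ (1/2 + ε) := by
            gcongr; exact Nat.cast_div_le
        _ = (T:ℝ) ^ (1/2 + ε) * (1 / (m:ℝ) ^ (1/2 + ε)) := by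
            rw [Real.div_rpow hT0.le (by linarith)]; ring
        _ ≤ _ := by
            rw [Real.sqrt_eq_rpow]
            gcongr
            · linarith
    refine (Finset.sum_le_sum hm).trans ?_
    rw [← Finset.mul_sum]
    calc _ ≤ K1 * (T:ℝ) ^ (1/2 + ε) * (2 * (T:ℝ) ^ (1/4 : ℝ)) := by
          gcongr; exact (sum_inv_sqrt Y).trans (by gcongr)
      _ = 2 * K1 * ((T:ℝ) ^ (1/2 + ε) * (T:ℝ) ^ (1/4 : ℝ)) := by ring
      _ = _ := by rw [← Real.rpow_add hT0]; congr 2; ring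
  have hSs : ∑ ξ ∈ A, ∑ k ∈ Finset.Icc 1 Y, (|SN (T / k) (ξ ^ 2)| + |SN Y (ξ ^ 2)|) ≤
      180 * Q * L * (T:ℝ) ^ (3/4 : ℝ) := by
    rw [Finset.sum_comm]
    have hk : ∀ k ∈ Finset.Icc 1 Y, ∑ ξ ∈ A, (|SN (T / k) (ξ ^ 2)| + |SN Y (ξ ^ 2)|) ≤
        60 * Q * L * (√(T:ℝ) * (1 / √(k:ℝ)) + √(Y:ℝ)) := by
      intro k hk
      rw [Finset.mem_Icc] at hk
      rw [Finset.sum_add_distrib, mul_add]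
      refine add_le_add ?_ (havg Y hY1 hYT)
      refine (havg (T / k) (Nat.div_pos (hk.2.trans hYT) (by omega)) (Nat.div_le_self _ _)).trans ?_
      gcongr
      rw [mul_one_div, ← Real.sqrt_div hT0.le]
      exact Real.sqrt_le_sqrt Nat.cast_div_le
    refine (Finset.sum_le_sum hk).trans ?_
    rw [← Finset.mul_sum, Finset.sum_add_distrib, ← Finset.mul_sum, Finset.sum_const, Nat.card_Icc,
      Nat.add_sub_cancel, nsmul_eq_mul]
    have hYs : (Y:ℝ) ≤ √T := Real.nat_sqrt_le_real_sqrt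
    have e1 : √(T:ℝ) * ∑ k ∈ Finset.Icc 1 Y, 1 / √(k:ℝ) ≤ √(T:ℝ) * (2 * √(Y:ℝ)) := by
      gcongr; exact sum_inv_sqrt Y
    have e2 : (Y:ℝ) * √(Y:ℝ) ≤ √(T:ℝ) * √(Y:ℝ) := by gcongr
    have e3 : √(T:ℝ) * √(Y:ℝ) ≤ (T:ℝ) ^ (3/4 : ℝ) := by
      calc _ ≤ (T:ℝ) ^ (1/2 : ℝ) * (T:ℝ) ^ (1/4 : ℝ) := by rw [Real.sqrt_eq_rpow]; gcongr
        _ = _ := by rw [← Real.rpow_add hT0]; norm_num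
    calc _ ≤ 60 * Q * L * (3 * (T:ℝ) ^ (3/4 : ℝ)) := by gcongr; linarith
      _ = _ := by ring
  have hpow1 : Q * (T:ℝ) ^ (3/4 + ε) = (T:ℝ) ^ ((11:ℝ)/4 + ε) := by
    rw [hQ, ← Real.rpow_natCast, ← Real.rpow_add hT0]; congr 1; push_cast; ring
  have hpow2 : Q * (T:ℝ) ^ ε * (T:ℝ) ^ (3/4 : ℝ) = (T:ℝ) ^ ((11:ℝ)/4 + ε) := by
    rw [mul_assoc, ← Real.rpow_add hT0, ← hpow1, add_comm ε]
  have hpow3 : Q ≤ (T:ℝ) ^ ((11:ℝ)/4 + ε) := by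
    rw [← hpow1]
    have : 1 ≤ (T:ℝ) ^ (3/4 + ε) := Real.one_le_rpow hT1 (by linarith)
    nlinarith
  rw [hmain]
  calc _ ≤ ∑ ξ ∈ A, (2 * K1 * (T:ℝ) ^ (3/4 + ε) +
        ∑ k ∈ Finset.Icc 1 Y, (|SN (T / k) (ξ ^ 2)| + |SN Y (ξ ^ 2)|) + 1/2) := by
        refine (Finset.abs_sum_le_sum_abs _ _).trans (Finset.sum_le_sum fun ξ _ => ?_)
        refine (abs_sub _ _).trans ?_
        rw [abs_neg]
        have := hyperbola T (ξ ^ 2)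
        have h2 : |(1:ℝ)/2| = 1/2 := by norm_num
        rw [h2]
        linarith
    _ ≤ 2 * Q * (2 * K1 * (T:ℝ) ^ (3/4 + ε)) + 180 * Q * L * (T:ℝ) ^ (3/4 : ℝ) + 2 * Q * (1/2) := by
        rw [Finset.sum_add_distrib, Finset.sum_add_distrib, Finset.sum_const, Finset.sum_const,
          nsmul_eq_mul, nsmul_eq_mul]
        gcongr
    _ ≤ 2 * Q * (2 * K1 * (T:ℝ) ^ (3/4 + ε)) + 180 * Q * (K2 * (T:ℝ) ^ ε) * (T:ℝ) ^ (3/4 : ℝ) + Q := by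
        have := hL T (by omega)
        have h3 : 180 * Q * L * (T:ℝ) ^ (3/4 : ℝ) ≤ 180 * Q * (K2 * (T:ℝ) ^ ε) * (T:ℝ) ^ (3/4 : ℝ) := by
          gcongr
        linarith
    _ = 4 * K1 * (Q * (T:ℝ) ^ (3/4 + ε)) + 180 * K2 * (Q * (T:ℝ) ^ ε * (T:ℝ) ^ (3/4 : ℝ)) + Q := by ring
    _ ≤ _ := by rw [hpow1, hpow2]; linarith
end
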